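/- For every integer n ≥ 6, every planar simple graph G on n vertices that contains no cycle of length 6 as a subgraph satisfies e(G) ≤ 18(n−2)/7. In particular, ex_P(n, C₆) ≤ 18(n−2)/7 for all n ≥ 6. -/

import Mathlib

open SimpleGraph

/-- `G` has a planar embedding (drawing in the plane): vertices are mapped to distinct
points of `ℝ²`, each edge `uv` is drawn as a simple continuous arc from the point of `u`
to the point of `v`, arcs traversed in opposite directions coincide, the interior of an
arc passes through no vertex point, and the interiors of arcs of distinct edges are
disjoint. -/
def SimpleGraph.HasPlanarEmbedding {V : Type*} (G : SimpleGraph V) : Prop :=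
  ∃ (pos : V → ℝ × ℝ) (arc : V → V → ℝ → ℝ × ℝ),
    Function.Injective pos ∧
    (∀ u v : V, G.Adj u v →
      ContinuousOn (arc u v) (Set.Icc (0 : ℝ) 1) ∧
      Set.InjOn (arc u v) (Set.Icc (0 : ℝ) 1) ∧
      arc u v 0 = pos u ∧
      arc u v 1 = pos v ∧
      (∀ t : ℝ, arc u v t = arc v u (1 - t)) ∧
      (∀ w : V, ∀ t ∈ Set.Ioo (0 : ℝ) 1, arc u v t ≠ pos w)) ∧
    (∀ u v x y : V, G.Adj u v → G.Adj x y → s(u, v) ≠ s(x, y) →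
      ∀ t₁ ∈ Set.Ioo (0 : ℝ) 1, ∀ t₂ ∈ Set.Ioo (0 : ℝ) 1, arc u v t₁ ≠ arc x y t₂)

/-- `G` contains a subgraph isomorphic to `F`, i.e. there is an injective graph
homomorphism from `F` to `G`. -/
def ContainsCopy {α β : Type*} (F : SimpleGraph α) (G : SimpleGraph β) : Prop :=
  ∃ f : F →g G, Function.Injective f

/-- The Theta graph on 4 vertices: the 4-cycle 0-1-2-3-0 plus the chord 02,
i.e. `K₄` minus one edge. -/
def theta4 : SimpleGraph (Fin 4) :=
  SimpleGraph.fromEdgeSet {s(0, 1), s(1, 2), s(2, 3), s(0, 3), s(0, 2)}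

/-- The Theta graph on 5 vertices: the 5-cycle 0-1-2-3-4-0 plus the chord 02. -/
def theta5 : SimpleGraph (Fin 5) :=
  SimpleGraph.fromEdgeSet {s(0, 1), s(1, 2), s(2, 3), s(3, 4), s(0, 4), s(0, 2)}

/-- The cycle on 6 vertices: 0-1-2-3-4-5-0. -/
def cycle6 : SimpleGraph (Fin 6) :=
  SimpleGraph.fromEdgeSet {s(0, 1), s(1, 2), s(2, 3), s(3, 4), s(4, 5), s(0, 5)}

/-- `G` contains no member of `Θ₆` as a subgraph: for each pair of distinct
non-consecutive vertices `a`, `b` of the 6-cycle, `G` contains no copy of the Theta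
graph obtained from the 6-cycle by adding the chord `ab`. -/
def Theta6Free {β : Type*} (G : SimpleGraph β) : Prop :=
  ∀ a b : Fin 6, a ≠ b → ¬ cycle6.Adj a b →
    ¬ ContainsCopy (cycle6 ⊔ SimpleGraph.fromEdgeSet {s(a, b)}) G

/-- `K₅⁻`: the complete graph on 5 vertices minus one edge. -/
def K5minus : SimpleGraph (Fin 5) :=
  (⊤ : SimpleGraph (Fin 5)).deleteEdges {s(0, 1)}

/-- The sign `±1` attached to an element of `ZMod 2`. -/
noncomputable def zsign (s : ZMod 2) : ℂ := if s = 0 then 1 else -1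

lemma zmod_two_cases (s : ZMod 2) : s = 0 ∨ s = 1 := by
  revert s; decide

lemma zmod_two_add_self (s : ZMod 2) : s + s = 0 := by
  revert s; decide

lemma zsign_zero : zsign 0 = 1 := by simp [zsign]

lemma zsign_one : zsign 1 = -1 := by simp [zsign]

lemma zsign_add (s t : ZMod 2) : zsign (s + t) = zsign s * zsign t := by
  rcases zmod_two_cases s with rfl | rfl <;> rcases zmod_two_cases t with rfl | rfl <;>
    simp [zsign, zmod_two_add_self]

lemma zsign_mul_self (s : ZMod 2) : zsign s * zsign s = 1 := by
  rw [← zsign_add, zmod_two_add_self, zsign_zero]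

lemma zsign_injective : Function.Injective zsign := by
  intro s t h
  rcases zmod_two_cases s with rfl | rfl <;> rcases zmod_two_cases t with rfl | rfl <;>
    simp [zsign] at h ⊢ <;> norm_num at h

/-- The principal square root. -/
noncomputable def rt (w : ℂ) : ℂ := w ^ (2⁻¹ : ℂ)

lemma rt_sq (w : ℂ) : rt w ^ 2 = w := by
  simp [rt]

lemma rt_ne_zero {w : ℂ} (hw : w ≠ 0) : rt w ≠ 0 := by
  intro h
  apply hw
  rw [← rt_sq w, h]; simp

lemma exists_zsign_of_sq_eq {a b : ℂ} (h : a ^ 2 = b ^ 2) : ∃ s, a = zsign s * b := by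
  rcases sq_eq_sq_iff_eq_or_eq_neg.1 h with h | h
  · exact ⟨0, by simp [zsign, h]⟩
  · exact ⟨1, by simp [zsign, h]⟩

lemma continuousOn_rt : ContinuousOn rt Complex.slitPlane := by
  intro z hz
  exact (continuousAt_id.cpow continuousAt_const hz).continuousWithinAt

lemma rt_re_nonneg (w : ℂ) : 0 ≤ (rt w).re := by
  rw [rt]
  rcases eq_or_ne w 0 with rfl | hw
  · simp
  rw [Complex.cpow_def_of_ne_zero hw, Complex.exp_re]
  apply mul_nonneg (Real.exp_pos _).le
  apply Real.cos_nonneg_of_mem_Icc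
  have h1 := Complex.neg_pi_lt_arg w
  have h2 := Complex.arg_le_pi w
  have : (Complex.log w * 2⁻¹).im = w.arg / 2 := by
    simp [Complex.mul_im, Complex.log_im, div_eq_mul_inv]
  rw [this]
  constructor <;> linarith

lemma rt_eq_of_sq_eq {z w : ℂ} (h : z ^ 2 = w) (hz : 0 < z.re) : rt w = z := by
  have h1 : rt w ^ 2 = z ^ 2 := by rw [rt_sq, h]
  rcases sq_eq_sq_iff_eq_or_eq_neg.1 h1 with h | h
  · exact h
  · have := rt_re_nonneg w
    rw [h] at this
    simp at this
    linarith

lemma exists_continuousOn_sqrt {f : ℝ → ℂ} (hf : ContinuousOn f (Set.Icc 0 1))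
    (h0 : ∀ t ∈ Set.Icc (0 : ℝ) 1, f t ≠ 0) :
    ∃ h : ℝ → ℂ, ContinuousOn h (Set.Icc 0 1) ∧ ∀ t ∈ Set.Icc (0 : ℝ) 1, h t ^ 2 = f t := by
  have cov := isCoveringMap_npow (𝕜 := ℂ) 2 (by norm_num)
  let γ : C(unitInterval, {x : ℂ // x ≠ 0}) :=
    ⟨fun t => ⟨f t, h0 t t.2⟩, by
      apply Continuous.subtype_mk
      exact continuousOn_iff_continuous_domRestrict.1 hf⟩
  obtain ⟨Γ, hΓ, -⟩ := cov.exists_path_lifts γ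
    ⟨rt (f 0), rt_ne_zero (h0 0 (by simp))⟩ (by
      apply Subtype.ext
      simp [γ, rt_sq])
  refine ⟨fun t => (Γ (Set.projIcc 0 1 zero_le_one t)).1, ?_, ?_⟩
  · apply Continuous.continuousOn
    exact continuous_subtype_val.comp (Γ.continuous.comp continuous_projIcc)
  · intro t ht
    have := congrArg Subtype.val (congrFun hΓ (Set.projIcc 0 1 zero_le_one t))
    simp only [Function.comp] at this
    rw [Set.projIcc_of_mem zero_le_one ht] at this
    simp only [Set.projIcc_of_mem zero_le_one ht]
    exact this

/-- The half winding number modulo `2` of the curve `γ` on `[0, 1]` around `p`, measured against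
principal square roots at the two ends. -/
def IsEvenCurve (p : ℂ) (γ : ℝ → ℂ) : Prop :=
  ∃ h : ℝ → ℂ, ContinuousOn h (Set.Icc 0 1) ∧ (∀ t ∈ Set.Icc (0 : ℝ) 1, h t ^ 2 = γ t - p) ∧
    h 0 = rt (γ 0 - p) ∧ h 1 = rt (γ 1 - p)

open Classical in
/-- The parity of a curve relative to a point. -/
noncomputable def curveParity (p : ℂ) (γ : ℝ → ℂ) : ZMod 2 := if IsEvenCurve p γ then 0 else 1

lemma curveParity_eq {p : ℂ} {γ : ℝ → ℂ} (hp : ∀ t ∈ Set.Icc (0 : ℝ) 1, γ t ≠ p)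
    {h : ℝ → ℂ} (hc : ContinuousOn h (Set.Icc 0 1))
    (hs : ∀ t ∈ Set.Icc (0 : ℝ) 1, h t ^ 2 = γ t - p) {s₀ s₁ : ZMod 2}
    (h0 : h 0 = zsign s₀ * rt (γ 0 - p)) (h1 : h 1 = zsign s₁ * rt (γ 1 - p)) :
    curveParity p γ = s₀ + s₁ := by
  have hm0 : (0 : ℝ) ∈ Set.Icc (0 : ℝ) 1 := by simp
  have hm1 : (1 : ℝ) ∈ Set.Icc (0 : ℝ) 1 := by simp
  have n0 : rt (γ 0 - p) ≠ 0 := rt_ne_zero (sub_ne_zero.2 (hp 0 hm0))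
  have n1 : rt (γ 1 - p) ≠ 0 := rt_ne_zero (sub_ne_zero.2 (hp 1 hm1))
  have key : IsEvenCurve p γ ↔ s₀ = s₁ := by
    constructor
    · rintro ⟨k, kc, ks, k0, k1⟩
      have hne : ∀ {x : ℝ}, x ∈ Set.Icc (0 : ℝ) 1 → k x ≠ 0 := by
        intro x hx h0
        have := ks x hx
        rw [h0] at this
        exact hp x hx (sub_eq_zero.1 (by rw [← this]; simp))
      have hsq : Set.EqOn (h ^ 2) (k ^ 2) (Set.Icc 0 1) := by
        intro t ht
        simp [hs t ht, ks t ht]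
      rcases isPreconnected_Icc.eq_or_eq_neg_of_sq_eq hc kc hsq hne with e | e
      · have a0 := e hm0
        have a1 := e hm1
        rw [h0, k0] at a0
        rw [h1, k1] at a1
        have a0' := mul_right_cancel₀ n0 (a0.trans (one_mul _).symm)
        have a1' := mul_right_cancel₀ n1 (a1.trans (one_mul _).symm)
        exact zsign_injective (a0'.trans a1'.symm)
      · have a0 := e hm0
        have a1 := e hm1
        simp only [Pi.neg_apply] at a0 a1
        rw [h0, k0] at a0
        rw [h1, k1] at a1
        have a0' := mul_right_cancel₀ n0 (a0.trans (neg_one_mul _).symm)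
        have a1' := mul_right_cancel₀ n1 (a1.trans (neg_one_mul _).symm)
        exact zsign_injective (a0'.trans a1'.symm)
    · rintro rfl
      refine ⟨fun t => zsign s₀ * h t, continuousOn_const.mul hc, ?_, ?_, ?_⟩
      · intro t ht
        rw [mul_pow, hs t ht, sq, zsign_mul_self, one_mul]
      · dsimp only
        rw [h0, ← mul_assoc, zsign_mul_self, one_mul]
      · dsimp only
        rw [h1, ← mul_assoc, zsign_mul_self, one_mul]
  unfold curveParity
  by_cases h : s₀ = s₁
  · rw [if_pos (key.2 h), h, zmod_two_add_self]
  · rw [if_neg (fun hh => h (key.1 hh))]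
    rcases zmod_two_cases s₀ with rfl | rfl <;> rcases zmod_two_cases s₁ with rfl | rfl <;>
      simp at h ⊢

/-- The correction term comparing parities relative to two points at a curve end `a`. -/
noncomputable def endTwist (p q a : ℂ) : ZMod 2 :=
  if rt ((a - p) / (a - q)) * rt (a - q) = rt (a - p) then 0 else 1

lemma endTwist_spec {p q a : ℂ} (hq : a ≠ q) :
    rt ((a - p) / (a - q)) * rt (a - q) = zsign (endTwist p q a) * rt (a - p) := by
  have h : (rt ((a - p) / (a - q)) * rt (a - q)) ^ 2 = rt (a - p) ^ 2 := by
    rw [mul_pow, rt_sq, rt_sq, rt_sq, div_mul_cancel₀ _ (sub_ne_zero.2 hq)]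
  unfold endTwist
  split_ifs with hh
  · rw [hh, zsign_zero, one_mul]
  · rcases sq_eq_sq_iff_eq_or_eq_neg.1 h with h | h
    · exact absurd h hh
    · rw [h, zsign_one, neg_one_mul]

lemma curveParity_add {p q : ℂ} {γ : ℝ → ℂ} (hγ : ContinuousOn γ (Set.Icc 0 1))
    (hp : ∀ t ∈ Set.Icc (0 : ℝ) 1, γ t ≠ p) (hq : ∀ t ∈ Set.Icc (0 : ℝ) 1, γ t ≠ q)
    {g : ℝ → ℂ} (gc : ContinuousOn g (Set.Icc 0 1))
    (gs : ∀ t ∈ Set.Icc (0 : ℝ) 1, g t ^ 2 = (γ t - p) / (γ t - q)) {s₀ s₁ : ZMod 2}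
    (g0 : g 0 = zsign s₀ * rt ((γ 0 - p) / (γ 0 - q)))
    (g1 : g 1 = zsign s₁ * rt ((γ 1 - p) / (γ 1 - q))) :
    curveParity p γ + curveParity q γ =
      endTwist p q (γ 0) + endTwist p q (γ 1) + (s₀ + s₁) := by
  obtain ⟨h, hc, hs⟩ := exists_continuousOn_sqrt (f := fun t => γ t - q)
    (hγ.sub continuousOn_const) (fun t ht => sub_ne_zero.2 (hq t ht))
  have hm0 : (0 : ℝ) ∈ Set.Icc (0 : ℝ) 1 := by simp
  have hm1 : (1 : ℝ) ∈ Set.Icc (0 : ℝ) 1 := by simp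
  obtain ⟨a, ha⟩ := exists_zsign_of_sq_eq ((hs 0 hm0).trans (rt_sq _).symm)
  obtain ⟨b, hb⟩ := exists_zsign_of_sq_eq ((hs 1 hm1).trans (rt_sq _).symm)
  have e1 := curveParity_eq hq hc hs ha hb
  have e2 : curveParity p γ = (s₀ + a + endTwist p q (γ 0)) + (s₁ + b + endTwist p q (γ 1)) := by
    refine curveParity_eq hp (gc.mul hc) ?_ ?_ ?_
    · intro t ht
      simp only [Pi.mul_apply]
      rw [mul_pow, gs t ht, hs t ht, div_mul_cancel₀ _ (sub_ne_zero.2 (hq t ht))]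
    · simp only [Pi.mul_apply]
      rw [g0, ha, zsign_add, zsign_add]
      linear_combination (zsign s₀ * zsign a) * endTwist_spec (p := p) (hq 0 hm0)
    · simp only [Pi.mul_apply]
      rw [g1, hb, zsign_add, zsign_add]
      linear_combination (zsign s₁ * zsign b) * endTwist_spec (p := p) (hq 1 hm1)
  rw [e1, e2]
  linear_combination zmod_two_add_self a + zmod_two_add_self b

lemma div_mem_slitPlane {p q z : ℂ} (h : z ∉ segment ℝ p q) :
    (z - p) / (z - q) ∈ Complex.slitPlane := by
  have hq : z ≠ q := fun e => h (e ▸ right_mem_segment ℝ p q)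
  by_contra hn
  rw [Complex.mem_slitPlane_iff_not_le_zero, not_not] at hn
  obtain ⟨k, hk, hkk⟩ : ∃ k : ℝ, 0 ≤ k ∧ (z - p) / (z - q) = -k := by
    rw [Complex.le_def] at hn
    refine ⟨-((z - p) / (z - q)).re, by simpa using hn.1, ?_⟩
    apply Complex.ext <;> simp
    exact hn.2
  rw [div_eq_iff (sub_ne_zero.2 hq)] at hkk
  apply h
  have hk1 : (1 + k : ℝ) ≠ 0 := by positivity
  have hk1' : (1 + k : ℂ) ≠ 0 := by exact_mod_cast hk1
  refine ⟨1 / (1 + k), k / (1 + k), by positivity, by positivity, by field_simp, ?_⟩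
  simp only [Complex.real_smul]
  push_cast
  field_simp
  linear_combination -hkk

lemma curveParity_add_of_segment {p q : ℂ} {γ : ℝ → ℂ} (hγ : ContinuousOn γ (Set.Icc 0 1))
    (hs : ∀ t ∈ Set.Icc (0 : ℝ) 1, γ t ∉ segment ℝ p q) :
    curveParity p γ + curveParity q γ = endTwist p q (γ 0) + endTwist p q (γ 1) := by
  have hp : ∀ t ∈ Set.Icc (0 : ℝ) 1, γ t ≠ p :=
    fun t ht e => hs t ht (e ▸ left_mem_segment ℝ p q)
  have hq : ∀ t ∈ Set.Icc (0 : ℝ) 1, γ t ≠ q :=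
    fun t ht e => hs t ht (e ▸ right_mem_segment ℝ p q)
  have := curveParity_add hγ hp hq (g := fun t => rt ((γ t - p) / (γ t - q)))
    (s₀ := 0) (s₁ := 0)
    (continuousOn_rt.comp ((hγ.sub continuousOn_const).div (hγ.sub continuousOn_const)
      (fun t ht => sub_ne_zero.2 (hq t ht))) (fun t ht => div_mem_slitPlane (hs t ht)))
    (fun t _ => rt_sq _) (by simp [zsign_zero]) (by simp [zsign_zero])
  simpa using this

lemma curveParity_add_of_cross {x d : ℂ} (hd : d ≠ 0) {η t₀ : ℝ} (hη : 0 < η) (h0 : 0 < t₀)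
    (h1 : t₀ < 1) :
    let γ : ℝ → ℂ := fun t => x + t * d
    let p : ℂ := x + (t₀ - η * Complex.I) * d
    let q : ℂ := x + (t₀ + η * Complex.I) * d
    curveParity p γ + curveParity q γ = endTwist p q (γ 0) + endTwist p q (γ 1) + 1 := by
  intro γ p q
  have ep : ∀ t, γ t - p = ((t - t₀ : ℝ) + η * Complex.I) * d := by
    intro t; simp only [γ, p]; push_cast; ring
  have eq : ∀ t, γ t - q = ((t - t₀ : ℝ) - η * Complex.I) * d := by
    intro t; simp only [γ, q]; push_cast; ring
  have np : ∀ s : ℝ, (s : ℂ) + η * Complex.I ≠ 0 := by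
    intro s h
    have := congrArg Complex.im h
    simp at this
    exact hη.ne' this
  have nq : ∀ s : ℝ, (s : ℂ) - η * Complex.I ≠ 0 := by
    intro s h
    have := congrArg Complex.im h
    simp at this
    exact hη.ne' this
  have hp : ∀ t ∈ Set.Icc (0 : ℝ) 1, γ t ≠ p := fun t _ =>
    sub_ne_zero.1 (by rw [ep]; exact mul_ne_zero (np _) hd)
  have hq : ∀ t ∈ Set.Icc (0 : ℝ) 1, γ t ≠ q := fun t _ =>
    sub_ne_zero.1 (by rw [eq]; exact mul_ne_zero (nq _) hd)
  have hγ : Continuous γ := by fun_prop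
  have hpos : ∀ s : ℝ, 0 < s ^ 2 + η ^ 2 := fun s => by positivity
  let g : ℝ → ℂ := fun t => ((t - t₀ : ℝ) + η * Complex.I) / (Real.sqrt ((t - t₀) ^ 2 + η ^ 2) : ℝ)
  have gs : ∀ t, g t ^ 2 = (γ t - p) / (γ t - q) := by
    intro t
    rw [ep, eq, mul_div_mul_right _ _ hd]
    simp only [g]
    rw [div_pow, ← Complex.ofReal_pow, Real.sq_sqrt (hpos _).le,
      div_eq_div_iff (by exact_mod_cast (hpos _).ne') (nq _)]
    push_cast
    linear_combination (((t : ℂ) - t₀) + η * Complex.I) * (- η ^ 2) * Complex.I_sq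
  have gre : ∀ t, (g t).re = (t - t₀) / Real.sqrt ((t - t₀) ^ 2 + η ^ 2) := by
    intro t
    simp only [g]
    rw [Complex.div_ofReal_re]
    simp
  have gc : Continuous g := by
    apply Continuous.div
    · fun_prop
    · fun_prop
    · intro t
      exact_mod_cast (Real.sqrt_pos.2 (hpos _)).ne'
  have := curveParity_add hγ.continuousOn hp hq gc.continuousOn (fun t _ => gs t)
    (s₀ := 1) (s₁ := 0) (by
      rw [rt_eq_of_sq_eq (z := - g 0) (by rw [neg_sq, gs]), zsign_one]
      · ring
      · rw [Complex.neg_re, gre]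
        rw [neg_pos]
        exact div_neg_of_neg_of_pos (by linarith) (Real.sqrt_pos.2 (hpos _))) (by
      rw [rt_eq_of_sq_eq (z := g 1) (gs 1), zsign_zero, one_mul]
      rw [gre]
      exact div_pos (by linarith) (Real.sqrt_pos.2 (hpos _)))
  simpa using this

/-- A drawing of `G` in which every edge leaves its end vertices along straight radii of a common
length `ρ` and otherwise stays outside the open discs of radius `ρ` around the vertices. -/
structure StraightDrawing {V : Type*} (G : SimpleGraph V) where
  z : V → ℂ
  ρ : ℝ
  ρ_pos : 0 < ρ
  sep : ∀ u v, u ≠ v → 2 * ρ < dist (z u) (z v)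
  P : V → V → ℂ
  dist_P : ∀ u v, G.Adj u v → dist (P u v) (z u) = ρ
  mid : Sym2 V → ℝ → ℂ
  mid_cont : ∀ e ∈ G.edgeSet, ContinuousOn (mid e) (Set.Icc 0 1)
  mid_zero : ∀ e ∈ G.edgeSet, mid e 0 = P (Quot.out e).1 (Quot.out e).2
  mid_one : ∀ e ∈ G.edgeSet, mid e 1 = P (Quot.out e).2 (Quot.out e).1
  mid_far : ∀ e ∈ G.edgeSet, ∀ t ∈ Set.Icc (0 : ℝ) 1, ∀ w, ρ ≤ dist (mid e t) (z w)
  mid_disj : ∀ e ∈ G.edgeSet, ∀ e' ∈ G.edgeSet, e ≠ e' → ∀ t ∈ Set.Icc (0 : ℝ) 1,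
    ∀ t' ∈ Set.Icc (0 : ℝ) 1, mid e t ≠ mid e' t'

lemma sym2_out_eq {V : Type*} (e : Sym2 V) : s((Quot.out e).1, (Quot.out e).2) = e := by
  exact Quot.out_eq e

lemma sym2_out_cases {V : Type*} (u v : V) :
    (Quot.out s(u, v) = (u, v)) ∨ (Quot.out s(u, v) = (v, u)) := by
  have h := sym2_out_eq s(u, v)
  rw [Sym2.eq_iff] at h
  rcases h with ⟨h1, h2⟩ | ⟨h1, h2⟩
  · exact Or.inl (Prod.ext h1 h2)
  · exact Or.inr (Prod.ext h1 h2)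

/-- Edge sets, as functions to `ZMod 2`, in which every vertex has even degree. -/
def SimpleGraph.evenChains {V : Type*} [Fintype V] (G : SimpleGraph V) :
    Submodule (ZMod 2) (Sym2 V → ZMod 2) where
  carrier := {c | (∀ e, e ∉ G.edgeSet → c e = 0) ∧ ∀ v, ∑ w, c s(v, w) = 0}
  add_mem' := by
    rintro a b ⟨h1, h2⟩ ⟨h3, h4⟩
    refine ⟨fun e he => by simp [h1 e he, h3 e he], fun v => ?_⟩
    simp [Finset.sum_add_distrib, h2 v, h4 v]
  zero_mem' := by simp
  smul_mem' := by
    rintro k a ⟨h1, h2⟩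
    refine ⟨fun e he => by simp [h1 e he], fun v => ?_⟩
    simp [← Finset.mul_sum, h2 v]

lemma sum_sym2_eq_sum_sum {V : Type*} [Fintype V] [DecidableEq V] (c : Sym2 V → ZMod 2)
    (hc : ∀ v, c s(v, v) = 0) (f : V → ZMod 2) :
    ∑ e : Sym2 V, c e * (f (Quot.out e).1 + f (Quot.out e).2) = ∑ v, ∑ w, f v * c s(v, w) := by
  rw [← Fintype.sum_prod_type' (f := fun v w => f v * c s(v, w)),
    ← Finset.sum_fiberwise (s := Finset.univ) (g := fun p : V × V => s(p.1, p.2))]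
  apply Finset.sum_congr rfl
  intro e _
  obtain ⟨p, hp⟩ : ∃ p, p = Quot.out e := ⟨_, rfl⟩
  have he : s(p.1, p.2) = e := by rw [hp]; exact sym2_out_eq e
  rw [← hp]
  by_cases hd : p.1 = p.2
  · have : c e = 0 := by rw [← he, hd]; exact hc _
    rw [this, zero_mul]
    symm
    apply Finset.sum_eq_zero
    intro x hx
    rw [(Finset.mem_filter.1 hx).2, this, mul_zero]
  · have : (Finset.univ.filter fun x : V × V => s(x.1, x.2) = e) = {p, (p.2, p.1)} := by
      ext x
      simp only [Finset.mem_filter, Finset.mem_univ, true_and, Finset.mem_insert,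
        Finset.mem_singleton]
      rw [← he, Sym2.eq_iff]
      simp [Prod.ext_iff]
    rw [this, Finset.sum_pair]
    · have h2 : c s(p.2, p.1) = c e := by rw [Sym2.eq_swap, he]
      simp only [he, h2]
      ring
    · intro h
      exact hd (congrArg Prod.fst h)

namespace StraightDrawing

variable {V : Type*} {G : SimpleGraph V} (D : StraightDrawing G)

/-- The radius at `u` of the edge `uv`. -/
noncomputable def rad (u v : V) (t : ℝ) : ℂ := D.z u + t * (D.P u v - D.z u)

/-- The point set of an edge. -/
def body (e : Sym2 V) : Set ℂ :=
  D.rad (Quot.out e).1 (Quot.out e).2 '' Set.Icc 0 1 ∪ D.mid e '' Set.Icc 0 1 ∪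
    D.rad (Quot.out e).2 (Quot.out e).1 '' Set.Icc 0 1

/-- The parity of an edge relative to a point. -/
noncomputable def parity (e : Sym2 V) (p : ℂ) : ZMod 2 :=
  curveParity p (D.rad (Quot.out e).1 (Quot.out e).2) + curveParity p (D.mid e) +
    curveParity p (D.rad (Quot.out e).2 (Quot.out e).1)

lemma out_adj {e : Sym2 V} (he : e ∈ G.edgeSet) : G.Adj (Quot.out e).1 (Quot.out e).2 := by
  rw [← SimpleGraph.mem_edgeSet, sym2_out_eq]; exact he

lemma continuous_rad (u v : V) : Continuous (D.rad u v) := by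
  unfold rad; fun_prop

lemma rad_zero (u v : V) : D.rad u v 0 = D.z u := by simp [rad]

lemma rad_one (u v : V) : D.rad u v 1 = D.P u v := by simp [rad]

lemma isCompact_body {e : Sym2 V} (he : e ∈ G.edgeSet) : IsCompact (D.body e) :=
  ((isCompact_Icc.image (D.continuous_rad _ _)).union
    (isCompact_Icc.image_of_continuousOn (D.mid_cont e he))).union
    (isCompact_Icc.image (D.continuous_rad _ _))

lemma parity_add_of_segment {e : Sym2 V} (he : e ∈ G.edgeSet) {p q : ℂ}
    (h : ∀ x ∈ D.body e, x ∉ segment ℝ p q) :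
    D.parity e p + D.parity e q =
      endTwist p q (D.z (Quot.out e).1) + endTwist p q (D.z (Quot.out e).2) := by
  have h1 := curveParity_add_of_segment (p := p) (q := q)
    (D.continuous_rad (Quot.out e).1 (Quot.out e).2).continuousOn
    (fun t ht => h _ (Or.inl (Or.inl ⟨t, ht, rfl⟩)))
  have h2 := curveParity_add_of_segment (p := p) (q := q) (D.mid_cont e he)
    (fun t ht => h _ (Or.inl (Or.inr ⟨t, ht, rfl⟩)))
  have h3 := curveParity_add_of_segment (p := p) (q := q)
    (D.continuous_rad (Quot.out e).2 (Quot.out e).1).continuousOn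
    (fun t ht => h _ (Or.inr ⟨t, ht, rfl⟩))
  rw [rad_zero, rad_one] at h1 h3
  rw [D.mid_zero e he, D.mid_one e he] at h2
  unfold parity
  linear_combination h1 + h2 + h3 +
    zmod_two_add_self (endTwist p q (D.P (Quot.out e).1 (Quot.out e).2)) +
    zmod_two_add_self (endTwist p q (D.P (Quot.out e).2 (Quot.out e).1))

set_option linter.unusedSectionVars false

variable [Fintype V] [DecidableEq V]

/-- The parity of a chain relative to a point, as a linear functional of the chain. -/
noncomputable def chainParity (p : ℂ) : (Sym2 V → ZMod 2) →ₗ[ZMod 2] ZMod 2 :=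
  ∑ e, (D.parity e p) • LinearMap.proj e

lemma chainParity_apply (p : ℂ) (c : Sym2 V → ZMod 2) :
    D.chainParity p c = ∑ e, c e * D.parity e p := by
  simp [chainParity, LinearMap.sum_apply, mul_comm]

lemma sum_endTwist {c : Sym2 V → ZMod 2} (hc : c ∈ G.evenChains) (p q : ℂ) :
    ∑ e : Sym2 V, c e *
      (endTwist p q (D.z (Quot.out e).1) + endTwist p q (D.z (Quot.out e).2)) = 0 := by
  rw [sum_sym2_eq_sum_sum c (fun v => hc.1 _ (by simp)) (fun v => endTwist p q (D.z v))]
  apply Finset.sum_eq_zero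
  intro v _
  rw [← Finset.mul_sum, hc.2 v, mul_zero]

lemma chainParity_eq_of_segment {c : Sym2 V → ZMod 2} (hc : c ∈ G.evenChains) {p q : ℂ}
    (h : ∀ e, c e ≠ 0 → ∀ x ∈ D.body e, x ∉ segment ℝ p q) :
    D.chainParity p c = D.chainParity q c := by
  have : D.chainParity p c + D.chainParity q c = 0 := by
    rw [← D.sum_endTwist hc p q, chainParity_apply, chainParity_apply, ← Finset.sum_add_distrib]
    apply Finset.sum_congr rfl
    intro e _
    by_cases h0 : c e = 0
    · simp [h0]
    · have he : e ∈ G.edgeSet := by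
        by_contra hn; exact h0 (hc.1 e hn)
      rw [← mul_add, D.parity_add_of_segment he (h e h0)]
  linear_combination this - zmod_two_add_self (D.chainParity q c)

lemma chainParity_eq_of_isPreconnected {c : Sym2 V → ZMod 2} (hc : c ∈ G.evenChains) {T : Set ℂ}
    (hT : IsPreconnected T) (h : ∀ e, c e ≠ 0 → ∀ x ∈ D.body e, x ∉ T) {p q : ℂ}
    (hp : p ∈ T) (hq : q ∈ T) : D.chainParity p c = D.chainParity q c := by
  classical
  let K : Set ℂ := ⋃ e ∈ {e : Sym2 V | c e ≠ 0}, D.body e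
  have hK : IsClosed K := by
    refine (Set.toFinite _).isClosed_biUnion fun e he => ?_
    exact (D.isCompact_body (by by_contra hn; exact he (hc.1 e hn))).isClosed
  have hcont : ContinuousOn (fun x => decide (D.chainParity x c = D.chainParity q c)) T := by
    intro x hx
    have hxK : x ∈ Kᶜ := by
      simp only [K, Set.mem_compl_iff, Set.mem_iUnion, not_exists]
      intro e he hx'
      exact h e he x hx' hx
    obtain ⟨δ, hδ, hb⟩ := Metric.isOpen_iff.1 hK.isOpen_compl x hxK
    apply ContinuousAt.continuousWithinAt
    apply ContinuousAt.congr (f := fun _ => decide (D.chainParity x c = D.chainParity q c))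
      continuousAt_const
    filter_upwards [Metric.ball_mem_nhds x hδ] with y hy
    rw [D.chainParity_eq_of_segment hc (p := x) (q := y)]
    intro e he a ha has
    have := hb ((convex_ball x δ).segment_subset (Metric.mem_ball_self hδ) hy has)
    exact this (Set.mem_biUnion he ha)
  have := hT.constant hcont hp hq
  simpa using this



end StraightDrawing

namespace StraightDrawing

variable {V : Type*} {G : SimpleGraph V} (D : StraightDrawing G)

/-- The direction in which the edge `vw` leaves `v`. -/
noncomputable def ang (v w : V) : ℝ := (D.P v w - D.z v).arg

/-- The point at distance `ρ / 2` from `v` in direction `ψ`. -/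
noncomputable def near (v : V) (ψ : ℝ) : ℂ := D.z v + (D.ρ / 2 : ℝ) * Complex.exp (ψ * Complex.I)

lemma P_sub {v w : V} (h : G.Adj v w) :
    D.P v w - D.z v = D.ρ * Complex.exp (D.ang v w * Complex.I) := by
  have := Complex.norm_mul_exp_arg_mul_I (D.P v w - D.z v)
  rw [← dist_eq_norm, D.dist_P v w h] at this
  exact this.symm

lemma rad_eq {v w : V} (h : G.Adj v w) (t : ℝ) :
    D.rad v w t = D.z v + (t * D.ρ : ℝ) * Complex.exp (D.ang v w * Complex.I) := by
  rw [rad, D.P_sub h]; push_cast; ring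

lemma dist_rad {v w : V} (h : G.Adj v w) {t : ℝ} (ht : 0 ≤ t) :
    dist (D.rad v w t) (D.z v) = t * D.ρ := by
  rw [D.rad_eq h, dist_eq_norm, add_sub_cancel_left, norm_mul, Complex.norm_exp_ofReal_mul_I,
    mul_one, Complex.norm_real, Real.norm_of_nonneg (mul_nonneg ht D.ρ_pos.le)]

lemma P_mem_mid {v w : V} (h : G.Adj v w) :
    ∃ t ∈ Set.Icc (0 : ℝ) 1, D.mid s(v, w) t = D.P v w := by
  have he : s(v, w) ∈ G.edgeSet := h
  rcases sym2_out_cases v w with h1 | h1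
  · exact ⟨0, by simp, by rw [D.mid_zero _ he, h1]⟩
  · exact ⟨1, by simp, by rw [D.mid_one _ he, h1]⟩

lemma P_injective {v w w' : V} (h : G.Adj v w) (h' : G.Adj v w') (e : D.P v w = D.P v w') :
    w = w' := by
  obtain ⟨t, ht, e1⟩ := D.P_mem_mid h
  obtain ⟨t', ht', e2⟩ := D.P_mem_mid h'
  by_contra hne
  refine D.mid_disj _ h _ h' ?_ t ht t' ht' (by rw [e1, e2, e])
  intro hs
  exact hne (Sym2.congr_right.1 hs)

lemma exp_ang_injective {v w w' : V} (h : G.Adj v w) (h' : G.Adj v w')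
    (e : Complex.exp (D.ang v w * Complex.I) = Complex.exp (D.ang v w' * Complex.I)) : w = w' := by
  apply D.P_injective h h'
  have h1 := D.P_sub h
  have h2 := D.P_sub h'
  rw [← e, ← h1] at h2
  exact (sub_left_inj.1 h2).symm

lemma ang_mem (v w : V) : D.ang v w ∈ Set.Ioc (-Real.pi) Real.pi := Complex.arg_mem_Ioc _

lemma ang_injective {v w w' : V} (h : G.Adj v w) (h' : G.Adj v w')
    (e : D.ang v w = D.ang v w') : w = w' :=
  D.exp_ang_injective h h' (by rw [e])

lemma exists_rad_of_mem_body {e : Sym2 V} (he : e ∈ G.edgeSet) {v : V} {x : ℂ}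
    (hx : x ∈ D.body e) (hv : dist x (D.z v) < D.ρ) :
    ∃ w, e = s(v, w) ∧ ∃ t ∈ Set.Icc (0 : ℝ) 1, x = D.rad v w t := by
  have aux : ∀ a b, G.Adj a b → x ∈ D.rad a b '' Set.Icc 0 1 → a = v := by
    rintro a b hab ⟨t, ht, rfl⟩
    by_contra hne
    have h1 := D.sep a v hne
    have h2 := D.dist_rad hab ht.1
    have h3 := dist_triangle_left (D.z a) (D.z v) (D.rad a b t)
    have h4 : t * D.ρ ≤ D.ρ := mul_le_of_le_one_left D.ρ_pos.le ht.2
    linarith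
  have hadj := out_adj he
  rcases hx with (hx | ⟨t, ht, rfl⟩) | hx
  · have := aux _ _ hadj hx
    obtain ⟨t, ht, hxt⟩ := hx
    rw [this] at hxt
    refine ⟨(Quot.out e).2, ?_, t, ht, hxt.symm⟩
    conv_lhs => rw [← sym2_out_eq e, this]
  · exact absurd hv (not_lt.2 (D.mid_far e he t ht v))
  · have := aux _ _ hadj.symm hx
    obtain ⟨t, ht, hxt⟩ := hx
    rw [this] at hxt
    refine ⟨(Quot.out e).1, ?_, t, ht, hxt.symm⟩
    conv_lhs => rw [← sym2_out_eq e, this, Sym2.eq_swap]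

lemma eq_of_mid_mem_body {e e' : Sym2 V} (he : e ∈ G.edgeSet) (he' : e' ∈ G.edgeSet) {t : ℝ}
    (ht : t ∈ Set.Icc (0 : ℝ) 1) (h : D.mid e t ∈ D.body e') : e = e' := by
  by_contra hne
  have aux : ∀ a b, G.Adj a b → s(a, b) = e' → D.mid e t ∉ D.rad a b '' Set.Icc 0 1 := by
    rintro a b hab hs ⟨t', ht', hh⟩
    have h1 := D.mid_far e he t ht a
    rw [← hh, D.dist_rad hab ht'.1] at h1
    have h2 : t' = 1 := by
      apply le_antisymm ht'.2
      by_contra hlt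
      nlinarith [D.ρ_pos]
    rw [h2, D.rad_one] at hh
    obtain ⟨t2, ht2, e2⟩ := D.P_mem_mid hab
    rw [hs] at e2
    exact D.mid_disj e he e' he' hne t ht t2 ht2 (by rw [e2, hh])
  have hadj := out_adj he'
  rcases h with (h | ⟨t', ht', h⟩) | h
  · exact aux _ _ hadj (sym2_out_eq e') h
  · exact D.mid_disj e he e' he' hne t ht t' ht' h.symm
  · exact aux _ _ hadj.symm (by rw [Sym2.eq_swap]; exact sym2_out_eq e') h

lemma dist_near (v : V) (ψ : ℝ) : dist (D.near v ψ) (D.z v) = D.ρ / 2 := by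
  rw [near, dist_eq_norm, add_sub_cancel_left, norm_mul, Complex.norm_exp_ofReal_mul_I,
    mul_one, Complex.norm_real, Real.norm_of_nonneg (by linarith [D.ρ_pos])]

lemma exp_eq_of_near_mem_body {e : Sym2 V} (he : e ∈ G.edgeSet) {v : V} {ψ : ℝ}
    (h : D.near v ψ ∈ D.body e) :
    ∃ w, e = s(v, w) ∧ Complex.exp (ψ * Complex.I) = Complex.exp (D.ang v w * Complex.I) := by
  obtain ⟨w, hw, t, ht, hx⟩ := D.exists_rad_of_mem_body he h
    (by rw [dist_near]; linarith [D.ρ_pos])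
  have hadj : G.Adj v w := by rw [hw] at he; exact he
  refine ⟨w, hw, ?_⟩
  have h1 := D.dist_near v ψ
  rw [hx, D.dist_rad hadj ht.1] at h1
  rw [D.rad_eq hadj, h1, near] at hx
  have hρ : ((D.ρ / 2 : ℝ) : ℂ) ≠ 0 := by
    have := D.ρ_pos
    exact_mod_cast (half_pos this).ne'
  exact mul_left_cancel₀ hρ (add_left_cancel hx)

lemma near_ang {v w : V} (h : G.Adj v w) : D.near v (D.ang v w) = D.rad v w (1 / 2) := by
  rw [near, D.rad_eq h]
  congr 3
  ring

lemma continuous_near (v : V) : Continuous (D.near v) := by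
  unfold near; fun_prop

variable [Fintype V] [DecidableEq V]

set_option linter.unusedSectionVars false

lemma chainParity_near_eq {c : Sym2 V → ZMod 2} (hc : c ∈ G.evenChains) {v : V} {a b : ℝ}
    (h : ∀ ψ ∈ Set.uIcc a b, ∀ w, G.Adj v w → c s(v, w) ≠ 0 →
      Complex.exp (ψ * Complex.I) ≠ Complex.exp (D.ang v w * Complex.I)) :
    D.chainParity (D.near v a) c = D.chainParity (D.near v b) c := by
  refine D.chainParity_eq_of_isPreconnected hc (T := D.near v '' Set.uIcc a b)
    (isPreconnected_uIcc.image _ (D.continuous_near v).continuousOn) ?_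
    ⟨a, Set.left_mem_uIcc, rfl⟩ ⟨b, Set.right_mem_uIcc, rfl⟩
  rintro e he _ hx ⟨ψ, hψ, rfl⟩
  have hee : e ∈ G.edgeSet := by by_contra hn; exact he (hc.1 e hn)
  obtain ⟨w, rfl, hw⟩ := D.exp_eq_of_near_mem_body hee hx
  exact h ψ hψ w hee he hw

/-- The angle `ε` is so small that no edge at `v` other than `vw` leaves within `ε` of `vw`. -/
def IsSmallAngle (v w : V) (ε : ℝ) : Prop :=
  0 < ε ∧ ε < Real.pi / 2 ∧
    ∀ w', G.Adj v w' → w' ≠ w → Real.cos (D.ang v w' - D.ang v w) < Real.cos ε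

lemma IsSmallAngle.eq {v w w' : V} {ε ψ : ℝ} (hε : D.IsSmallAngle v w ε)
    (hψ : |ψ - D.ang v w| ≤ ε) (hw' : G.Adj v w')
    (h : Complex.exp (ψ * Complex.I) = Complex.exp (D.ang v w' * Complex.I)) : w' = w := by
  by_contra hne
  have h1 := hε.2.2 w' hw' hne
  have h2 : Complex.exp ((ψ - D.ang v w : ℝ) * Complex.I) =
      Complex.exp ((D.ang v w' - D.ang v w : ℝ) * Complex.I) := by
    push_cast
    rw [sub_mul, sub_mul, Complex.exp_sub, Complex.exp_sub, h]
  have h3 := congrArg Complex.re h2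
  rw [Complex.exp_ofReal_mul_I_re, Complex.exp_ofReal_mul_I_re] at h3
  have h4 : Real.cos ε ≤ Real.cos |ψ - D.ang v w| :=
    Real.cos_le_cos_of_nonneg_of_le_pi (abs_nonneg _) (by linarith [hε.2.1, Real.pi_pos]) hψ
  rw [Real.cos_abs] at h4
  linarith

end StraightDrawing

namespace StraightDrawing

variable {V : Type*} {G : SimpleGraph V} (D : StraightDrawing G)

lemma near_add {v w : V} (h : G.Adj v w) (ε : ℝ) :
    D.near v (D.ang v w + ε) = D.z v +
      ((Real.cos ε / 2 : ℝ) + (Real.sin ε / 2 : ℝ) * Complex.I) * (D.P v w - D.z v) := by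
  rw [D.P_sub h, near]
  push_cast
  rw [add_mul, Complex.exp_add, Complex.exp_mul_I (ε : ℂ)]
  ring

lemma near_sub {v w : V} (h : G.Adj v w) (ε : ℝ) :
    D.near v (D.ang v w - ε) = D.z v +
      ((Real.cos ε / 2 : ℝ) - (Real.sin ε / 2 : ℝ) * Complex.I) * (D.P v w - D.z v) := by
  rw [sub_eq_add_neg, D.near_add h, Real.cos_neg, Real.sin_neg]
  push_cast
  ring

lemma dist_lt_of_mem_cross {v w : V} {ε : ℝ} {x : ℂ}
    (hx : x ∈ segment ℝ (D.near v (D.ang v w - ε)) (D.near v (D.ang v w + ε))) :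
    dist x (D.z v) ≤ D.ρ / 2 := by
  have := (convex_closedBall (D.z v) (D.ρ / 2)).segment_subset
    (Metric.mem_closedBall.2 (D.dist_near v (D.ang v w - ε)).le)
    (Metric.mem_closedBall.2 (D.dist_near v (D.ang v w + ε)).le) hx
  exact this

lemma eq_of_mem_cross {v w : V} (h : G.Adj v w) {ε : ℝ} (hε : D.IsSmallAngle v w ε) {x : ℂ}
    (hx : x ∈ segment ℝ (D.near v (D.ang v w - ε)) (D.near v (D.ang v w + ε)))
    {e : Sym2 V} (he : e ∈ G.edgeSet) (hxe : x ∈ D.body e) : e = s(v, w) := by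
  have hρ := D.ρ_pos
  have hd := D.dist_lt_of_mem_cross hx
  obtain ⟨w', rfl, t, ht, hxt⟩ := D.exists_rad_of_mem_body he hxe
    (by linarith : dist x (D.z v) < D.ρ)
  have hadj : G.Adj v w' := he
  by_contra hne
  have hw : w' ≠ w := fun h => hne (by rw [h])
  have hcos := hε.2.2 w' hadj hw
  have ht2 : t ≤ 1 / 2 := by
    rw [hxt, D.dist_rad hadj ht.1] at hd
    by_contra hlt
    nlinarith
  obtain ⟨a, b, ha, hb, hab, rfl⟩ := hx
  rw [D.near_add h, D.near_sub h, D.rad_eq hadj, D.P_sub h] at hxt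
  have hb' : b = 1 - a := by linarith
  have hρ' : (D.ρ : ℂ) ≠ 0 := by exact_mod_cast hρ.ne'
  have e1 : Complex.exp (D.ang v w * Complex.I) ≠ 0 := Complex.exp_ne_zero _
  have key : (t : ℂ) * Complex.exp ((D.ang v w' - D.ang v w : ℝ) * Complex.I) =
      (Real.cos ε / 2 : ℝ) + ((b - a) * (Real.sin ε / 2) : ℝ) * Complex.I := by
    push_cast
    rw [sub_mul, Complex.exp_sub]
    apply mul_right_cancel₀ (mul_ne_zero hρ' e1)
    have hB := div_mul_cancel₀ (Complex.exp (D.ang v w' * Complex.I)) e1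
    simp only [Complex.real_smul] at hxt
    rw [hb'] at hxt ⊢
    push_cast at hxt ⊢
    linear_combination (t * D.ρ : ℂ) * hB - hxt
  have hre := congrArg Complex.re key
  rw [Complex.re_ofReal_mul, Complex.exp_ofReal_mul_I_re] at hre
  simp only [Complex.add_re, Complex.ofReal_re, Complex.re_ofReal_mul, Complex.I_re, mul_zero,
    add_zero] at hre
  have hc : 0 < Real.cos ε := Real.cos_pos_of_mem_Ioo ⟨by linarith [hε.1, Real.pi_pos], hε.2.1⟩
  have ht0 : 0 < t := by
    rcases ht.1.eq_or_lt with h0 | h0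
    · rw [← h0] at hre; linarith
    · exact h0
  nlinarith

lemma parity_cross {v w : V} (h : G.Adj v w) {ε : ℝ} (hε : D.IsSmallAngle v w ε) :
    D.parity s(v, w) (D.near v (D.ang v w - ε)) + D.parity s(v, w) (D.near v (D.ang v w + ε)) =
      endTwist (D.near v (D.ang v w - ε)) (D.near v (D.ang v w + ε)) (D.z v) +
      endTwist (D.near v (D.ang v w - ε)) (D.near v (D.ang v w + ε)) (D.z w) + 1 := by
  have hρ := D.ρ_pos
  have hs : 0 < Real.sin ε :=
    Real.sin_pos_of_pos_of_lt_pi hε.1 (by linarith [hε.2.1, Real.pi_pos])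
  have hc : 0 < Real.cos ε := Real.cos_pos_of_mem_Ioo ⟨by linarith [hε.1, Real.pi_pos], hε.2.1⟩
  have hd : D.P v w - D.z v ≠ 0 := by
    rw [D.P_sub h]
    exact mul_ne_zero (by exact_mod_cast hρ.ne') (Complex.exp_ne_zero _)
  have h1 := curveParity_add_of_cross (x := D.z v) hd (η := Real.sin ε / 2)
    (t₀ := Real.cos ε / 2) (by linarith) (by linarith) (by linarith [Real.cos_le_one ε])
  simp only at h1
  rw [← D.near_add h, ← D.near_sub h] at h1
  have h1' : (fun t : ℝ => D.z v + t * (D.P v w - D.z v)) = D.rad v w := rfl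
  rw [h1'] at h1
  simp only [Complex.ofReal_zero, zero_mul, add_zero, Complex.ofReal_one, one_mul,
    add_sub_cancel] at h1
  have he : s(v, w) ∈ G.edgeSet := h
  set p := D.near v (D.ang v w - ε) with hp
  set q := D.near v (D.ang v w + ε) with hq
  have h2 := curveParity_add_of_segment (p := p) (q := q) (D.mid_cont _ he) (by
    intro t ht hx
    have := D.mid_far _ he t ht v
    have := D.dist_lt_of_mem_cross hx
    linarith)
  have h3 := curveParity_add_of_segment (p := p) (q := q) (D.continuous_rad w v).continuousOn (by
    intro t ht hx
    have e1 := D.sep v w h.ne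
    have e2 := D.dist_lt_of_mem_cross hx
    have e3 := D.dist_rad h.symm ht.1
    have e4 := dist_triangle_left (D.z v) (D.z w) (D.rad w v t)
    have e5 : t * D.ρ ≤ D.ρ := mul_le_of_le_one_left D.ρ_pos.le ht.2
    linarith)
  rw [D.mid_zero _ he, D.mid_one _ he] at h2
  rw [rad_zero, rad_one] at h3
  unfold parity
  rcases sym2_out_cases v w with ho | ho
  · rw [ho] at h2 ⊢
    simp only at h2 ⊢
    linear_combination h1 + h2 + h3 + zmod_two_add_self (endTwist p q (D.P v w)) +
      zmod_two_add_self (endTwist p q (D.P w v))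
  · rw [ho] at h2 ⊢
    simp only at h2 ⊢
    linear_combination h1 + h2 + h3 + zmod_two_add_self (endTwist p q (D.P v w)) +
      zmod_two_add_self (endTwist p q (D.P w v))

variable [Fintype V] [DecidableEq V]

set_option linter.unusedSectionVars false

lemma chainParity_cross {c : Sym2 V → ZMod 2} (hc : c ∈ G.evenChains) {v w : V} (h : G.Adj v w)
    {ε : ℝ} (hε : D.IsSmallAngle v w ε) :
    D.chainParity (D.near v (D.ang v w + ε)) c =
      D.chainParity (D.near v (D.ang v w - ε)) c + c s(v, w) := by
  have key : D.chainParity (D.near v (D.ang v w - ε)) c +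
      D.chainParity (D.near v (D.ang v w + ε)) c = c s(v, w) := by
    have h1 : c s(v, w) = ∑ e : Sym2 V, if e = s(v, w) then c e else 0 := by
      rw [Finset.sum_ite_eq' Finset.univ s(v, w)]; simp
    have h2 := D.sum_endTwist hc (D.near v (D.ang v w - ε)) (D.near v (D.ang v w + ε))
    have h3 := congrArg₂ (· + ·) h2 h1.symm
    simp only [zero_add] at h3
    rw [← h3, chainParity_apply, chainParity_apply, ← Finset.sum_add_distrib, ← Finset.sum_add_distrib]
    apply Finset.sum_congr rfl
    intro e _
    by_cases h0 : c e = 0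
    · simp [h0]
    have he : e ∈ G.edgeSet := by
      by_contra hn; exact h0 (hc.1 e hn)
    rw [← mul_add]
    split_ifs with hvw
    · subst hvw
      rw [D.parity_cross h hε]
      rcases sym2_out_cases v w with ho | ho
      · rw [ho]; ring
      · rw [ho]; ring
    · rw [add_zero, D.parity_add_of_segment he]
      intro x hx hxs
      exact hvw (D.eq_of_mem_cross h hε hxs he hx)
  linear_combination key - zmod_two_add_self (D.chainParity (D.near v (D.ang v w - ε)) c)

lemma exists_smallAngle : ∃ ε, ∀ v w, G.Adj v w →
    D.IsSmallAngle v w ε ∧ -Real.pi < D.ang v w - ε := by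
  have hev : ∀ᶠ ε in nhdsWithin (0 : ℝ) (Set.Ioi 0), ∀ v w, G.Adj v w →
      D.IsSmallAngle v w ε ∧ -Real.pi < D.ang v w - ε := by
    rw [Filter.eventually_all]
    intro v
    rw [Filter.eventually_all]
    intro w
    rw [Filter.eventually_imp_distrib_left]
    intro h
    have hsub : ∀ {p : ℝ → Prop}, (∀ᶠ ε in nhds (0 : ℝ), p ε) →
        ∀ᶠ ε in nhdsWithin (0 : ℝ) (Set.Ioi 0), p ε := fun h => h.filter_mono nhdsWithin_le_nhds
    have h1 : ∀ᶠ ε in nhdsWithin (0 : ℝ) (Set.Ioi 0), ε ∈ Set.Ioi (0 : ℝ) :=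
      eventually_mem_nhdsWithin
    have h2 : ∀ᶠ ε in nhdsWithin (0 : ℝ) (Set.Ioi 0), ε < Real.pi / 2 :=
      hsub (eventually_lt_nhds (by positivity))
    have h3 : ∀ᶠ ε in nhdsWithin (0 : ℝ) (Set.Ioi 0), -Real.pi < D.ang v w - ε := by
      apply hsub
      have : Filter.Tendsto (fun ε => D.ang v w - ε) (nhds 0) (nhds (D.ang v w - 0)) :=
        (continuous_const.sub continuous_id).tendsto 0
      rw [sub_zero] at this
      exact this.eventually_const_lt (D.ang_mem v w).1
    have h4 : ∀ᶠ ε in nhdsWithin (0 : ℝ) (Set.Ioi 0), ∀ w', G.Adj v w' → w' ≠ w →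
        Real.cos (D.ang v w' - D.ang v w) < Real.cos ε := by
      apply hsub
      rw [Filter.eventually_all]
      intro w'
      rw [Filter.eventually_imp_distrib_left]
      intro hw'
      rw [Filter.eventually_imp_distrib_left]
      intro hne
      have : Filter.Tendsto Real.cos (nhds 0) (nhds (Real.cos 0)) :=
        Real.continuous_cos.tendsto 0
      refine this.eventually_const_lt ?_
      rw [Real.cos_zero]
      refine lt_of_le_of_ne (Real.cos_le_one _) fun hcos => hne ?_
      have hb1 := D.ang_mem v w'
      have hb2 := D.ang_mem v w
      rw [Real.cos_eq_one_iff_of_lt_of_lt (by linarith [hb1.1, hb2.2]) (by linarith [hb1.2, hb2.1])]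
        at hcos
      exact D.ang_injective hw' h (by linarith)
    filter_upwards [h1, h2, h3, h4] with ε a b c d
    exact ⟨⟨a, b, d⟩, c⟩
  exact hev.exists

end StraightDrawing

namespace StraightDrawing

variable {V : Type*} {G : SimpleGraph V} (D : StraightDrawing G)

lemma ang_eq_of_exp_eq {v w : V} {ψ : ℝ} (hψ : ψ ∈ Set.Ioc (-Real.pi) Real.pi)
    (h : Complex.exp (ψ * Complex.I) = Complex.exp (D.ang v w * Complex.I)) : ψ = D.ang v w := by
  have h1 := D.ang_mem v w
  have := Complex.exp_inj_of_neg_pi_lt_of_le_pi (by simpa using hψ.1) (by simpa using hψ.2)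
    (by simpa using h1.1) (by simpa using h1.2) h
  exact_mod_cast mul_right_cancel₀ Complex.I_ne_zero this

variable [Fintype V] [DecidableEq V]

set_option linter.unusedSectionVars false

lemma chainParity_near_eq_add {c : Sym2 V → ZMod 2} (hc : c ∈ G.evenChains) {ε : ℝ}
    (hε : ∀ v w, G.Adj v w → D.IsSmallAngle v w ε ∧ -Real.pi < D.ang v w - ε)
    (v : V) {ψ₀ : ℝ} (h₀ : -Real.pi < ψ₀) (hlow : ∀ w, G.Adj v w → ψ₀ < D.ang v w) (n : ℕ) :
    ∀ ψ ∈ Set.Ioc (-Real.pi) Real.pi, (∀ w, G.Adj v w → ψ ≠ D.ang v w) →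
      ({w | G.Adj v w ∧ D.ang v w < ψ} : Set V).ncard = n →
      D.chainParity (D.near v ψ) c = D.chainParity (D.near v ψ₀) c +
        ∑ w with D.ang v w < ψ, c s(v, w) := by
  have hc0 : ∀ w, ¬ G.Adj v w → c s(v, w) = 0 := fun w hw => hc.1 _ hw
  induction n using Nat.strong_induction_on with
  | _ n ih =>
  intro ψ hψ hne hn
  by_cases hex : ∃ w, G.Adj v w ∧ D.ang v w < ψ
  · obtain ⟨w, ⟨hw, hwψ⟩, hmax⟩ := Set.exists_max_image {w | G.Adj v w ∧ D.ang v w < ψ}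
      (D.ang v) (Set.toFinite _) hex
    obtain ⟨hs, hpi⟩ := hε v w hw
    have hang := D.ang_mem v w
    have hlt : ∀ w', G.Adj v w' → D.ang v w' < ψ → w' ≠ w →
        D.ang v w' < D.ang v w - ε := by
      intro w' hw' hlt hne'
      by_contra hnot
      have hle := hmax w' ⟨hw', hlt⟩
      refine hne' (hs.eq D (ψ := D.ang v w') ?_ hw' rfl)
      rw [abs_le]
      constructor <;> linarith [hs.1]
    have h1 : D.chainParity (D.near v ψ) c = D.chainParity (D.near v (D.ang v w + ε)) c := by
      apply D.chainParity_near_eq hc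
      intro x hx w' hw' _ hxe
      rw [Set.mem_uIcc] at hx
      have hxw : D.ang v w < x := by
        rcases hx with hx | hx <;> linarith [hs.1]
      by_cases hxs : x ≤ D.ang v w + ε
      · have := hs.eq D (ψ := x) (by rw [abs_le]; constructor <;> linarith [hs.1]) hw' hxe
        subst this
        have hq : |x - D.ang v w'| < Real.pi := by
          rw [abs_of_pos (by linarith)]; linarith [hs.2.1, Real.pi_pos]
        have h3 : Complex.exp ((x - D.ang v w' : ℝ) * Complex.I) = 1 := by
          push_cast
          rw [sub_mul, Complex.exp_sub, hxe, div_self (Complex.exp_ne_zero _)]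
        have h4 := congrArg Complex.re h3
        rw [Complex.exp_ofReal_mul_I_re, Complex.one_re, Real.cos_eq_one_iff_of_lt_of_lt] at h4
        · linarith
        · linarith [Real.pi_pos, (abs_lt.1 hq).1]
        · linarith [Real.pi_pos, (abs_lt.1 hq).2]
      · have hxψ : x ≤ ψ := by
          rcases hx with hx | hx <;> linarith
        have h3 := D.ang_eq_of_exp_eq ⟨by linarith [hang.1], by linarith [hψ.2]⟩ hxe
        have h4 : D.ang v w' < ψ :=
          lt_of_le_of_ne (by linarith) (hne w' hw').symm
        have := hmax w' ⟨hw', h4⟩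
        linarith
    rw [h1, D.chainParity_cross hc hw hs]
    have hsub : {w' | G.Adj v w' ∧ D.ang v w' < D.ang v w - ε} ⊂
        {w' | G.Adj v w' ∧ D.ang v w' < ψ} := by
      refine ⟨fun w' h => ⟨h.1, by linarith [h.2, hs.1]⟩, fun h => ?_⟩
      have := (h ⟨hw, hwψ⟩ : _ ∧ _).2
      linarith [hs.1]
    have h2 := ih _ (hn ▸ Set.ncard_lt_ncard hsub (Set.toFinite _)) (D.ang v w - ε)
      ⟨hpi, by linarith [hang.2, hs.1]⟩ (by
        intro w' hw' h
        have := hs.eq D (ψ := D.ang v w') (by rw [abs_le]; constructor <;> linarith [hs.1]) hw' rfl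
        subst this
        linarith [hs.1]) rfl
    rw [h2, add_assoc]
    congr 1
    have h4 : c s(v, w) = ∑ w', if w' = w then c s(v, w') else 0 := by simp
    rw [Finset.sum_filter, Finset.sum_filter, h4, ← Finset.sum_add_distrib]
    apply Finset.sum_congr rfl
    intro w' _
    by_cases ha : G.Adj v w'
    · by_cases hw' : w' = w
      · subst hw'
        simp [hwψ, hs.1.le]
      · by_cases hlt' : D.ang v w' < ψ
        · simp [hw', hlt', hlt w' ha hlt' hw']
        · have : ¬ D.ang v w' < D.ang v w - ε := by
            intro h; linarith [hs.1]
          simp [hw', hlt', this]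
    · simp [hc0 w' ha]
  · push Not at hex
    have h1 : ∑ w with D.ang v w < ψ, c s(v, w) = 0 := by
      apply Finset.sum_eq_zero
      intro w hw
      by_cases ha : G.Adj v w
      · exact absurd (Finset.mem_filter.1 hw).2 (not_lt.2 (hex w ha))
      · exact hc0 w ha
    rw [h1, add_zero]
    apply D.chainParity_near_eq hc
    intro x hx w hw _ hxe
    have h3 := D.ang_eq_of_exp_eq (ψ := x) (by
      rw [Set.mem_uIcc] at hx
      have := hlow w hw
      have := (D.ang_mem v w).2
      rcases hx with hx | hx
      · exact ⟨by linarith [hψ.1], by linarith⟩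
      · exact ⟨by linarith, by linarith [hψ.2]⟩) hxe
    have h4 := hex w hw
    have h5 := hne w hw
    have h6 := hlow w hw
    rw [Set.mem_uIcc] at hx
    rcases hx with hx | hx
    · linarith
    · exact h5 (by linarith)

lemma chainParity_along {c : Sym2 V → ZMod 2} (hc : c ∈ G.evenChains) {v w : V} (h : G.Adj v w)
    (h0 : c s(v, w) = 0) {ε ε' : ℝ} (hε : D.IsSmallAngle v w ε) (hε' : D.IsSmallAngle w v ε') :
    D.chainParity (D.near v (D.ang v w - ε)) c = D.chainParity (D.near w (D.ang w v - ε')) c := by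
  have step1 : ∀ {v w : V}, G.Adj v w → c s(v, w) = 0 → ∀ {ε : ℝ}, D.IsSmallAngle v w ε →
      D.chainParity (D.near v (D.ang v w - ε)) c = D.chainParity (D.P v w) c := by
    intro v w h h0 ε hε
    have e1 : D.chainParity (D.near v (D.ang v w - ε)) c =
        D.chainParity (D.near v (D.ang v w)) c := by
      apply D.chainParity_near_eq hc
      intro x hx w' hw' hcw hxe
      rw [Set.uIcc_of_le (by linarith [hε.1])] at hx
      have := hε.eq D (ψ := x) (by rw [abs_le]; constructor <;> linarith [hε.1, hx.1, hx.2]) hw' hxe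
      rw [this] at hcw
      exact hcw h0
    rw [e1, D.near_ang h]
    refine D.chainParity_eq_of_isPreconnected hc (T := D.rad v w '' Set.Icc (1 / 2) 1)
      (isPreconnected_Icc.image _ (D.continuous_rad v w).continuousOn) ?_
      ⟨1 / 2, by norm_num, rfl⟩ ⟨1, by norm_num, D.rad_one v w⟩
    rintro e he _ hx ⟨t, ht, rfl⟩
    have hee : e ∈ G.edgeSet := by by_contra hn; exact he (hc.1 e hn)
    apply he
    suffices e = s(v, w) by rw [this, h0]
    rcases ht.2.lt_or_eq with hlt | rfl
    · obtain ⟨w', rfl, t', ht', hr⟩ := D.exists_rad_of_mem_body hee hx (by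
        rw [D.dist_rad h (by linarith [ht.1])]
        nlinarith [D.ρ_pos])
      have hd := D.dist_rad h (t := t) (by linarith [ht.1])
      rw [hr, D.dist_rad hee ht'.1] at hd
      have htt := mul_right_cancel₀ D.ρ_pos.ne' hd
      subst htt
      have htz : (t' : ℂ) ≠ 0 := by
        have : t' ≠ 0 := by linarith [ht.1]
        exact_mod_cast this
      have := mul_left_cancel₀ htz (add_left_cancel hr)
      rw [D.P_injective h hee (sub_left_injective this)]
    · rw [D.rad_one] at hx
      obtain ⟨t, ht, hm⟩ := D.P_mem_mid h
      rw [← hm] at hx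
      exact (D.eq_of_mid_mem_body h hee ht hx).symm
  rw [step1 h h0 hε, step1 h.symm (by rw [Sym2.eq_swap]; exact h0) hε']
  obtain ⟨t, ht, hm⟩ := D.P_mem_mid h
  obtain ⟨t', ht', hm'⟩ := D.P_mem_mid h.symm
  rw [Sym2.eq_swap] at hm'
  refine D.chainParity_eq_of_isPreconnected hc (T := D.mid s(v, w) '' Set.Icc 0 1)
    (isPreconnected_Icc.image _ (D.mid_cont _ h)) ?_ ⟨t, ht, hm⟩ ⟨t', ht', hm'⟩
  rintro e he _ hx ⟨t, ht, rfl⟩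
  have hee : e ∈ G.edgeSet := by by_contra hn; exact he (hc.1 e hn)
  apply he
  rw [← D.eq_of_mid_mem_body h hee ht hx, h0]

end StraightDrawing

/-- A rotation system of `G` together with linear functionals on even chains recording the faces:
`side v w` is the functional of the face just before the edge `vw` in the order around `v`. -/
structure FaceFunctionals {V : Type*} [Fintype V] (G : SimpleGraph V) where
  θ : V → V → ℝ
  θ_injective : ∀ {v w w'}, G.Adj v w → G.Adj v w' → θ v w = θ v w' → w = w'
  base : V → (Sym2 V → ZMod 2) →ₗ[ZMod 2] ZMod 2
  side : V → V → (Sym2 V → ZMod 2) →ₗ[ZMod 2] ZMod 2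
  side_eq : ∀ c ∈ G.evenChains, ∀ v w, G.Adj v w →
    side v w c = base v c + ∑ w' with θ v w' < θ v w, c s(v, w')
  side_swap : ∀ v w, G.Adj v w → (∀ c ∈ G.evenChains, side v w c = side w v c) ∨
    (∀ c ∈ G.evenChains, side v w c = side w v c + c s(v, w))

theorem StraightDrawing.nonempty_faceFunctionals {V : Type*} [Fintype V] {G : SimpleGraph V}
    (D : StraightDrawing G) : Nonempty (FaceFunctionals G) := by
  classical
  obtain ⟨ε, hε⟩ := D.exists_smallAngle
  have hψ : ∀ v, ∃ ψ₀, -Real.pi < ψ₀ ∧ ∀ w, G.Adj v w → ψ₀ < D.ang v w := by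
    intro v
    have h1 : ∀ᶠ ψ in nhdsWithin (-Real.pi) (Set.Ioi (-Real.pi)), ∀ w, ψ < D.ang v w := by
      rw [Filter.eventually_all]
      intro w
      exact (eventually_lt_nhds (D.ang_mem v w).1).filter_mono nhdsWithin_le_nhds
    obtain ⟨ψ, h2, h3⟩ := (h1.and eventually_mem_nhdsWithin).exists
    exact ⟨ψ, h3, fun w _ => h2 w⟩
  choose ψ₀ hψ₀ hψ₁ using hψ
  refine ⟨⟨D.ang, fun h h' e => D.ang_injective h h' e,
    fun v => D.chainParity (D.near v (ψ₀ v)),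
    fun v w => D.chainParity (D.near v (D.ang v w - ε)), ?_, ?_⟩⟩
  · intro c hc v w h
    obtain ⟨hs, hpi⟩ := hε v w h
    have hnot : ∀ w', G.Adj v w' → |D.ang v w' - D.ang v w| ≤ ε → w' = w :=
      fun w' hw' hle => hs.eq D (ψ := D.ang v w') hle hw' rfl
    rw [D.chainParity_near_eq_add hc hε v (hψ₀ v) (hψ₁ v) _ (D.ang v w - ε)
      ⟨hpi, by linarith [(D.ang_mem v w).2, hs.1]⟩ (by
        intro w' hw' h
        have := hnot w' hw' (by rw [← h, abs_le]; constructor <;> linarith [hs.1])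
        subst this
        linarith [hs.1]) rfl]
    congr 1
    rw [Finset.sum_filter, Finset.sum_filter]
    apply Finset.sum_congr rfl
    intro w' _
    by_cases ha : G.Adj v w'
    · by_cases h1 : D.ang v w' < D.ang v w
      · have : D.ang v w' < D.ang v w - ε := by
          by_contra hcon
          have := hnot w' ha (by rw [abs_le]; constructor <;> linarith)
          rw [this] at h1
          exact lt_irrefl _ h1
        simp [h1, this]
      · have : ¬ D.ang v w' < D.ang v w - ε := by
          intro h; linarith [hs.1]
        simp [h1, this]
    · have : c s(v, w') = 0 := hc.1 _ ha
      simp [this]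
  · intro v w h
    have hs := (hε v w h).1
    have hs' := (hε w v h.symm).1
    by_cases hex : ∃ c₁ ∈ G.evenChains, c₁ s(v, w) = 1
    · obtain ⟨c₁, hc₁, h1⟩ := hex
      have key : ∀ c ∈ G.evenChains, D.chainParity (D.near v (D.ang v w - ε)) c =
          D.chainParity (D.near w (D.ang w v - ε)) c + c s(v, w) *
          (D.chainParity (D.near v (D.ang v w - ε)) c₁ +
            D.chainParity (D.near w (D.ang w v - ε)) c₁) := by
        intro c hc
        rcases zmod_two_cases (c s(v, w)) with h0 | h0
        · rw [h0, zero_mul, add_zero]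
          exact D.chainParity_along hc h h0 hs hs'
        · have := D.chainParity_along (G.evenChains.add_mem hc hc₁) h
            (by rw [Pi.add_apply, h0, h1, zmod_two_add_self]) hs hs'
          rw [map_add, map_add] at this
          rw [h0, one_mul]
          linear_combination this -
            zmod_two_add_self (D.chainParity (D.near v (D.ang v w - ε)) c₁)
      rcases zmod_two_cases (D.chainParity (D.near v (D.ang v w - ε)) c₁ +
            D.chainParity (D.near w (D.ang w v - ε)) c₁) with hz | hz
      · left
        intro c hc
        rw [key c hc, hz, mul_zero, add_zero]
      · right
        intro c hc
        rw [key c hc, hz, mul_one]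
    · left
      intro c hc
      rcases zmod_two_cases (c s(v, w)) with h0 | h0
      · exact D.chainParity_along hc h h0 hs hs'
      · exact absurd ⟨c, hc, h0⟩ hex

lemma continuousOn_dist_const {γ : ℝ → ℂ} {s : Set ℝ} (hγ : ContinuousOn γ s) (a : ℂ) :
    ContinuousOn (fun t => dist (γ t) a) s :=
  (continuous_id.dist continuous_const).comp_continuousOn hγ

/-- Any arc between two points separated by more than `2 * r` contains a subarc that starts on the
circle of radius `r` around its first end, ends on the circle around its second end, and
avoids both open discs. -/
lemma exists_subarc {γ : ℝ → ℂ} (hγ : ContinuousOn γ (Set.Icc 0 1)) {r : ℝ} (hr : 0 < r)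
    (hsep : 2 * r < dist (γ 0) (γ 1)) :
    ∃ t₁ t₂ : ℝ, 0 < t₁ ∧ t₁ ≤ t₂ ∧ t₂ < 1 ∧ dist (γ t₁) (γ 0) = r ∧ dist (γ t₂) (γ 1) = r ∧
      ∀ t ∈ Set.Icc t₁ t₂, r ≤ dist (γ t) (γ 0) ∧ r ≤ dist (γ t) (γ 1) := by
  have c0 : ContinuousOn (fun t => dist (γ t) (γ 0)) (Set.Icc 0 1) := continuousOn_dist_const hγ _
  have c1 : ContinuousOn (fun t => dist (γ t) (γ 1)) (Set.Icc 0 1) := continuousOn_dist_const hγ _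
  have hA : IsCompact (Set.Icc (0 : ℝ) 1 ∩ (fun t => dist (γ t) (γ 0)) ⁻¹' Set.Iic r) :=
    isCompact_Icc.of_isClosed_subset (c0.preimage_isClosed_of_isClosed isClosed_Icc isClosed_Iic)
      Set.inter_subset_left
  obtain ⟨t₁, ⟨h1, h1r⟩, h1max⟩ := hA.exists_isGreatest ⟨0, by simp, by simp [hr.le]⟩
  have e1 : dist (γ t₁) (γ 0) = r := by
    have hsub : Set.Icc t₁ 1 ⊆ Set.Icc (0 : ℝ) 1 := Set.Icc_subset_Icc_left h1.1
    have hiv := intermediate_value_Icc h1.2 (c0.mono hsub)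
    obtain ⟨t, ht, htr⟩ := hiv ⟨h1r, by rw [_root_.dist_comm]; linarith⟩
    have : t ≤ t₁ := h1max ⟨hsub ht, htr.le⟩
    rw [← le_antisymm this ht.1]
    exact htr
  have hB : IsCompact (Set.Icc (0 : ℝ) 1 ∩ (fun t => dist (γ t) (γ 1)) ⁻¹' Set.Iic r ∩
      Set.Icc t₁ 1) :=
    (isCompact_Icc.of_isClosed_subset (c1.preimage_isClosed_of_isClosed isClosed_Icc isClosed_Iic)
      Set.inter_subset_left).inter isCompact_Icc
  obtain ⟨t₂, ⟨⟨h2, h2r⟩, h21⟩, h2min⟩ :=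
    hB.exists_isLeast ⟨1, ⟨⟨by simp, by simp [hr.le]⟩, ⟨h1.2, le_rfl⟩⟩⟩
  have e2 : dist (γ t₂) (γ 1) = r := by
    have hsub : Set.Icc t₁ t₂ ⊆ Set.Icc (0 : ℝ) 1 := Set.Icc_subset_Icc h1.1 h2.2
    have hiv := intermediate_value_Icc' h21.1 (c1.mono hsub)
    obtain ⟨t, ht, htr⟩ := hiv ⟨h2r, by
      have := dist_triangle_left (γ 0) (γ 1) (γ t₁)
      linarith⟩
    have : t₂ ≤ t := h2min ⟨⟨hsub ht, htr.le⟩, ⟨ht.1, (hsub ht).2⟩⟩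
    rw [← le_antisymm ht.2 this]
    exact htr
  refine ⟨t₁, t₂, ?_, h21.1, ?_, e1, e2, ?_⟩
  · refine lt_of_le_of_ne h1.1 fun h => ?_
    rw [← h, _root_.dist_self] at e1
    exact hr.ne e1
  · refine lt_of_le_of_ne h2.2 fun h => ?_
    rw [h, _root_.dist_self] at e2
    exact hr.ne e2
  · intro t ht
    have ht01 : t ∈ Set.Icc (0 : ℝ) 1 := ⟨h1.1.trans ht.1, ht.2.trans h2.2⟩
    constructor
    · by_contra hlt
      push Not at hlt
      have : t ≤ t₁ := h1max ⟨ht01, hlt.le⟩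
      rw [le_antisymm this ht.1] at hlt
      linarith
    · by_contra hlt
      push Not at hlt
      have : t₂ ≤ t := h2min ⟨⟨ht01, hlt.le⟩, ⟨ht.1, ht01.2⟩⟩
      rw [le_antisymm ht.2 this] at hlt
      linarith

theorem nonempty_straightDrawing {V : Type*} [Finite V]
    {G : SimpleGraph V} (h : G.HasPlanarEmbedding) : Nonempty (StraightDrawing G) := by
  classical
  obtain ⟨pos, arc, hinj, harc, hdisj⟩ := h
  let ι := Complex.equivRealProdCLM.symm
  have hι : Function.Injective ι := ι.injective
  let z : V → ℂ := fun v => ι (pos v)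
  let γ : Sym2 V → ℝ → ℂ := fun e t => ι (arc (Quot.out e).1 (Quot.out e).2 t)
  have hz : ∀ u v, u ≠ v → z u ≠ z v := fun u v huv h => huv (hinj (hι h))
  have γc : ∀ e ∈ G.edgeSet, ContinuousOn (γ e) (Set.Icc 0 1) := fun e he =>
    ι.continuous.comp_continuousOn (harc _ _ (StraightDrawing.out_adj he)).1
  have γ0 : ∀ e ∈ G.edgeSet, γ e 0 = z (Quot.out e).1 := fun e he => by
    simp only [γ, z]; rw [(harc _ _ (StraightDrawing.out_adj he)).2.2.1]
  have γ1 : ∀ e ∈ G.edgeSet, γ e 1 = z (Quot.out e).2 := fun e he => by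
    simp only [γ, z]; rw [(harc _ _ (StraightDrawing.out_adj he)).2.2.2.1]
  have γi : ∀ e ∈ G.edgeSet, ∀ w, ∀ t ∈ Set.Ioo (0 : ℝ) 1, γ e t ≠ z w := fun e he w t ht h =>
    (harc _ _ (StraightDrawing.out_adj he)).2.2.2.2.2 w t ht (hι h)
  have γd : ∀ e ∈ G.edgeSet, ∀ e' ∈ G.edgeSet, e ≠ e' → ∀ t ∈ Set.Ioo (0 : ℝ) 1,
      ∀ t' ∈ Set.Ioo (0 : ℝ) 1, γ e t ≠ γ e' t' := fun e he e' he' hne t ht t' ht' h =>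
    hdisj _ _ _ _ (StraightDrawing.out_adj he) (StraightDrawing.out_adj he')
      (by rw [sym2_out_eq, sym2_out_eq]; exact hne) t ht t' ht' (hι h)
  have hr : ∀ᶠ r in nhdsWithin (0 : ℝ) (Set.Ioi 0), 0 < r ∧
      (∀ u v, u ≠ v → 2 * r < dist (z u) (z v)) ∧
      ∀ e ∈ G.edgeSet, ∀ w, w ≠ (Quot.out e).1 → w ≠ (Quot.out e).2 →
        ∀ t ∈ Set.Icc (0 : ℝ) 1, r ≤ dist (γ e t) (z w) := by
    refine eventually_mem_nhdsWithin.and (Filter.Eventually.and ?_ ?_)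
    · apply Filter.Eventually.filter_mono nhdsWithin_le_nhds
      rw [Filter.eventually_all]; intro u
      rw [Filter.eventually_all]; intro v
      rw [Filter.eventually_imp_distrib_left]; intro huv
      have h2 : Filter.Tendsto (fun r : ℝ => 2 * r) (nhds 0) (nhds (2 * 0)) :=
        (continuous_const.mul continuous_id).tendsto 0
      rw [mul_zero] at h2
      exact h2.eventually_lt_const (dist_pos.2 (hz u v huv))
    · apply Filter.Eventually.filter_mono nhdsWithin_le_nhds
      rw [Filter.eventually_all]; intro e
      rw [Filter.eventually_imp_distrib_left]; intro he
      rw [Filter.eventually_all]; intro w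
      rw [Filter.eventually_imp_distrib_left]; intro h1
      rw [Filter.eventually_imp_distrib_left]; intro h2
      have c0 : ContinuousOn (fun t => dist (γ e t) (z w)) (Set.Icc 0 1) :=
        continuousOn_dist_const (γc e he) _
      obtain ⟨t₀, ht₀, hmin⟩ := isCompact_Icc.exists_isMinOn ⟨0, by simp⟩ c0
      have hpos : 0 < dist (γ e t₀) (z w) := by
        rw [dist_pos]
        rcases ht₀.1.eq_or_lt with h | h
        · rw [← h, γ0 e he]; exact hz _ _ h1.symm
        rcases ht₀.2.eq_or_lt with h' | h'
        · rw [h', γ1 e he]; exact hz _ _ h2.symm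
        exact γi e he w _ ⟨h, h'⟩
      filter_upwards [eventually_lt_nhds hpos] with r hr t ht
      exact hr.le.trans (hmin ht)
  obtain ⟨r, hr0, hsep, hfar⟩ := hr.exists
  have hsub : ∀ e : Sym2 V, ∃ t : ℝ × ℝ, e ∈ G.edgeSet → 0 < t.1 ∧ t.1 ≤ t.2 ∧ t.2 < 1 ∧
      dist (γ e t.1) (z (Quot.out e).1) = r ∧ dist (γ e t.2) (z (Quot.out e).2) = r ∧
      ∀ s ∈ Set.Icc t.1 t.2, r ≤ dist (γ e s) (z (Quot.out e).1) ∧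
        r ≤ dist (γ e s) (z (Quot.out e).2) := by
    intro e
    by_cases he : e ∈ G.edgeSet
    · obtain ⟨t₁, t₂, h⟩ := exists_subarc (γc e he) hr0 (by
        rw [γ0 e he, γ1 e he]; exact hsep _ _ (StraightDrawing.out_adj he).ne)
      rw [γ0 e he, γ1 e he] at h
      exact ⟨(t₁, t₂), fun _ => h⟩
    · exact ⟨0, fun h => absurd h he⟩
  choose τ hτ using hsub
  let mid : Sym2 V → ℝ → ℂ := fun e s => γ e ((τ e).1 + s * ((τ e).2 - (τ e).1))
  have hmem : ∀ e ∈ G.edgeSet, ∀ s ∈ Set.Icc (0 : ℝ) 1,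
      (τ e).1 + s * ((τ e).2 - (τ e).1) ∈ Set.Icc (τ e).1 (τ e).2 := by
    intro e he s hs
    have := (hτ e he).2.1
    constructor <;> nlinarith [hs.1, hs.2]
  have hmem' : ∀ e ∈ G.edgeSet, ∀ s ∈ Set.Icc (0 : ℝ) 1,
      (τ e).1 + s * ((τ e).2 - (τ e).1) ∈ Set.Ioo (0 : ℝ) 1 := by
    intro e he s hs
    have h1 := hmem e he s hs
    exact ⟨(hτ e he).1.trans_le h1.1, h1.2.trans_lt (hτ e he).2.2.1⟩
  refine ⟨⟨z, r, hr0, hsep,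
    fun u v => if (Quot.out s(u, v)).1 = u then mid s(u, v) 0 else mid s(u, v) 1,
    ?_, mid, ?_, ?_, ?_, ?_, ?_⟩⟩
  · intro u v huv
    have he : s(u, v) ∈ G.edgeSet := huv
    have := hτ _ he
    rcases sym2_out_cases u v with ho | ho
    · rw [ho] at this ⊢
      simp only [if_true, mid, zero_mul, add_zero]
      exact this.2.2.2.1
    · rw [ho] at this ⊢
      simp only [huv.ne', if_false, mid, one_mul, add_sub_cancel]
      exact this.2.2.2.2.1
  · intro e he
    apply (γc e he).comp (by fun_prop)
    intro s hs
    exact Set.Ioo_subset_Icc_self (hmem' e he s hs)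
  · intro e he
    rw [sym2_out_eq, if_pos rfl]
  · intro e he
    rw [Sym2.eq_swap, sym2_out_eq, if_neg (StraightDrawing.out_adj he).ne]
  · intro e he t ht w
    by_cases h1 : w = (Quot.out e).1
    · rw [h1]; exact ((hτ e he).2.2.2.2.2 _ (hmem e he t ht)).1
    by_cases h2 : w = (Quot.out e).2
    · rw [h2]; exact ((hτ e he).2.2.2.2.2 _ (hmem e he t ht)).2
    exact hfar e he w h1 h2 _ (Set.Ioo_subset_Icc_self (hmem' e he t ht))
  · intro e he e' he' hne t ht t' ht'
    exact γd e he e' he' hne _ (hmem' e he t ht) _ (hmem' e' he' t' ht')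

lemma hasPlanarEmbedding_comap {V W : Type*} {G : SimpleGraph V}
    (h : G.HasPlanarEmbedding) {f : W → V} (hf : Function.Injective f) :
    (G.comap f).HasPlanarEmbedding := by
  obtain ⟨pos, arc, hinj, harc, hdisj⟩ := h
  refine ⟨pos ∘ f, fun u v => arc (f u) (f v), hinj.comp hf, fun u v huv => ?_, ?_⟩
  · obtain ⟨h1, h2, h3, h4, h5, h6⟩ := harc (f u) (f v) huv
    exact ⟨h1, h2, h3, h4, h5, fun w => h6 (f w)⟩
  · intro u v x y huv hxy hne
    refine hdisj _ _ _ _ huv hxy fun h => hne ?_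
    have := Sym2.map.injective hf (a₁ := s(u, v)) (a₂ := s(x, y)) (by simpa using h)
    exact this

/-- `G` is connected and stays connected when any single vertex is removed. -/
def NoCutVertex {V : Type*} (G : SimpleGraph V) : Prop :=
  ∀ (v : V) (S : Set V), v ∉ S → S.Nonempty → (∀ a ∈ S, ∀ b, G.Adj a b → b ∈ S ∨ b = v) →
    ∀ x, x ∈ S ∨ x = v

/-- The combinatorial faces of a plane drawing of a 2-connected graph: `B F v w` says that the edge
`vw` lies on the boundary of the face `F`. -/
structure FaceSystem {V : Type*} [Fintype V] (G : SimpleGraph V) (ι : Type*) [Fintype ι] where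
  B : ι → V → V → Prop
  symm : ∀ {F v w}, B F v w → B F w v
  adj : ∀ {F v w}, B F v w → G.Adj v w
  two_faces : ∀ {v w}, G.Adj v w → ∃ F₁ F₂, F₁ ≠ F₂ ∧ ∀ F, B F v w ↔ F = F₁ ∨ F = F₂
  two_edges : ∀ {F v w}, B F v w → ∃ w', w' ≠ w ∧ ∀ x, B F v x ↔ x = w ∨ x = w'
  link : ∀ (v : V) (A : Set V), (∃ a ∈ A, G.Adj v a) →
    (∀ a ∈ A, ∀ F b, B F v a → B F v b → b ∈ A) → ∀ x, G.Adj v x → x ∈ A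
  nonempty : ∀ F, ∃ v w, B F v w
  euler : G.edgeSet.ncard + 2 ≤ Fintype.card V + Fintype.card ι

section Chains

variable {V : Type*} [Fintype V] {G : SimpleGraph V}

lemma sum_single_edge [DecidableEq V] {a b : V} (hab : a ≠ b) (x : V) :
    ∑ w, (Pi.single s(a, b) 1 : Sym2 V → ZMod 2) s(x, w) =
      (if x = a then 1 else 0) + (if x = b then 1 else 0) := by
  by_cases hxa : x = a
  · subst hxa
    rw [if_pos rfl, if_neg hab, Finset.sum_eq_single b]
    · simp
    · intro w _ hw
      rw [Pi.single_eq_of_ne]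
      intro h
      exact hw (Sym2.congr_right.1 h)
    · simp
  · by_cases hxb : x = b
    · subst hxb
      rw [if_neg hxa, if_pos rfl, Finset.sum_eq_single a]
      · rw [Sym2.eq_swap]; simp
      · intro w _ hw
        rw [Pi.single_eq_of_ne]
        intro h
        rw [Sym2.eq_swap (a := a)] at h
        exact hw (Sym2.congr_right.1 h)
      · simp
    · rw [if_neg hxa, if_neg hxb, add_zero]
      apply Finset.sum_eq_zero
      intro w _
      rw [Pi.single_eq_of_ne]
      intro h
      rw [Sym2.eq_iff] at h
      rcases h with h | h
      · exact hxa h.1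
      · exact hxb h.1

lemma NoCutVertex.exists_evenChain [DecidableEq V] (hG : NoCutVertex G) {v a b : V}
    (ha : G.Adj v a) (hb : G.Adj v b) (hab : a ≠ b) :
    ∃ c ∈ G.evenChains, ∀ w, c s(v, w) = if w = a ∨ w = b then 1 else 0 := by
  let S : Set V := {w | w ≠ v ∧ ∃ c : Sym2 V → ZMod 2, (∀ e, e ∉ G.edgeSet → c e = 0) ∧
    (∀ w, c s(v, w) = 0) ∧
    ∀ x, ∑ w, c s(x, w) = (if x = a then 1 else 0) + (if x = w then 1 else 0)}
  have hS := hG v S (fun h => h.1 rfl) ⟨a, ha.ne', 0, by simp, by simp, fun x => by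
    simp [zmod_two_add_self]⟩ (by
    rintro w ⟨hw, c, h1, h2, h3⟩ y hwy
    by_cases hy : y = v
    · exact Or.inr hy
    · refine Or.inl ⟨hy, c + Pi.single s(w, y) 1, ?_, ?_, ?_⟩
      · intro e he
        rw [Pi.add_apply, h1 e he, Pi.single_eq_of_ne, add_zero]
        rintro rfl
        exact he hwy
      · intro x
        rw [Pi.add_apply, h2, Pi.single_eq_of_ne, add_zero]
        intro h
        rw [Sym2.eq_iff] at h
        rcases h with h | h
        · exact hw h.1.symm
        · exact hy h.1.symm
      · intro x
        simp only [Pi.add_apply]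
        rw [Finset.sum_add_distrib, h3, sum_single_edge hwy.ne]
        linear_combination zmod_two_add_self (if x = w then (1 : ZMod 2) else 0))
  obtain ⟨-, c, h1, h2, h3⟩ := (hS b).resolve_right hb.ne'
  refine ⟨c + Pi.single s(v, a) 1 + Pi.single s(v, b) 1, ⟨?_, ?_⟩, ?_⟩
  · intro e he
    rw [Pi.add_apply, Pi.add_apply, h1 e he, Pi.single_eq_of_ne, Pi.single_eq_of_ne]
    · simp
    · rintro rfl; exact he hb
    · rintro rfl; exact he ha
  · intro x
    simp only [Pi.add_apply]
    rw [Finset.sum_add_distrib, Finset.sum_add_distrib, h3, sum_single_edge ha.ne,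
      sum_single_edge hb.ne]
    linear_combination zmod_two_add_self (if x = a then (1 : ZMod 2) else 0) +
      zmod_two_add_self (if x = b then (1 : ZMod 2) else 0) +
      zmod_two_add_self (if x = v then (1 : ZMod 2) else 0)
  · intro w
    simp only [Pi.add_apply, h2, Pi.single_apply, Sym2.congr_right, zero_add]
    by_cases h : w = a
    · subst h; simp [hab]
    · simp [h]

end Chains

namespace FaceFunctionals

variable {V : Type*} [Fintype V] {G : SimpleGraph V} (D : FaceFunctionals G)

/-- The face before the edge `vw` in the order around `v`. -/
def right (v w : V) : G.evenChains →ₗ[ZMod 2] ZMod 2 := (D.side v w).comp G.evenChains.subtype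

/-- The face after the edge `vw` in the order around `v`. -/
def left (v w : V) : G.evenChains →ₗ[ZMod 2] ZMod 2 :=
  D.right v w + (LinearMap.proj s(v, w)).comp G.evenChains.subtype

lemma left_apply (v w : V) (c : G.evenChains) :
    D.left v w c = D.right v w c + c.1 s(v, w) := rfl

lemma right_apply {v w : V} (h : G.Adj v w) (c : G.evenChains) :
    D.right v w c = D.base v c.1 + ∑ w' with D.θ v w' < D.θ v w, c.1 s(v, w') :=
  D.side_eq c.1 c.2 v w h

lemma sum_lt_eq {v : V} (c : G.evenChains) (s t : ℝ) (hst : s ≤ t) :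
    ∑ w' with D.θ v w' < t, c.1 s(v, w') = ∑ w' with D.θ v w' < s, c.1 s(v, w') +
      ∑ w' with s ≤ D.θ v w' ∧ D.θ v w' < t, c.1 s(v, w') := by
  rw [Finset.sum_filter, Finset.sum_filter, Finset.sum_filter, ← Finset.sum_add_distrib]
  apply Finset.sum_congr rfl
  intro w _
  by_cases h1 : D.θ v w < s
  · simp [h1, h1.trans_le hst, not_le.2 h1]
  · simp [h1, not_lt.1 h1]

lemma right_ne_left (hG : NoCutVertex G) {v w w' : V} (h : G.Adj v w) (h' : G.Adj v w')
    (hne : w ≠ w') : D.right v w ≠ D.left v w := by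
  classical
  obtain ⟨c, hc, hcw⟩ := hG.exists_evenChain h h' hne
  intro he
  have := LinearMap.congr_fun he ⟨c, hc⟩
  simp only [left_apply, hcw] at this
  simp at this

lemma exists_right_ne (hG : NoCutVertex G) {v w w' : V} (h : G.Adj v w) (h' : G.Adj v w')
    (hne : w ≠ w') : ∃ c : G.evenChains, D.right v w c ≠ D.right v w' c ∧
      c.1 s(v, w) = c.1 s(v, w') := by
  classical
  wlog hlt : D.θ v w < D.θ v w' generalizing w w'
  · obtain ⟨c, h1, h2⟩ := this h' h (Ne.symm hne)
      (lt_of_le_of_ne (not_lt.1 hlt) fun h0 => hne (D.θ_injective h h' h0.symm))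
    exact ⟨c, h1.symm, h2.symm⟩
  obtain ⟨c, hc, hcw⟩ := hG.exists_evenChain h h' hne
  refine ⟨⟨c, hc⟩, ?_, by simp [hcw]⟩
  rw [D.right_apply h, D.right_apply h', D.sum_lt_eq ⟨c, hc⟩ _ _ hlt.le]
  have h1 : ∑ x with D.θ v w ≤ D.θ v x ∧ D.θ v x < D.θ v w', c s(v, x) = 1 := by
    rw [Finset.sum_eq_single w]
    · rw [hcw]; simp
    · intro x hx hxw
      rw [hcw, if_neg]
      rintro (rfl | rfl)
      · exact hxw rfl
      · exact lt_irrefl _ (Finset.mem_filter.1 hx).2.2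
    · intro hx
      exact absurd (Finset.mem_filter.2 ⟨Finset.mem_univ _, le_rfl, hlt⟩) hx
  simp only
  rw [h1]
  simp

lemma right_injective (hG : NoCutVertex G) {v w w' : V} (h : G.Adj v w) (h' : G.Adj v w')
    (he : D.right v w = D.right v w') : w = w' := by
  by_contra hne
  obtain ⟨c, h1, -⟩ := D.exists_right_ne hG h h' hne
  exact h1 (by rw [he])

lemma left_injective (hG : NoCutVertex G) {v w w' : V} (h : G.Adj v w) (h' : G.Adj v w')
    (he : D.left v w = D.left v w') : w = w' := by
  by_contra hne
  obtain ⟨c, h1, h2⟩ := D.exists_right_ne hG h h' hne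
  have := LinearMap.congr_fun he c
  rw [left_apply, left_apply, h2] at this
  exact h1 (add_right_cancel this)

lemma exists_left_eq_right {v w : V} (h : G.Adj v w) :
    ∃ w', G.Adj v w' ∧ D.left v w = D.right v w' := by
  classical
  have hfin : (Finset.univ.filter fun w => G.Adj v w).Nonempty := ⟨w, by simp [h]⟩
  by_cases hex : ∃ x, G.Adj v x ∧ D.θ v w < D.θ v x
  · obtain ⟨w', ⟨hw', hlt⟩, hmin⟩ := Set.exists_min_image {x | G.Adj v x ∧ D.θ v w < D.θ v x}
      (D.θ v) (Set.toFinite _) hex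
    refine ⟨w', hw', LinearMap.ext fun c => ?_⟩
    rw [D.left_apply, D.right_apply h, D.right_apply hw', D.sum_lt_eq c _ _ hlt.le, add_assoc]
    congr 2
    symm
    apply Finset.sum_eq_single w
    · intro x hx hxw
      by_cases hax : G.Adj v x
      · have hx' := (Finset.mem_filter.1 hx).2
        have : D.θ v w < D.θ v x := lt_of_le_of_ne hx'.1 fun h0 =>
          hxw (D.θ_injective hax h h0.symm)
        exact absurd (hmin x ⟨hax, this⟩) (not_le.2 hx'.2)
      · exact c.2.1 _ hax
    · intro hx
      exact absurd (Finset.mem_filter.2 ⟨Finset.mem_univ _, le_rfl, hlt⟩) hx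
  · push Not at hex
    obtain ⟨w', hw', hmin⟩ := Set.exists_min_image {x | G.Adj v x}
      (D.θ v) (Set.toFinite _) ⟨w, h⟩
    refine ⟨w', hw', LinearMap.ext fun c => ?_⟩
    rw [D.left_apply, D.right_apply h, D.right_apply hw', add_assoc]
    congr 1
    have h1 : ∑ x with D.θ v x < D.θ v w', c.1 s(v, x) = 0 := by
      apply Finset.sum_eq_zero
      intro x hx
      by_cases hax : G.Adj v x
      · exact absurd (hmin x hax) (not_le.2 (Finset.mem_filter.1 hx).2)
      · exact c.2.1 _ hax
    rw [h1, ← c.2.2 v]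
    have h2 : c.1 s(v, w) = ∑ x, if x = w then c.1 s(v, x) else 0 := by simp
    rw [h2, Finset.sum_filter, ← Finset.sum_add_distrib]
    apply Finset.sum_congr rfl
    intro x _
    by_cases hax : G.Adj v x
    · by_cases hxw : x = w
      · simp [hxw]
      · have : D.θ v x < D.θ v w := lt_of_le_of_ne (hex x hax) fun h0 =>
          hxw (D.θ_injective hax h h0)
        simp [hxw, this]
    · have : c.1 s(v, x) = 0 := c.2.1 _ hax
      simp [this]

end FaceFunctionals

namespace FaceFunctionals

variable {V : Type*} [Fintype V] {G : SimpleGraph V} (D : FaceFunctionals G)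

/-- The functional `F` is one of the two faces at the edge `vw`. -/
def Bd (F : G.evenChains →ₗ[ZMod 2] ZMod 2) (v w : V) : Prop :=
  G.Adj v w ∧ (F = D.right v w ∨ F = D.left v w)

lemma Bd.symm {D : FaceFunctionals G} {F : G.evenChains →ₗ[ZMod 2] ZMod 2} {v w : V}
    (h : D.Bd F v w) : D.Bd F w v := by
  obtain ⟨ha, h⟩ := h
  refine ⟨ha.symm, ?_⟩
  rcases D.side_swap v w ha with hs | hs
  · have h1 : D.right v w = D.right w v := LinearMap.ext fun c => hs c.1 c.2
    have h2 : D.left v w = D.left w v := LinearMap.ext fun c => by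
      rw [left_apply, left_apply, h1, Sym2.eq_swap]
    rwa [← h1, ← h2]
  · have h1 : D.right v w = D.left w v := LinearMap.ext fun c => by
      rw [left_apply, Sym2.eq_swap]; exact hs c.1 c.2
    have h2 : D.left v w = D.right w v := LinearMap.ext fun c => by
      rw [left_apply, h1, left_apply, Sym2.eq_swap, add_assoc, zmod_two_add_self, add_zero]
    rw [← h1, ← h2]
    exact h.symm

lemma exists_next (v : V) : ∃ nxt : V → V, ∀ w, G.Adj v w →
    G.Adj v (nxt w) ∧ D.left v w = D.right v (nxt w) := by
  choose! nxt h using fun w (hw : G.Adj v w) => D.exists_left_eq_right hw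
  exact ⟨nxt, h⟩

lemma exists_right_eq_left (hG : NoCutVertex G) {v w : V} (h : G.Adj v w) :
    ∃ w', G.Adj v w' ∧ D.left v w' = D.right v w := by
  obtain ⟨nxt, hn⟩ := D.exists_next v
  obtain ⟨w', hw', rfl⟩ := Set.surj_on_of_inj_on_of_ncard_le (s := {w | G.Adj v w})
    (t := {w | G.Adj v w}) (fun w _ => nxt w) (fun w hw => (hn w hw).1)
    (fun w w' hw hw' he => D.left_injective hG hw hw' (by
      rw [(hn w hw).2, (hn w' hw').2]; exact congrArg _ he)) le_rfl (Set.toFinite _) w h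
  exact ⟨w', hw', (hn w' hw').2⟩

lemma Bd.exists_two (hG : NoCutVertex G) (hdeg : ∀ v w, G.Adj v w → ∃ w', w' ≠ w ∧ G.Adj v w')
    {F : G.evenChains →ₗ[ZMod 2] ZMod 2} {v w : V}
    (h : D.Bd F v w) : ∃ w', w' ≠ w ∧ ∀ x, D.Bd F v x ↔ x = w ∨ x = w' := by
  obtain ⟨ha, h⟩ := h
  obtain ⟨u, hu, hau⟩ := hdeg v w ha
  rcases h with rfl | rfl
  · obtain ⟨w', hw', he⟩ := D.exists_right_eq_left hG ha
    refine ⟨w', ?_, fun x => ⟨?_, ?_⟩⟩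
    · rintro rfl
      exact D.right_ne_left hG ha hau hu.symm he.symm
    · rintro ⟨hx, h | h⟩
      · exact Or.inl (D.right_injective hG hx ha h.symm)
      · exact Or.inr (D.left_injective hG hx hw' (h.symm.trans he.symm))
    · rintro (rfl | rfl)
      · exact ⟨ha, Or.inl rfl⟩
      · exact ⟨hw', Or.inr he.symm⟩
  · obtain ⟨w', hw', he⟩ := D.exists_left_eq_right ha
    refine ⟨w', ?_, fun x => ⟨?_, ?_⟩⟩
    · rintro rfl
      exact D.right_ne_left hG ha hau hu.symm he.symm
    · rintro ⟨hx, h | h⟩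
      · exact Or.inr (D.right_injective hG hx hw' (h.symm.trans he))
      · exact Or.inl (D.left_injective hG hx ha h.symm)
    · rintro (rfl | rfl)
      · exact ⟨ha, Or.inr rfl⟩
      · exact ⟨hw', Or.inl he⟩

lemma mem_of_closed (hG : NoCutVertex G) (v : V) (A : Set V) (hA : ∃ a ∈ A, G.Adj v a)
    (hcl : ∀ a ∈ A, ∀ F b, D.Bd F v a → D.Bd F v b → b ∈ A) (x : V) (hx : G.Adj v x) : x ∈ A := by
  classical
  by_contra hxA
  obtain ⟨a, haA, ha⟩ := hA
  have hax : a ≠ x := by rintro rfl; exact hxA haA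
  obtain ⟨c, hc, hcw⟩ := hG.exists_evenChain ha hx hax
  obtain ⟨nxt, hn⟩ := D.exists_next v
  let S : Finset V := Finset.univ.filter fun w => w ∈ A ∧ G.Adj v w
  have hS : ∀ w, w ∈ S ↔ w ∈ A ∧ G.Adj v w := fun w => by simp [S]
  have hmaps : ∀ w ∈ S, nxt w ∈ S := by
    intro w hw
    rw [hS] at hw ⊢
    have := hn w hw.2
    exact ⟨hcl w hw.1 (D.left v w) _ ⟨hw.2, Or.inr rfl⟩ ⟨this.1, Or.inl this.2⟩, this.1⟩
  have hinj : Set.InjOn nxt S := by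
    intro w hw w' hw' he
    have h1 := ((hS w).1 hw).2
    have h2 := ((hS w').1 hw').2
    exact D.left_injective hG h1 h2 (by rw [(hn w h1).2, (hn w' h2).2, he])
  have himg : S.image nxt = S :=
    Finset.eq_of_subset_of_card_le (Finset.image_subset_iff.2 hmaps)
      (Finset.card_image_of_injOn hinj).ge
  have hsum : ∑ w ∈ S, D.left v w ⟨c, hc⟩ = ∑ w ∈ S, D.right v w ⟨c, hc⟩ := by
    conv_rhs => rw [← himg]
    rw [Finset.sum_image hinj]
    exact Finset.sum_congr rfl fun w hw => by rw [(hn w ((hS w).1 hw).2).2]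
  simp only [left_apply] at hsum
  rw [Finset.sum_add_distrib] at hsum
  have h1 : ∑ w ∈ S, c s(v, w) = 1 := by
    rw [Finset.sum_eq_single a]
    · simp [hcw]
    · intro b hb hba
      rw [hcw, if_neg]
      rintro (rfl | rfl)
      · exact hba rfl
      · exact hxA ((hS _).1 hb).1
    · intro h
      exact absurd ((hS a).2 ⟨haA, ha⟩) h
  rw [h1] at hsum
  simp at hsum

end FaceFunctionals

lemma sum_sum_symm_eq_zero {V : Type*} [Fintype V] (c : Sym2 V → ZMod 2)
    (hc : ∀ v, c s(v, v) = 0) : ∑ v, ∑ w, c s(v, w) = 0 := by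
  classical
  obtain ⟨r⟩ : Nonempty (LinearOrder V) := ⟨LinearOrder.lift' _ (Fintype.equivFin V).injective⟩
  have h : ∀ v w, c s(v, w) = (if v < w then c s(v, w) else 0) + if w < v then c s(w, v) else 0 := by
    intro v w
    rcases lt_trichotomy v w with h | rfl | h
    · simp [h, h.not_gt]
    · simp [hc]
    · simp [h, h.not_gt, Sym2.eq_swap]
  rw [Finset.sum_congr rfl fun v _ => Finset.sum_congr rfl fun w _ => h v w]
  simp only [Finset.sum_add_distrib]
  rw [Finset.sum_comm (f := fun v w => if w < v then c s(w, v) else 0)]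
  exact zmod_two_add_self _

/-- Euler's inequality: functionals on even chains whose differences separate points give at least
`|E| - |V| + 2` values. -/
lemma SimpleGraph.ncard_edgeSet_add_two_le {V : Type*} [Fintype V] (G : SimpleGraph V)
    {ι : Type*} [Fintype ι] (φ : ι → G.evenChains →ₗ[ZMod 2] ZMod 2) (i₀ : ι) [Nonempty V]
    (hφ : ∀ c, (∀ i, φ i c = φ i₀ c) → c = 0) :
    G.edgeSet.ncard + 2 ≤ Fintype.card V + Fintype.card ι := by
  classical
  let ext : (G.edgeSet → ZMod 2) →ₗ[ZMod 2] (Sym2 V → ZMod 2) :=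
    { toFun := fun x e => if h : e ∈ G.edgeSet then x ⟨e, h⟩ else 0
      map_add' := fun x y => by ext e; by_cases h : e ∈ G.edgeSet <;> simp [h]
      map_smul' := fun k x => by ext e; by_cases h : e ∈ G.edgeSet <;> simp [h] }
  have ext_of : ∀ x e, e ∉ G.edgeSet → ext x e = 0 := fun x e h => dif_neg h
  have ext_mem : ∀ x (e : G.edgeSet), ext x e.1 = x e := fun x e => dif_pos e.2
  let bd : (G.edgeSet → ZMod 2) →ₗ[ZMod 2] (V → ZMod 2) :=
    LinearMap.pi fun v => ∑ w, (LinearMap.proj s(v, w)).comp ext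
  have bd_apply : ∀ x v, bd x v = ∑ w, ext x s(v, w) := fun x v => by
    simp [bd, LinearMap.sum_apply]
  have h1 := bd.finrank_range_add_finrank_ker
  have h2 : Module.finrank (ZMod 2) (LinearMap.range bd) < Module.finrank (ZMod 2) (V → ZMod 2) := by
    apply Submodule.finrank_lt
    intro htop
    obtain ⟨v₀⟩ := ‹Nonempty V›
    have : Pi.single v₀ 1 ∈ LinearMap.range bd := htop ▸ Submodule.mem_top
    obtain ⟨x, hx⟩ := this
    have h0 := sum_sum_symm_eq_zero (ext x) fun v => ext_of x _ (by simp)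
    simp_rw [← bd_apply, hx] at h0
    simp at h0
  have hker : ∀ x ∈ LinearMap.ker bd, ext x ∈ G.evenChains := fun x hx =>
    ⟨ext_of x, fun v => by rw [← bd_apply, LinearMap.mem_ker.1 hx]; rfl⟩
  let ext' : LinearMap.ker bd →ₗ[ZMod 2] G.evenChains :=
    (ext.comp (LinearMap.ker bd).subtype).codRestrict _ fun x => hker x.1 x.2
  let Ψ : LinearMap.ker bd →ₗ[ZMod 2] ({i // i ≠ i₀} → ZMod 2) :=
    LinearMap.pi fun i => (φ i.1 - φ i₀).comp ext'
  have hΨ : Function.Injective Ψ := by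
    rw [← LinearMap.ker_eq_bot, LinearMap.ker_eq_bot']
    intro x hx
    have h3 : ext' x = 0 := by
      apply hφ
      intro i
      by_cases hi : i = i₀
      · rw [hi]
      · have := congrFun hx ⟨i, hi⟩
        simpa [Ψ, sub_eq_zero] using this
    ext e
    have := congrFun (congrArg Subtype.val h3) e.1
    exact (ext_mem x.1 e).symm.trans this
  have h4 := LinearMap.finrank_le_finrank_of_injective hΨ
  have h5 : Fintype.card {i // i ≠ i₀} = Fintype.card ι - 1 := Set.card_ne_eq i₀
  have h6 : 0 < Fintype.card ι := Fintype.card_pos_iff.2 ⟨i₀⟩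
  have h7 : G.edgeSet.ncard = Fintype.card G.edgeSet := by
    rw [← Nat.card_coe_set_eq, Nat.card_eq_fintype_card]
  rw [Module.finrank_fintype_fun_eq_card] at h1 h2 h4
  omega

universe u in
theorem FaceFunctionals.exists_faceSystem {V : Type u} [Fintype V] {G : SimpleGraph V}
    (D : FaceFunctionals G) (hG : NoCutVertex G)
    (hdeg : ∀ v w, G.Adj v w → ∃ w', w' ≠ w ∧ G.Adj v w') {a b : V} (hab : G.Adj a b) :
    ∃ (κ : Type u) (_ : Fintype κ), Nonempty (FaceSystem G κ) := by
  classical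
  let T : Set (G.evenChains →ₗ[ZMod 2] ZMod 2) := {F | ∃ v w, D.Bd F v w}
  have hT : T.Finite := by
    apply (Set.finite_range (fun p : (V × V) × Bool =>
      if p.2 then D.right p.1.1 p.1.2 else D.left p.1.1 p.1.2)).subset
    rintro F ⟨v, w, -, rfl | rfl⟩
    · exact ⟨((v, w), true), by simp⟩
    · exact ⟨((v, w), false), by simp⟩
  have hr : ∀ {v w}, G.Adj v w → D.right v w ∈ T := fun h => ⟨_, _, h, Or.inl rfl⟩
  have hl : ∀ {v w}, G.Adj v w → D.left v w ∈ T := fun h => ⟨_, _, h, Or.inr rfl⟩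
  have : Fintype T := hT.fintype
  refine ⟨T, inferInstance, ⟨⟨fun F v w => D.Bd F.1 v w, fun h => h.symm, fun h => h.1, ?_,
    fun h => Bd.exists_two D hG hdeg h, ?_, fun F => F.2, ?_⟩⟩⟩
  · intro v w h
    obtain ⟨w', hw', h'⟩ := hdeg v w h
    refine ⟨⟨_, hr h⟩, ⟨_, hl h⟩, fun he => D.right_ne_left hG h h' hw'.symm
      (congrArg Subtype.val he), fun F => ?_⟩
    simp [Bd, h, Subtype.ext_iff]
  · intro v A hA hcl
    refine D.mem_of_closed hG v A hA fun x hx F y h1 h2 => ?_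
    exact hcl x hx ⟨F, v, x, h1⟩ y h1 h2
  · have : Nonempty V := ⟨a⟩
    refine G.ncard_edgeSet_add_two_le (fun F : T => F.1) ⟨_, hr hab⟩ fun c hc => ?_
    ext e
    by_cases he : e ∈ G.edgeSet
    · induction e with | _ v w =>
      have h1 := hc ⟨_, hr he⟩
      have h2 := hc ⟨_, hl he⟩
      simp only at h1 h2
      rw [← h1, left_apply] at h2
      simpa using h2
    · exact c.2.1 e he

/-- All neighbours of `v` are among `a`, `b`, `c`. -/
def SimpleGraph.NbrsAmong {V : Type*} (G : SimpleGraph V) (v a b c : V) : Prop :=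
  ∀ w, G.Adj v w → w = a ∨ w = b ∨ w = c

/-- The vertex `v` has degree at most three. -/
def SimpleGraph.DegLeThree {V : Type*} (G : SimpleGraph V) (v : V) : Prop :=
  ∃ a b c, G.NbrsAmong v a b c

/-- The structural hypotheses under which the discharging argument works. -/
structure Reduced {V : Type*} (G : SimpleGraph V) : Prop where
  no_hexagon : ∀ {a b c d e f}, G.Adj a b → G.Adj b c → G.Adj c d → G.Adj d e → G.Adj e f →
    G.Adj f a → a ≠ c → a ≠ d → a ≠ e → b ≠ d → b ≠ e → b ≠ f → c ≠ e → c ≠ f → d ≠ f → False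
  no_adj_deg_three : ∀ {u v}, G.Adj u v → G.DegLeThree u → G.DegLeThree v → False
  min_deg : ∀ v a b, ∃ w, G.Adj v w ∧ w ≠ a ∧ w ≠ b
  no_clique : ∀ {a b c d e}, G.Adj a b → G.Adj a c → G.Adj a d → G.Adj a e → G.Adj b c →
    G.Adj b d → G.Adj b e → G.Adj c d → G.Adj c e → G.Adj d e → False
  six_le : ∀ a b c d e : V, ∃ w, w ≠ a ∧ w ≠ b ∧ w ≠ c ∧ w ≠ d ∧ w ≠ e
  connected : ∀ S : Set V, S.Nonempty → (∀ a ∈ S, ∀ b, G.Adj a b → b ∈ S) → ∀ x, x ∈ S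

namespace FaceSystem

variable {V : Type*} [Fintype V] {G : SimpleGraph V} {κ : Type*} [Fintype κ] (S : FaceSystem G κ)

open Classical in
/-- The number of vertices on the boundary of `F`. -/
noncomputable def len (F : κ) : ℕ := (Finset.univ.filter fun v => ∃ w, S.B F v w).card

/-- `F` is a triangular face with vertices `x`, `y`, `z`. -/
def Tri (F : κ) (x y z : V) : Prop := S.len F ≤ 3 ∧ S.B F x y ∧ S.B F y z ∧ S.B F z x

/-- `x`, `y`, `z` span a triangular face. -/
def T (x y z : V) : Prop := ∃ F, S.Tri F x y z

/-- The edges `va` and `vb` are consecutive on some face. -/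
def R (v a b : V) : Prop := a ≠ b ∧ ∃ F, S.B F v a ∧ S.B F v b

variable {S}

lemma le_len {F : κ} {s : Finset V} (h : ∀ v ∈ s, ∃ w, S.B F v w) : s.card ≤ S.len F :=
  Finset.card_le_card fun v hv => by simpa using h v hv

lemma B.ne {F : κ} {v w : V} (h : S.B F v w) : v ≠ w := (S.adj h).ne

lemma B.exists_other {F : κ} {v w : V} (h : S.B F v w) :
    ∃ w', w' ≠ w ∧ S.B F v w' ∧ ∀ x, S.B F v x → x = w ∨ x = w' := by
  obtain ⟨w', hne, hw'⟩ := S.two_edges h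
  exact ⟨w', hne, (hw' _).2 (Or.inr rfl), fun x hx => (hw' x).1 hx⟩

lemma B.mem_pair {F : κ} {v a b x : V} (ha : S.B F v a) (hb : S.B F v b) (hab : a ≠ b)
    (hx : S.B F v x) : x = a ∨ x = b := by
  obtain ⟨w', hne, -, hw'⟩ := ha.exists_other
  rcases hw' b hb with h | h
  · exact absurd h.symm hab
  · rw [h]; exact hw' x hx

lemma eq_or_eq {F₁ F₂ F : κ} {v w : V} (h1 : S.B F₁ v w) (h2 : S.B F₂ v w) (hne : F₁ ≠ F₂)
    (h : S.B F v w) : F = F₁ ∨ F = F₂ := by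
  obtain ⟨A, A', -, hA⟩ := S.two_faces (S.adj h)
  have h1 := (hA _).1 h1
  have h2 := (hA _).1 h2
  have h := (hA _).1 h
  grind

lemma eq_of_ne {F F₁ F₂ : κ} {v w : V} (h : S.B F v w) (h1 : S.B F₁ v w) (h2 : S.B F₂ v w)
    (hne1 : F₁ ≠ F) (hne2 : F₂ ≠ F) : F₁ = F₂ := by
  rcases S.eq_or_eq h h1 hne1.symm h2 with h | h
  · exact absurd h hne2
  · exact h.symm

lemma exists_opp {F : κ} {v w : V} (h : S.B F v w) : ∃ F', F' ≠ F ∧ S.B F' v w := by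
  obtain ⟨A, A', hne, hA⟩ := S.two_faces (S.adj h)
  rcases (hA F).1 h with rfl | rfl
  · exact ⟨A', hne.symm, (hA _).2 (Or.inr rfl)⟩
  · exact ⟨A, hne, (hA _).2 (Or.inl rfl)⟩

lemma R.symm {v a b : V} (h : S.R v a b) : S.R v b a :=
  ⟨h.1.symm, h.2.imp fun _ h => h.symm⟩

lemma R.adj_left {v a b : V} (h : S.R v a b) : G.Adj v a := by
  obtain ⟨-, F, h, -⟩ := h; exact S.adj h

lemma R.mem_of_two {v a b c x : V} (h1 : S.R v a b) (h2 : S.R v a c) (hbc : b ≠ c)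
    (h : S.R v a x) : x = b ∨ x = c := by
  obtain ⟨hb, F₁, h1, h1'⟩ := h1
  obtain ⟨hc, F₂, h2, h2'⟩ := h2
  obtain ⟨hx, F, h, h'⟩ := h
  have hne : F₁ ≠ F₂ := by
    rintro rfl
    rcases h1.mem_pair h1' hb h2' with h | h
    · exact hc h.symm
    · exact hbc h.symm
  rcases eq_or_eq h1 h2 hne h with rfl | rfl
  · exact Or.inl ((h1.mem_pair h1' hb h').resolve_left hx.symm)
  · exact Or.inr ((h2.mem_pair h2' hc h').resolve_left hx.symm)

lemma R.not_three {v a b c d : V} (h1 : S.R v a b) (h2 : S.R v a c) (h3 : S.R v a d)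
    (hbc : b ≠ c) (hbd : b ≠ d) (hcd : c ≠ d) : False := by
  rcases h1.mem_of_two h2 hbc h3 with h | h
  · exact hbd h.symm
  · exact hcd h.symm

lemma nbrs_of_closed {v : V} (A : Set V) (hA : ∃ a ∈ A, G.Adj v a)
    (h : ∀ a ∈ A, ∀ b, S.R v a b → b ∈ A) (x : V) (hx : G.Adj v x) : x ∈ A := by
  refine S.link v A hA (fun a ha F b h1 h2 => ?_) x hx
  by_cases hab : a = b
  · rwa [← hab]
  · exact h a ha b ⟨hab, F, h1, h2⟩

lemma nbrs_of_three {v a b c : V} (h1 : S.R v a b) (h2 : S.R v b c) (h3 : S.R v c a) :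
    G.NbrsAmong v a b c := by
  refine fun x hx => nbrs_of_closed (S := S) {a, b, c} ⟨a, by simp, h1.adj_left⟩ ?_ x hx
  rintro w (rfl | rfl | rfl) u hu
  · rcases h1.mem_of_two h3.symm h2.1 hu with rfl | rfl <;> simp
  · rcases h1.symm.mem_of_two h2 h3.1.symm hu with rfl | rfl <;> simp
  · rcases h3.mem_of_two h2.symm h1.1 hu with rfl | rfl <;> simp

lemma degLeThree_of_three {v a b c : V} (h1 : S.R v a b) (h2 : S.R v b c) (h3 : S.R v c a) :
    G.DegLeThree v := ⟨a, b, c, nbrs_of_three h1 h2 h3⟩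

lemma nbrs_of_four {v a b c d x : V} (h1 : S.R v a b) (h2 : S.R v b c) (h3 : S.R v c d)
    (h4 : S.R v d a) (hac : a ≠ c) (hbd : b ≠ d) (hx : G.Adj v x) :
    x = a ∨ x = b ∨ x = c ∨ x = d := by
  refine nbrs_of_closed (S := S) {a, b, c, d} ⟨a, by simp, h1.adj_left⟩ ?_ x hx
  rintro w (rfl | rfl | rfl | rfl) u hu
  · rcases h1.mem_of_two h4.symm hbd hu with rfl | rfl <;> simp
  · rcases h1.symm.mem_of_two h2 hac hu with rfl | rfl <;> simp
  · rcases h3.mem_of_two h2.symm hbd.symm hu with rfl | rfl <;> simp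
  · rcases h3.symm.mem_of_two h4 hac.symm hu with rfl | rfl <;> simp

/-- Two distinct faces do not share two consecutive edges. -/
lemma eq_of_share (hG : Reduced G) {F F' : κ} {v a b : V} (hab : a ≠ b) (h1 : S.B F v a)
    (h2 : S.B F v b) (h3 : S.B F' v a) (h4 : S.B F' v b) : F = F' := by
  by_contra hne
  obtain ⟨w, hw, hwa, hwb⟩ := hG.min_deg v a b
  have := S.link v {a, b} ⟨a, by simp, S.adj h1⟩ (by
    rintro c hc F₀ d h5 h6
    have h0 : F₀ = F ∨ F₀ = F' := by
      rcases hc with rfl | rfl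
      · exact eq_or_eq h1 h3 hne h5
      · exact eq_or_eq h2 h4 hne h5
    rcases h0 with rfl | rfl
    · rcases h1.mem_pair h2 hab h6 with rfl | rfl <;> simp
    · rcases h3.mem_pair h4 hab h6 with rfl | rfl <;> simp) w hw
  rcases this with h | h
  · exact hwa h
  · exact hwb h

lemma Tri.rotate {F : κ} {x y z : V} (h : S.Tri F x y z) : S.Tri F y z x :=
  ⟨h.1, h.2.2.1, h.2.2.2, h.2.1⟩

lemma Tri.swap {F : κ} {x y z : V} (h : S.Tri F x y z) : S.Tri F y x z :=
  ⟨h.1, S.symm h.2.1, S.symm h.2.2.2, S.symm h.2.2.1⟩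

lemma T.rotate {x y z : V} (h : S.T x y z) : S.T y z x := h.imp fun _ h => h.rotate

lemma T.swap {x y z : V} (h : S.T x y z) : S.T y x z := h.imp fun _ h => h.swap

lemma T.adj {x y z : V} (h : S.T x y z) : G.Adj x y := by
  obtain ⟨F, h⟩ := h; exact S.adj h.2.1

lemma T.r {x y z : V} (h : S.T x y z) : S.R x y z := by
  refine ⟨h.rotate.adj.ne, ?_⟩
  obtain ⟨F, h⟩ := h
  exact ⟨F, h.2.1, S.symm h.2.2.2⟩

/-- The boundary of a face, followed from one of its edges. -/
lemma B.cases {F : κ} {x z : V} (h : S.B F x z) :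
    (∃ p, S.B F z p ∧ S.B F p x) ∨
    (∃ p q, x ≠ p ∧ z ≠ q ∧ S.B F z p ∧ S.B F p q ∧ S.B F q x) ∨
    (∃ p q r, x ≠ p ∧ x ≠ q ∧ z ≠ q ∧ z ≠ r ∧ p ≠ r ∧
      S.B F z p ∧ S.B F p q ∧ S.B F q r ∧ S.B F r x) ∨ 6 ≤ S.len F := by
  classical
  obtain ⟨p, hpx, hp, hzu⟩ := (S.symm h).exists_other
  obtain ⟨q, hqz, hq, hpu⟩ := (S.symm hp).exists_other
  by_cases hqx : q = x
  · subst hqx; exact Or.inl ⟨p, hp, hq⟩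
  obtain ⟨r, hrp, hr, hqu⟩ := (S.symm hq).exists_other
  by_cases hrx : r = x
  · subst hrx; exact Or.inr (Or.inl ⟨p, q, hpx.symm, hqz.symm, hp, hq, hr⟩)
  obtain ⟨s, hsq, hs, hru⟩ := (S.symm hr).exists_other
  have hrz : r ≠ z := by
    rintro rfl
    rcases hzu q (S.symm hr) with h | h
    · exact hqx h
    · exact hq.ne h.symm
  by_cases hsx : s = x
  · subst hsx
    exact Or.inr (Or.inr (Or.inl ⟨p, q, r, hpx.symm, Ne.symm hqx, hqz.symm, hrz.symm, hrp.symm,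
      hp, hq, hr, hs⟩))
  have hsz : s ≠ z := by
    rintro rfl
    rcases hzu r (S.symm hs) with h | h
    · exact hrx h
    · exact hrp h
  have hsp : s ≠ p := by
    rintro rfl
    rcases hpu r (S.symm hs) with h | h
    · exact hrz h
    · exact hr.ne h.symm
  refine Or.inr (Or.inr (Or.inr ?_))
  have hcard : ({x, z, p, q, r, s} : Finset V).card = 6 := by
    have := h.ne; have := hp.ne; have := hq.ne; have := hr.ne; have := hs.ne
    simp only [Finset.card_insert_eq_ite, Finset.mem_insert, Finset.mem_singleton,
      Finset.card_singleton]
    grind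
  rw [← hcard]
  apply le_len
  intro v hv
  simp only [Finset.mem_insert, Finset.mem_singleton] at hv
  rcases hv with rfl | rfl | rfl | rfl | rfl | rfl
  exacts [⟨_, h⟩, ⟨_, hp⟩, ⟨_, hq⟩, ⟨_, hr⟩, ⟨_, hs⟩, ⟨_, S.symm hs⟩]

lemma three_le_len (F : κ) : 3 ≤ S.len F := by
  classical
  obtain ⟨v, w, h⟩ := S.nonempty F
  obtain ⟨u, hu, h', -⟩ := h.exists_other
  have hcard : ({v, w, u} : Finset V).card = 3 :=
    Finset.card_eq_three.2 ⟨_, _, _, h.ne, h'.ne, hu.symm, rfl⟩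
  rw [← hcard]
  apply le_len
  intro v hv
  simp only [Finset.mem_insert, Finset.mem_singleton] at hv
  rcases hv with rfl | rfl | rfl
  exacts [⟨_, h⟩, ⟨_, S.symm h⟩, ⟨_, S.symm h'⟩]

lemma exists_tri {F : κ} (hF : S.len F ≤ 3) {x y : V} (h : S.B F x y) : ∃ z, S.Tri F x y z := by
  classical
  have key : ∀ p q, x ≠ p → y ≠ q → S.B F y p → S.B F p q → x ≠ q → False := by
    intro p q h1 h2 h3 h4 h5
    have hcard : ({x, y, p, q} : Finset V).card = 4 := by
      have := h.ne; have := h3.ne; have := h4.ne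
      simp only [Finset.card_insert_eq_ite, Finset.mem_insert, Finset.mem_singleton,
        Finset.card_singleton]
      grind
    have : ({x, y, p, q} : Finset V).card ≤ S.len F := by
      apply le_len
      intro v hv
      simp only [Finset.mem_insert, Finset.mem_singleton] at hv
      rcases hv with rfl | rfl | rfl | rfl
      exacts [⟨_, h⟩, ⟨_, h3⟩, ⟨_, h4⟩, ⟨_, S.symm h4⟩]
    omega
  rcases h.cases with ⟨p, h1, h2⟩ | ⟨p, q, h1, h2, h3, h4, h5⟩ |
    ⟨p, q, r, h1, h2, h3, h4, h5, h6, h7, h8, h9⟩ | h0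
  · exact ⟨p, hF, h, h1, h2⟩
  · exact (key p q h1 h2 h3 h4 h5.ne.symm).elim
  · exact (key p q h1 h3 h6 h7 h2).elim
  · omega

lemma six_le_of_triangle {F : κ} (hF : 4 ≤ S.len F) {x y z : V} (h : S.B F x y) (h' : S.B F y z)
    (h'' : S.B F z x) : 6 ≤ S.len F := by
  classical
  obtain ⟨u, ⟨w, hu⟩, hux, huy, huz⟩ : ∃ u, (∃ w, S.B F u w) ∧ u ≠ x ∧ u ≠ y ∧ u ≠ z := by
    by_contra! hcon
    have : S.len F ≤ ({x, y, z} : Finset V).card := by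
      apply Finset.card_le_card
      intro v hv
      have := hcon v (by simpa using hv)
      simp only [Finset.mem_insert, Finset.mem_singleton]
      tauto
    have := Finset.card_le_three (a := x) (b := y) (c := z)
    omega
  obtain ⟨w', hw', hu', -⟩ := hu.exists_other
  have hx : ∀ v, S.B F u v → v ≠ x ∧ v ≠ y ∧ v ≠ z := by
    intro v hv
    refine ⟨?_, ?_, ?_⟩
    · rintro rfl
      have := h.mem_pair (S.symm h'') h'.ne (S.symm hv)
      tauto
    · rintro rfl
      have := h'.mem_pair (S.symm h) h''.ne (S.symm hv)
      tauto
    · rintro rfl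
      have := h''.mem_pair (S.symm h') h.ne (S.symm hv)
      tauto
  have h1 := hx w hu
  have h2 := hx w' hu'
  have hcard : ({x, y, z, u, w, w'} : Finset V).card = 6 := by
    have := h.ne; have := h'.ne; have := h''.ne; have := hu.ne; have := hu'.ne
    simp only [Finset.card_insert_eq_ite, Finset.mem_insert, Finset.mem_singleton,
      Finset.card_singleton]
    grind
  rw [← hcard]
  apply le_len
  intro v hv
  simp only [Finset.mem_insert, Finset.mem_singleton] at hv
  rcases hv with rfl | rfl | rfl | rfl | rfl | rfl
  exacts [⟨_, h⟩, ⟨_, h'⟩, ⟨_, h''⟩, ⟨_, hu⟩, ⟨_, S.symm hu⟩, ⟨_, S.symm hu'⟩]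

/-- The face `F` has a pentagonal boundary with edge `xz`. -/
def Pent (S : FaceSystem G κ) (F : κ) (x z p q r : V) : Prop :=
  x ≠ p ∧ x ≠ q ∧ z ≠ q ∧ z ≠ r ∧ p ≠ r ∧ S.B F z p ∧ S.B F p q ∧ S.B F q r ∧ S.B F r x

/-- The face `F` has a quadrangular boundary with edge `xz`. -/
def Quad (S : FaceSystem G κ) (F : κ) (x z p q : V) : Prop :=
  x ≠ p ∧ z ≠ q ∧ S.B F z p ∧ S.B F p q ∧ S.B F q x

lemma B.cases_of_four_le {F : κ} {x z : V} (h : S.B F x z) (hF : 4 ≤ S.len F) :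
    6 ≤ S.len F ∨ (5 ≤ S.len F ∧ ∃ p q r, S.Pent F x z p q r) ∨ ∃ p q, S.Quad F x z p q := by
  classical
  rcases h.cases with ⟨p, h1, h2⟩ | ⟨p, q, h1⟩ |
    ⟨p, q, r, h1, h2, h3, h4, h5, h6, h7, h8, h9⟩ | h0
  · exact Or.inl (six_le_of_triangle hF h h1 h2)
  · exact Or.inr (Or.inr ⟨p, q, h1⟩)
  · refine Or.inr (Or.inl ⟨?_, p, q, r, h1, h2, h3, h4, h5, h6, h7, h8, h9⟩)
    have hcard : ({x, z, p, q, r} : Finset V).card = 5 := by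
      have := h.ne; have := h6.ne; have := h7.ne; have := h8.ne; have := h9.ne
      simp only [Finset.card_insert_eq_ite, Finset.mem_insert, Finset.mem_singleton,
        Finset.card_singleton]
      grind
    rw [← hcard]
    apply le_len
    intro v hv
    simp only [Finset.mem_insert, Finset.mem_singleton] at hv
    rcases hv with rfl | rfl | rfl | rfl | rfl
    exacts [⟨_, h⟩, ⟨_, h6⟩, ⟨_, h7⟩, ⟨_, h8⟩, ⟨_, h9⟩]
  · exact Or.inl h0

end FaceSystem

namespace FaceSystem

variable {V : Type*} [Fintype V] {G : SimpleGraph V} {κ : Type*} [Fintype κ]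
  {S : FaceSystem G κ}

/-- Three triangular faces around the vertex `y`. -/
def Trio (S : FaceSystem G κ) (x y z a : V) : Prop := S.T x y z ∧ S.T x y a ∧ S.T y z a

lemma Trio.symm {x y z a : V} (h : S.Trio x y z a) : S.Trio z y x a :=
  ⟨h.1.rotate.swap, h.2.2.swap, h.2.1.swap⟩

lemma Trio.nbrs {x y z a : V} (h : S.Trio x y z a) : G.NbrsAmong y x z a :=
  nbrs_of_three h.1.swap.r h.2.2.r h.2.1.swap.r.symm

lemma Trio.degLeThree {x y z a : V} (h : S.Trio x y z a) : G.DegLeThree y := ⟨_, _, _, h.nbrs⟩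

lemma Trio.not_adj {x y z a c : V} (h : S.Trio x y z a) (hx : c ≠ x) (hz : c ≠ z) (ha : c ≠ a) :
    ¬ G.Adj y c := by
  intro hc
  rcases h.nbrs c hc with h | h | h <;> contradiction

/-- The apexes over the three sides of a triangle are not all distinct. -/
lemma apexes_not_distinct (hG : Reduced G) {x y z a b c : V} (hxy : S.T x y a) (hyz : S.T y z b)
    (hzx : S.T z x c) (ha : a ≠ z) (hb : b ≠ x) (hc : c ≠ y) : a = b ∨ b = c ∨ c = a := by
  by_contra! hcon
  obtain ⟨h1, h2, h3⟩ := hcon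
  exact hG.no_hexagon hxy.rotate.rotate.adj.symm hxy.rotate.adj.symm hyz.rotate.rotate.adj.symm
    hyz.rotate.adj.symm hzx.rotate.rotate.adj.symm hzx.rotate.adj.symm
    hxy.adj.ne hb.symm hzx.adj.ne.symm h1 ha h3.symm hyz.adj.ne hc.symm h2

section

variable (hG : Reduced G) {x y z a c : V}
include hG

lemma Trio.not_T (h : S.Trio x y z a) : ¬ S.T z x a := by
  intro h'
  exact hG.no_adj_deg_three h.1.adj
    (degLeThree_of_three h.1.r h'.swap.r h.2.1.r.symm) h.degLeThree

lemma Trio.ne_outer (h : S.Trio x y z a) (hc : S.T z x c) : c ≠ a := by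
  rintro rfl; exact h.not_T hG hc

lemma Trio.eq_of_side (h : S.Trio x y z a) (hc : S.T z x c) (hcy : c ≠ y) {d : V}
    (hd : S.T x a d) (hdy : d ≠ y) : d = c := by
  by_contra hdc
  have hca := h.ne_outer hG hc
  by_cases hdz : d = z
  · subst hdz; exact h.not_T hG hd.rotate.rotate
  · exact hG.no_hexagon hd.rotate.rotate.adj.symm hd.rotate.adj.symm h.2.2.rotate.rotate.adj
      h.1.rotate.adj hc.rotate.rotate.adj.symm hc.rotate.adj.symm hd.adj.ne h.1.adj.ne
      h.1.rotate.rotate.adj.ne.symm hdy hdz hdc h.2.2.rotate.adj.ne.symm hca.symm hcy.symm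

lemma Trio.eq_of_outer (h : S.Trio x y z a) (hc : S.T z x c) (hcy : c ≠ y) {d : V}
    (hd : S.T x c d) (hdz : d ≠ z) : d = a := by
  by_contra hda
  have hca := h.ne_outer hG hc
  have hdy : d ≠ y := by
    rintro rfl
    exact h.not_adj hc.rotate.adj.ne.symm hc.rotate.rotate.adj.ne hca hd.rotate.adj.symm
  exact hG.no_hexagon hd.rotate.rotate.adj.symm hd.rotate.adj.symm hc.rotate.rotate.adj
    h.1.rotate.adj.symm h.2.1.rotate.adj h.2.1.rotate.rotate.adj hd.adj.ne h.1.rotate.rotate.adj.ne.symm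
    h.1.adj.ne hdz hdy hda hcy hca h.2.2.rotate.adj.ne

lemma Trio.not_five (h : S.Trio x y z a) (hc : S.T z x c) (hcy : c ≠ y) (h1 : S.T x a c)
    (h2 : S.T z a c) : False := by
  have hca := h.ne_outer hG hc
  obtain ⟨w, hw⟩ := hG.six_le x y z a c
  have := hG.connected {x, y, z, a, c} ⟨x, by simp⟩ (by
    rintro u hu b hb
    simp only [Set.mem_insert_iff, Set.mem_singleton_iff] at hu ⊢
    rcases hu with rfl | rfl | rfl | rfl | rfl
    · have := nbrs_of_four h.1.r hc.swap.r h1.r.symm h.2.1.r.symm hcy.symm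
        h.2.2.rotate.adj.ne hb
      tauto
    · have := h.nbrs b hb
      tauto
    · have := nbrs_of_four h.1.rotate.rotate.r.symm hc.r h2.r.symm h.2.2.swap.r.symm hcy.symm
        h.2.1.rotate.rotate.adj.ne.symm hb
      tauto
    · have := nbrs_of_four h.2.1.rotate.rotate.r h.2.2.rotate.rotate.r h2.swap.r
        h1.swap.r.symm h.1.rotate.rotate.adj.ne.symm hcy.symm hb
      tauto
    · have := nbrs_of_three hc.rotate.rotate.r h1.rotate.rotate.r h2.rotate.rotate.r.symm b hb
      tauto) w
  simp only [Set.mem_insert_iff, Set.mem_singleton_iff] at this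
  tauto

end

lemma ne_of_share (hG : Reduced G) {F F' : κ} {v a b c : V} (hF : F ≠ F') (hab : a ≠ b)
    (h1 : S.B F v a) (h2 : S.B F v b) (h3 : S.B F' v a) (h4 : S.B F' v c) : b ≠ c := by
  rintro rfl
  exact hF (S.eq_of_share hG hab h1 h2 h3 h4)

lemma T_of_tri {F : κ} {x y z : V} (h : S.Tri F x y z) : S.T x y z := ⟨F, h⟩

lemma Trio.six_le (hG : Reduced G) {F F' : κ} {x y z a : V} (h : S.Trio x y z a)
    (hF : S.Tri F x y z) (hF' : S.B F' x z) (hne : F ≠ F') (h4 : 4 ≤ S.len F') :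
    6 ≤ S.len F' := by
  have hxa := h.2.1.rotate.rotate.adj.symm
  have hza := h.2.2.rotate.adj
  have hay := h.2.1.rotate.adj.symm
  have hxy := h.1.adj
  have hyz := h.1.rotate.adj
  have hxz := h.1.rotate.rotate.adj.symm
  rcases hF'.cases_of_four_le h4 with h6 | ⟨-, p, q, r, h1, h2, h3, h4, h5, h6, h7, h8, h9⟩ |
    ⟨p, q, h1, h2, h3, h4, h5⟩
  · exact h6
  · exfalso
    have hpy : y ≠ p := ne_of_share hG hne hxy.ne hF.2.2.2 (S.symm hF.2.2.1) (S.symm hF') h6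
    have hry : y ≠ r := ne_of_share hG hne hyz.ne.symm (S.symm hF.2.2.2) hF.2.1 hF' (S.symm h9)
    by_cases hqy : y = q
    · subst hqy
      have hp := h.nbrs p (S.adj h7).symm
      have hr := h.nbrs r (S.adj h8)
      have := (S.adj h6).ne
      have := (S.adj h9).ne
      grind
    · exact hG.no_hexagon hxy hyz (S.adj h6) (S.adj h7) (S.adj h8) (S.adj h9) hxz.ne h1 h2
        hpy hqy hry h3 h4 h5
  · exfalso
    have hpy : y ≠ p := ne_of_share hG hne hxy.ne hF.2.2.2 (S.symm hF.2.2.1) (S.symm hF') h3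
    have hqy : y ≠ q := ne_of_share hG hne hyz.ne.symm (S.symm hF.2.2.2) hF.2.1 hF' (S.symm h5)
    have hpa : a ≠ p := by
      rintro rfl
      exact hG.no_adj_deg_three hyz h.degLeThree (degLeThree_of_three h.1.rotate.rotate.r
        h.2.2.swap.r ⟨hxa.ne.symm, F', h3, S.symm hF'⟩)
    have hqa : a ≠ q := by
      rintro rfl
      exact hG.no_adj_deg_three hxy (degLeThree_of_three h.1.r.symm
        h.2.1.r ⟨hza.ne.symm, F', S.symm h5, hF'⟩) h.degLeThree
    exact hG.no_hexagon hxa hay hyz (S.adj h3) (S.adj h4) (S.adj h5) hxy.ne hxz.ne h1 hza.ne.symm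
      hpa hqa hpy hqy h2

lemma not_quad_of_two (hG : Reduced G) {F F' : κ} {x y z a b p q : V} (hF : S.Tri F x y z)
    (ha : S.T x y a) (hb : S.T y z b) (haz : a ≠ z) (hbx : b ≠ x) (hab : a ≠ b)
    (hF' : S.B F' x z) (hne : F ≠ F') : ¬ S.Quad F' x z p q := by
  rintro ⟨h1, h2, h3, h4, h5⟩
  have hT := T_of_tri hF
  have hxy := hT.adj
  have hyz := hT.rotate.adj
  have hxz := hT.rotate.rotate.adj.symm
  have hay := ha.rotate.adj.symm
  have hxa := ha.rotate.rotate.adj.symm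
  have hyb := hb.rotate.rotate.adj.symm
  have hbz := hb.rotate.adj.symm
  have hpy : y ≠ p := ne_of_share hG hne hxy.ne hF.2.2.2 (S.symm hF.2.2.1) (S.symm hF') h3
  have hqy : y ≠ q := ne_of_share hG hne hyz.ne.symm (S.symm hF.2.2.2) hF.2.1 hF' (S.symm h5)
  have hapq : a = p ∨ a = q := by
    by_contra! hcon
    exact hG.no_hexagon hxa hay hyz (S.adj h3) (S.adj h4) (S.adj h5) hxy.ne hxz.ne h1 haz
      hcon.1 hcon.2 hpy hqy h2
  have hbpq : b = p ∨ b = q := by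
    by_contra! hcon
    exact hG.no_hexagon hxy hyb hbz (S.adj h3) (S.adj h4) (S.adj h5) hbx.symm hxz.ne h1 hyz.ne
      hpy hqy hcon.1 hcon.2 h2
  rcases hapq with rfl | rfl <;> rcases hbpq with rfl | rfl
  · exact hab rfl
  · exact hG.no_clique hxy hxz hxa (S.adj h5).symm hyz hay.symm hyb (S.adj h3) hbz.symm (S.adj h4)
  · exact hG.no_adj_deg_three hxz (degLeThree_of_three hT.r.symm ha.r ⟨haz, F', S.symm h5, hF'⟩)
      (degLeThree_of_three hT.rotate.rotate.r hb.swap.r ⟨hbx, F', h3, S.symm hF'⟩)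
  · exact hab rfl

section

variable (hG : Reduced G) {x y z a c : V}
include hG

/-- The face across `zc` from the outer triangle `zxc` of a trio, when the face across `xc` is
triangular. -/
lemma Trio.six_le_outer (h : S.Trio x y z a) {F F' : κ} (hF : S.Tri F z x c) (hcy : c ≠ y)
    (hca : S.T x c a) (hF' : S.B F' z c) (hne : F ≠ F') (h4 : 4 ≤ S.len F') :
    6 ≤ S.len F' := by
  have hc := T_of_tri hF
  have hne' := h.ne_outer hG hc
  have hxy := h.1.adj
  have hyz := h.1.rotate.adj
  have hzx := h.1.rotate.rotate.adj
  have hxc := hc.rotate.adj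
  have hcz := hc.rotate.rotate.adj
  have hyc := h.not_adj hxc.ne.symm hcz.ne hne'
  have hzq : ∀ q, S.B F' z q → q ≠ c → q ≠ y := by
    rintro _ hq hqc rfl
    exact h.1.rotate.rotate.swap.swap.r.symm.not_three h.2.2.swap.r
      ⟨hcy.symm, F', hq, hF'⟩ h.2.1.rotate.rotate.adj.ne.symm hxc.ne hne'.symm
  have hcp : ∀ p, S.B F' c p → x ≠ p := fun p hp =>
    ne_of_share hG hne hzx.ne hF.2.2.2 (S.symm hF.2.2.1) (S.symm hF') hp
  have hzq' : ∀ q, S.B F' z q → x ≠ q := fun q hq =>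
    ne_of_share hG hne hxc.ne.symm (S.symm hF.2.2.2) hF.2.1 hF' hq
  rcases hF'.cases_of_four_le h4 with h6 | ⟨-, p, q, r, h1, h2, h3, h4, h5, h6, h7, h8, h9⟩ |
    ⟨p, q, h1, h2, h3, h4, h5⟩
  · exact h6
  · exfalso
    by_cases hqx : x = q
    · subst hqx
      have hp := nbrs_of_four h.1.r hc.swap.r hca.r h.2.1.r.symm hcy.symm
        h.2.2.rotate.adj.ne (S.adj h7).symm
      have hr := nbrs_of_four h.1.r hc.swap.r hca.r h.2.1.r.symm hcy.symm
        h.2.2.rotate.adj.ne (S.adj h8)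
      have hpy : p ≠ y := by rintro rfl; exact hyc (S.adj h6).symm
      have hry := hzq r (S.symm h9) h4.symm
      have := (S.adj h6).ne
      have := (S.adj h9).ne
      grind
    · exact hG.no_hexagon hzx hxc (S.adj h6) (S.adj h7) (S.adj h8) (S.adj h9) hcz.ne.symm h1 h2
        (hcp p h6) hqx (hzq' r (S.symm h9)) h3 h4 h5
  · exfalso
    have hpy : y ≠ p := by rintro rfl; exact hyc (S.adj h3).symm
    exact hG.no_hexagon hyz.symm hxy.symm hxc (S.adj h3) (S.adj h4) (S.adj h5) hzx.ne hcz.ne.symm h1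
      hcy.symm hpy (hzq q (S.symm h5) h2.symm).symm (hcp p h3) (hzq' q (S.symm h5)) h2

lemma Trio.eq_of_outer_side (h : S.Trio x y z a) (hc : S.T z x c) (hcy : c ≠ y)
    (hca : S.T x c a) {s : V} (hs : S.T a c s) : s = x := by
  by_contra hsx
  have hne' := h.ne_outer hG hc
  have hsy : s ≠ y := by
    rintro rfl
    exact h.not_adj hc.rotate.adj.ne.symm hc.rotate.rotate.adj.ne hne' hs.rotate.adj.symm
  have hsz : s ≠ z := by
    rintro rfl
    exact h.not_five hG hc hcy hca.rotate.rotate.swap hs.rotate.rotate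
  exact hG.no_hexagon hs.rotate.rotate.adj.symm hs.rotate.adj.symm hc.rotate.rotate.adj
    h.1.rotate.adj.symm h.1.adj.symm h.2.1.rotate.rotate.adj.symm hs.adj.ne
    h.2.2.rotate.adj.ne.symm h.2.1.rotate.adj.ne.symm hsz hsy hsx hcy hc.rotate.adj.ne.symm
    hc.adj.ne

lemma Trio.not_quad_outer (h : S.Trio x y z a) {F F' : κ} (hF : S.Tri F z x c) (hcy : c ≠ y)
    (hF' : S.B F' x c) (hne : F ≠ F') {p q : V} : ¬ S.Quad F' x c p q := by
  rintro ⟨h1, h2, h3, h4, h5⟩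
  have hc := T_of_tri hF
  have hne' := h.ne_outer hG hc
  have hxy := h.1.adj
  have hyz := h.1.rotate.adj
  have hzx := h.1.rotate.rotate.adj
  have hxc := hc.rotate.adj
  have hcz := hc.rotate.rotate.adj
  have hyc := h.not_adj hxc.ne.symm hcz.ne hne'
  have hpy : y ≠ p := by rintro rfl; exact hyc (S.adj h3).symm
  have hqy : y ≠ q := by
    rintro rfl
    exact h.1.r.not_three h.2.1.r ⟨hcy.symm, F', S.symm h5, hF'⟩ h.2.2.rotate.adj.ne
      hcz.ne.symm hne'.symm
  have hpz : z ≠ p := ne_of_share hG hne hzx.ne.symm (S.symm hF.2.2.1) hF.2.2.2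
    (S.symm hF') h3
  have hqz : z ≠ q := ne_of_share hG hne hcz.ne hF.2.2.1 (S.symm hF.2.1) hF' (S.symm h5)
  exact hG.no_hexagon hxy hyz hcz.symm (S.adj h3) (S.adj h4) (S.adj h5) hzx.ne.symm hxc.ne h1
    hcy.symm hpy hqy hpz hqz h2

end

end FaceSystem

namespace FaceSystem

variable {V : Type*} [Fintype V] {G : SimpleGraph V} {κ : Type*} [Fintype κ]
  {S : FaceSystem G κ}

lemma exists_apex (hG : Reduced G) {F F' : κ} {x y z : V} (hF : S.Tri F x y z) (hne : F' ≠ F)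
    (h : S.B F' x y) (hF' : S.len F' ≤ 3) : ∃ a, S.Tri F' x y a ∧ a ≠ z := by
  obtain ⟨a, ha⟩ := exists_tri hF' h
  refine ⟨a, ha, ?_⟩
  rintro rfl
  exact hne (S.eq_of_share hG hF.2.2.1.ne ha.2.1 (S.symm ha.2.2.2) hF.2.1 (S.symm hF.2.2.2))

lemma len_le_of_T {F F' : κ} {x y z b : V} (hF : S.Tri F x y z) (hne : F' ≠ F)
    (h : S.B F' x y) (hT : S.T x y b) (hb : b ≠ z) : S.len F' ≤ 3 := by
  obtain ⟨F₀, h0⟩ := hT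
  have h1 : F₀ ≠ F := by
    rintro rfl
    rcases hF.2.1.mem_pair (S.symm hF.2.2.2) hF.2.2.1.ne (S.symm h0.2.2.2) with h | h
    · exact h0.2.2.1.ne h.symm
    · exact hb h
  rw [eq_of_ne hF.2.1 h h0.2.1 hne h1]
  exact h0.1

lemma Tri.mem {F : κ} {x y z v w : V} (hF : S.Tri F x y z) (h : S.B F v w) :
    v = x ∨ v = y ∨ v = z := by
  classical
  by_contra! hcon
  have hcard : ({v, x, y, z} : Finset V).card = 4 := by
    have := hF.2.1.ne; have := hF.2.2.1.ne; have := hF.2.2.2.ne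
    simp only [Finset.card_insert_eq_ite, Finset.mem_insert, Finset.mem_singleton,
      Finset.card_singleton]
    grind
  have : ({v, x, y, z} : Finset V).card ≤ S.len F := by
    apply le_len
    intro u hu
    simp only [Finset.mem_insert, Finset.mem_singleton] at hu
    rcases hu with rfl | rfl | rfl | rfl
    exacts [⟨_, h⟩, ⟨_, hF.2.1⟩, ⟨_, hF.2.2.1⟩, ⟨_, hF.2.2.2⟩]
  have := hF.1
  omega

/-- A triangular face all of whose neighbouring faces are triangular. -/
def Full (S : FaceSystem G κ) (F : κ) : Prop :=
  S.len F ≤ 3 ∧ ∀ v w F', F' ≠ F → S.B F v w → S.B F' v w → S.len F' ≤ 3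

lemma Full.exists_T (hG : Reduced G) {F : κ} {x y z : V} (h : S.Full F) (hF : S.Tri F x y z) :
    ∃ d, S.T x y d ∧ d ≠ z := by
  obtain ⟨F', hne, hF'⟩ := S.exists_opp hF.2.1
  obtain ⟨d, hd, hdz⟩ := exists_apex hG hF hne hF' (h.2 _ _ _ hne hF.2.1 hF')
  exact ⟨d, ⟨F', hd⟩, hdz⟩

lemma full_of_tri {F F₁ F₂ F₃ : κ} {x y z : V} (hF : S.Tri F x y z) (h1 : F₁ ≠ F) (h2 : F₂ ≠ F)
    (h3 : F₃ ≠ F) (b1 : S.B F₁ x y) (b2 : S.B F₂ y z) (b3 : S.B F₃ z x) (l1 : S.len F₁ ≤ 3)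
    (l2 : S.len F₂ ≤ 3) (l3 : S.len F₃ ≤ 3) : S.Full F := by
  refine ⟨hF.1, fun v w F' hne hvw hF' => ?_⟩
  have k1 : ∀ {F'}, F' ≠ F → S.B F' x y → S.len F' ≤ 3 := fun hn h => by
    rw [eq_of_ne hF.2.1 h b1 hn h1]; exact l1
  have k2 : ∀ {F'}, F' ≠ F → S.B F' y z → S.len F' ≤ 3 := fun hn h => by
    rw [eq_of_ne hF.2.2.1 h b2 hn h2]; exact l2
  have k3 : ∀ {F'}, F' ≠ F → S.B F' z x → S.len F' ≤ 3 := fun hn h => by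
    rw [eq_of_ne hF.2.2.2 h b3 hn h3]; exact l3
  rcases hF.mem hvw with rfl | rfl | rfl <;> rcases hF.mem (S.symm hvw) with rfl | rfl | rfl
  · exact (hvw.ne rfl).elim
  · exact k1 hne hF'
  · exact k3 hne (S.symm hF')
  · exact k1 hne (S.symm hF')
  · exact (hvw.ne rfl).elim
  · exact k2 hne hF'
  · exact k3 hne hF'
  · exact k2 hne (S.symm hF')
  · exact (hvw.ne rfl).elim

/-- What a non-triangular face with `n` vertices sends across each of its edges. -/
def quota (n : ℕ) : ℤ := if n ≤ 4 then 2 else if n ≤ 5 then 3 else 5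

lemma two_le_quota (n : ℕ) : 2 ≤ quota n := by unfold quota; split_ifs <;> norm_num

lemma three_le_quota {n : ℕ} (h : 5 ≤ n) : 3 ≤ quota n := by
  unfold quota; split_ifs <;> omega

lemma quota_eq_five {n : ℕ} (h : 6 ≤ n) : quota n = 5 := by
  unfold quota; split_ifs <;> omega

lemma B.three_le_quota {F : κ} {x z : V} (h : S.B F x z) (hF : 4 ≤ S.len F)
    (hq : ∀ p q, ¬ S.Quad F x z p q) : 3 ≤ quota (S.len F) := by
  rcases h.cases_of_four_le hF with h | h | ⟨p, q, h⟩
  · exact FaceSystem.three_le_quota (by omega)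
  · exact FaceSystem.three_le_quota h.1
  · exact (hq p q h).elim

open Classical in
/-- The charge sent from `F` to `F'` across the edge `vw`. -/
noncomputable def give (S : FaceSystem G κ) (F F' : κ) (v w : V) : ℤ :=
  if S.len F' ≤ 3 then
    if 4 ≤ S.len F then quota (S.len F)
    else if S.Full F' then if G.DegLeThree v ∨ G.DegLeThree w then 1 else 2 else 0
  else 0

/-- The net charge received by `F` from `F'` across the edge `vw`. -/
noncomputable def net (S : FaceSystem G κ) (F F' : κ) (v w : V) : ℤ :=
  S.give F' F v w - S.give F F' v w

lemma net_comm (F F' : κ) (v w : V) : S.net F F' v w = S.net F F' w v := by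
  unfold net give
  split_ifs <;> first | rfl | tauto

lemma net_of_four_le {F F' : κ} {v w : V} (hF : S.len F ≤ 3) (hF' : 4 ≤ S.len F') :
    S.net F F' v w = quota (S.len F') := by
  simp [net, give, hF, hF', Nat.not_le.2 hF']

lemma net_of_full_of_deg {F F' : κ} {v w : V} (hF : S.Full F) (hF' : S.len F' ≤ 3)
    (hn : ¬ S.Full F') (h : G.DegLeThree v ∨ G.DegLeThree w) : S.net F F' v w = 1 := by
  simp [net, give, hF.1, hF, hF', hn, h, Nat.not_le.2 (Nat.lt_succ_of_le hF'),
    Nat.not_le.2 (Nat.lt_succ_of_le hF.1)]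

lemma net_of_full_of_not_deg {F F' : κ} {v w : V} (hF : S.Full F) (hF' : S.len F' ≤ 3)
    (hn : ¬ S.Full F') (h : ¬ G.DegLeThree v) (h' : ¬ G.DegLeThree w) : S.net F F' v w = 2 := by
  simp [net, give, hF.1, hF, hF', hn, h, h', Nat.not_le.2 (Nat.lt_succ_of_le hF'),
    Nat.not_le.2 (Nat.lt_succ_of_le hF.1)]

lemma net_of_full_full {F F' : κ} {v w : V} (hF : S.Full F) (hF' : S.Full F') :
    S.net F F' v w = 0 := by
  simp [net, give, hF.1, hF, hF', hF'.1, Nat.not_le.2 (Nat.lt_succ_of_le hF'.1),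
    Nat.not_le.2 (Nat.lt_succ_of_le hF.1)]

lemma net_of_not_full {F F' : κ} {v w : V} (hF : S.len F ≤ 3) (hF' : S.len F' ≤ 3)
    (hn : ¬ S.Full F) (hn' : ¬ S.Full F') : S.net F F' v w = 0 := by
  simp [net, give, hF, hn, hF', hn', Nat.not_le.2 (Nat.lt_succ_of_le hF'),
    Nat.not_le.2 (Nat.lt_succ_of_le hF)]

lemma net_ge_neg_two {F F' : κ} {v w : V} (hF : S.len F ≤ 3) (hF' : S.len F' ≤ 3) :
    -2 ≤ S.net F F' v w := by
  simp only [net, give, hF, hF', Nat.not_le.2 (Nat.lt_succ_of_le hF'),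
    Nat.not_le.2 (Nat.lt_succ_of_le hF), if_true, if_false]
  split_ifs <;> norm_num

lemma net_ge_neg_one {F F' : κ} {v w : V} (hF : S.len F ≤ 3) (hF' : S.len F' ≤ 3)
    (h : G.DegLeThree v ∨ G.DegLeThree w) : -1 ≤ S.net F F' v w := by
  simp only [net, give, hF, hF', Nat.not_le.2 (Nat.lt_succ_of_le hF'), h,
    Nat.not_le.2 (Nat.lt_succ_of_le hF), if_true, if_false]
  split_ifs <;> norm_num

section

variable (hG : Reduced G) {F F₁ F₂ F₃ : κ} {x y z : V}
include hG

lemma net_sum_of_full_center {a c : V} (hfull : S.Full F) (hF : S.Tri F x y z)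
    (hF₁ : S.Tri F₁ x y a) (hF₂ : S.Tri F₂ y z a) (hF₃ : S.Tri F₃ z x c) (hc : c ≠ y) :
    3 ≤ S.net F F₁ x y + S.net F F₂ y z + S.net F F₃ z x := by
  have trio : S.Trio x y z a := ⟨⟨F, hF⟩, ⟨F₁, hF₁⟩, ⟨F₂, hF₂⟩⟩
  have hT := T_of_tri hF₃
  have hd := trio.degLeThree
  have hx : ¬ G.DegLeThree x := fun h => hG.no_adj_deg_three trio.1.adj h hd
  have hz : ¬ G.DegLeThree z := fun h => hG.no_adj_deg_three trio.1.rotate.adj hd h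
  have hca := trio.ne_outer hG hT
  have h3 : ¬ S.Full F₃ := by
    intro h
    obtain ⟨d, hd, hdz⟩ := h.exists_T hG hF₃.rotate
    obtain ⟨d', hd', hdx⟩ := h.exists_T hG hF₃.swap.rotate
    have h1 := trio.eq_of_outer hG hT hc hd hdz
    have h2 := trio.symm.eq_of_outer hG hT.swap hc hd' hdx
    subst h1 h2
    exact trio.not_five hG hT hc hd.rotate.rotate.swap hd'.rotate.rotate.swap
  have h12 : ¬ (S.Full F₁ ∧ S.Full F₂) := by
    rintro ⟨h1, h2⟩
    obtain ⟨d, hd, hdy⟩ := h1.exists_T hG hF₁.swap.rotate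
    obtain ⟨d', hd', hdy'⟩ := h2.exists_T hG hF₂.rotate
    have e1 := trio.eq_of_side hG hT hc hd hdy
    have e2 := trio.symm.eq_of_side hG hT.swap hc hd' hdy'
    subst e1 e2
    exact trio.not_five hG hT hc hd hd'
  have e3 := net_of_full_of_not_deg hfull hF₃.1 h3 hz hx
  by_cases h1 : S.Full F₁
  · have h2 : ¬ S.Full F₂ := fun h => h12 ⟨h1, h⟩
    have e2 := net_of_full_of_deg (v := y) (w := z) hfull hF₂.1 h2 (Or.inl hd)
    rw [e2, e3, net_of_full_full hfull h1]
    norm_num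
  · have e1 := net_of_full_of_deg (v := x) (w := y) hfull hF₁.1 h1 (Or.inr hd)
    by_cases h2 : S.Full F₂
    · rw [e1, e3, net_of_full_full hfull h2]
      norm_num
    · have e2 := net_of_full_of_deg (v := y) (w := z) hfull hF₂.1 h2 (Or.inl hd)
      rw [e1, e2, e3]
      norm_num

variable (hF : S.Tri F x y z) (n1 : F₁ ≠ F) (n2 : F₂ ≠ F) (n3 : F₃ ≠ F)
  (b1 : S.B F₁ x y) (b2 : S.B F₂ y z) (b3 : S.B F₃ z x)
include hF n1 n2 n3 b1 b2 b3

lemma net_sum_of_full (hfull : S.Full F) :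
    3 ≤ S.net F F₁ x y + S.net F F₂ y z + S.net F F₃ z x := by
  obtain ⟨a, ha, haz⟩ := exists_apex hG hF n1 b1 (hfull.2 _ _ _ n1 hF.2.1 b1)
  obtain ⟨b, hb, hbx⟩ := exists_apex hG hF.rotate n2 b2 (hfull.2 _ _ _ n2 hF.2.2.1 b2)
  obtain ⟨c, hc, hcy⟩ := exists_apex hG hF.rotate.rotate n3 b3 (hfull.2 _ _ _ n3 hF.2.2.2 b3)
  rcases apexes_not_distinct hG (T_of_tri ha) (T_of_tri hb) (T_of_tri hc) haz hbx hcy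
    with rfl | rfl | rfl
  · exact net_sum_of_full_center hG hfull hF ha hb hc hcy
  · have := net_sum_of_full_center hG hfull hF.rotate hb hc ha haz
    linarith
  · have := net_sum_of_full_center hG hfull hF.rotate.rotate hc ha hb hbx
    linarith

omit n1 n2 b1 b2 in
/-- A full face next to a non-full triangular face, where the two other faces around one end of the
common edge are not triangular, has its centre opposite to the common edge. -/
lemma exists_trio_of_full {a : V} (hF₁ : S.Tri F₁ x y a) (haz : a ≠ z) (hfull : S.Full F₁)
    (l3 : 4 ≤ S.len F₃) (h2 : ¬ S.T y z a) : ∃ t, S.Trio y a x t ∧ S.T x y z := by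
  obtain ⟨d, hd, hdx⟩ := hfull.exists_T hG hF₁.rotate
  obtain ⟨e, he, hey⟩ := hfull.exists_T hG hF₁.rotate.rotate
  have hT := T_of_tri hF
  rcases apexes_not_distinct hG hT hd he haz.symm hdx hey with rfl | rfl | rfl
  · exact (h2 hd.rotate.rotate.swap).elim
  · exact ⟨d, ⟨⟨F₁, hF₁.rotate⟩, hd, he⟩, hT⟩
  · have := len_le_of_T hF.rotate.rotate n3 b3 he.rotate.swap hF₁.2.2.1.ne.symm
    omega

omit n1 n2 b1 b2 in
lemma six_le_of_full {a b : V} (l3 : 4 ≤ S.len F₃) (ha : S.Tri F₁ x y a) (hb : S.Tri F₂ y z b)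
    (haz : a ≠ z) (hbx : b ≠ x) (hab : a ≠ b) (hfull : S.Full F₁) :
    6 ≤ S.len F₃ ∧ ¬ S.Full F₂ := by
  have hT' := T_of_tri hF
  obtain ⟨t, trio, hT⟩ := exists_trio_of_full hG hF n3 b3 ha haz hfull l3 fun h =>
    hT'.rotate.r.not_three (T_of_tri hb).r h.r (Ne.symm hbx) ha.2.2.2.ne.symm (Ne.symm hab)
  have hbt := trio.eq_of_outer hG hT haz.symm (T_of_tri hb) hbx
  subst hbt
  refine ⟨trio.six_le_outer hG hF haz.symm (T_of_tri hb) (S.symm b3) n3.symm l3, fun h2 => ?_⟩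
  obtain ⟨d, hd, hdy⟩ := h2.exists_T hG hb.rotate
  exact hdy (trio.eq_of_outer_side hG hT haz.symm (T_of_tri hb) hd.swap)

lemma net_sum_of_two (hn : ¬ S.Full F) (l1 : S.len F₁ ≤ 3) (l2 : S.len F₂ ≤ 3)
    (l3 : 4 ≤ S.len F₃) : 3 ≤ S.net F F₁ x y + S.net F F₂ y z + S.net F F₃ z x := by
  obtain ⟨a, ha, haz⟩ := exists_apex hG hF n1 b1 l1
  obtain ⟨b, hb, hbx⟩ := exists_apex hG hF.rotate n2 b2 l2
  rw [net_of_four_le hF.1 l3]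
  by_cases hab : a = b
  · subst hab
    have trio : S.Trio x y z a := ⟨⟨F, hF⟩, ⟨F₁, ha⟩, ⟨F₂, hb⟩⟩
    have h1 := net_ge_neg_one (v := x) (w := y) hF.1 l1 (Or.inr trio.degLeThree)
    have h2 := net_ge_neg_one (v := y) (w := z) hF.1 l2 (Or.inl trio.degLeThree)
    rw [quota_eq_five (trio.six_le hG hF (S.symm b3) n3.symm l3)]
    linarith
  · have key1 := fun h => six_le_of_full hG hF n3 b3 l3 ha hb haz hbx hab h
    have key2 := fun h => six_le_of_full hG hF.rotate.swap n3 (S.symm b3) l3 hb.swap ha.swap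
      hbx haz (Ne.symm hab) h
    by_cases h1 : S.Full F₁
    · have h2 := net_ge_neg_two (v := x) (w := y) hF.1 l1
      rw [quota_eq_five (key1 h1).1, net_of_not_full hF.1 l2 hn (key1 h1).2]
      linarith
    · by_cases h2 : S.Full F₂
      · have h2' := net_ge_neg_two (v := y) (w := z) hF.1 l2
        rw [quota_eq_five (key2 h2).1, net_of_not_full hF.1 l1 hn h1]
        linarith
      · rw [net_of_not_full hF.1 l1 hn h1, net_of_not_full hF.1 l2 hn h2]
        have := (S.symm b3).three_le_quota l3 fun p q => not_quad_of_two hG hF (T_of_tri ha)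
          (T_of_tri hb) haz hbx hab (S.symm b3) n3.symm
        linarith

lemma net_sum_of_one (hn : ¬ S.Full F) (l1 : S.len F₁ ≤ 3) (l2 : 4 ≤ S.len F₂)
    (l3 : 4 ≤ S.len F₃) : 3 ≤ S.net F F₁ x y + S.net F F₂ y z + S.net F F₃ z x := by
  obtain ⟨a, ha, haz⟩ := exists_apex hG hF n1 b1 l1
  rw [net_of_four_le hF.1 l2, net_of_four_le hF.1 l3]
  have q2 := two_le_quota (S.len F₂)
  have q3 := two_le_quota (S.len F₃)
  by_cases hfull : S.Full F₁
  · obtain ⟨t, trio, hT⟩ := exists_trio_of_full hG hF n3 b3 ha haz hfull l3 fun h => by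
      have := len_le_of_T hF.rotate n2 b2 h ha.2.2.2.ne
      omega
    have h1 := net_ge_neg_two (v := x) (w := y) hF.1 l1
    have := b2.three_le_quota l2 fun p q => trio.not_quad_outer hG hF haz.symm b2 n2.symm
    linarith
  · rw [net_of_not_full hF.1 l1 hn hfull]
    linarith

lemma three_le_net_sum : 3 ≤ S.net F F₁ x y + S.net F F₂ y z + S.net F F₃ z x := by
  by_cases hfull : S.Full F
  · exact net_sum_of_full hG hF n1 n2 n3 b1 b2 b3 hfull
  have r1 := hF.rotate
  have r2 := r1.rotate
  rcases le_or_gt (S.len F₁) 3 with l1 | l1 <;> rcases le_or_gt (S.len F₂) 3 with l2 | l2 <;>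
    rcases le_or_gt (S.len F₃) 3 with l3 | l3
  · exact (hfull (full_of_tri hF n1 n2 n3 b1 b2 b3 l1 l2 l3)).elim
  · exact net_sum_of_two hG hF n1 n2 n3 b1 b2 b3 hfull l1 l2 l3
  · have := net_sum_of_two hG r2 n3 n1 n2 b3 b1 b2 hfull l3 l1 l2
    linarith
  · exact net_sum_of_one hG hF n1 n2 n3 b1 b2 b3 hfull l1 l2 l3
  · have := net_sum_of_two hG r1 n2 n3 n1 b2 b3 b1 hfull l2 l3 l1
    linarith
  · have := net_sum_of_one hG r1 n2 n3 n1 b2 b3 b1 hfull l2 l3 l1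
    linarith
  · have := net_sum_of_one hG r2 n3 n1 n2 b3 b1 b2 hfull l3 l1 l2
    linarith
  · rw [net_of_four_le hF.1 l1, net_of_four_le hF.1 l2, net_of_four_le hF.1 l3]
    have := two_le_quota (S.len F₁)
    have := two_le_quota (S.len F₂)
    have := two_le_quota (S.len F₃)
    linarith

end

end FaceSystem

open Classical in
lemma SimpleGraph.card_adj_pairs {V : Type*} [Fintype V] (G : SimpleGraph V) :
    (Finset.univ.filter fun p : V × V => G.Adj p.1 p.2).card = 2 * G.edgeSet.ncard := by
  rw [Set.ncard_eq_toFinset_card', ← SimpleGraph.edgeFinset, ← G.sum_degrees_eq_twice_card_edges,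
    Finset.card_filter, Fintype.sum_prod_type]
  refine Finset.sum_congr rfl fun v _ => ?_
  rw [← Finset.card_filter, ← G.card_neighborFinset_eq_degree, G.neighborFinset_eq_filter]

namespace FaceSystem

variable {V : Type*} [Fintype V] {G : SimpleGraph V} {κ : Type*} [Fintype κ]
  (S : FaceSystem G κ)

open Classical in
/-- The darts on the boundary of `F`. -/
noncomputable def darts (F : κ) : Finset (V × V) := Finset.univ.filter fun p => S.B F p.1 p.2

variable {S}

lemma mem_darts {F : κ} {p : V × V} : p ∈ S.darts F ↔ S.B F p.1 p.2 := by simp [darts]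

lemma card_darts (F : κ) : (S.darts F).card = 2 * S.len F := by
  classical
  rw [darts, Finset.card_filter, Fintype.sum_prod_type, len, Finset.card_filter, Finset.mul_sum]
  refine Finset.sum_congr rfl fun v _ => ?_
  rw [← Finset.card_filter]
  split_ifs with h
  · obtain ⟨w, h⟩ := h
    obtain ⟨w', hne, hw'⟩ := S.two_edges h
    rw [mul_one, Finset.card_eq_two]
    exact ⟨w, w', hne.symm, by ext; simp [hw']⟩
  · rw [mul_zero, Finset.card_eq_zero, Finset.filter_eq_empty_iff]
    exact fun w _ hw => h ⟨w, hw⟩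

lemma sum_sum_darts (f : κ → V × V → ℤ) (g : V × V → ℤ)
    (h : ∀ F F' v w, F ≠ F' → S.B F v w → S.B F' v w → f F (v, w) + f F' (v, w) = g (v, w)) :
    open Classical in ∑ F, ∑ p ∈ S.darts F, f F p = ∑ p with G.Adj p.1 p.2, g p := by
  classical
  simp only [darts, Finset.sum_filter]
  rw [Finset.sum_comm]
  refine Finset.sum_congr rfl fun p _ => ?_
  obtain ⟨v, w⟩ := p
  split_ifs with hvw
  · obtain ⟨F, F', hne, hF⟩ := S.two_faces hvw
    rw [← Finset.sum_filter]
    have : (Finset.univ.filter fun A => S.B A v w) = {F, F'} := by ext; simp [hF]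
    rw [this, Finset.sum_pair hne]
    exact h F F' v w hne ((hF _).2 (Or.inl rfl)) ((hF _).2 (Or.inr rfl))
  · exact Finset.sum_eq_zero fun F _ => if_neg fun h => hvw (S.adj h)

lemma Tri.sum_darts {F : κ} {x y z : V} (h : S.Tri F x y z) (f : V × V → ℤ) :
    ∑ p ∈ S.darts F, f p =
      f (x, y) + f (y, x) + f (y, z) + f (z, y) + f (z, x) + f (x, z) := by
  classical
  have h1 := h.2.1.ne
  have h2 := h.2.2.1.ne
  have h3 := h.2.2.2.ne
  have hs : ({(x, y), (y, x), (y, z), (z, y), (z, x), (x, z)} : Finset (V × V)) = S.darts F := by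
    apply Finset.eq_of_subset_of_card_le
    · intro p hp
      rw [mem_darts]
      simp only [Finset.mem_insert, Finset.mem_singleton] at hp
      rcases hp with rfl | rfl | rfl | rfl | rfl | rfl
      exacts [h.2.1, S.symm h.2.1, h.2.2.1, S.symm h.2.2.1, h.2.2.2, S.symm h.2.2.2]
    · rw [card_darts]
      have : 2 * S.len F ≤ 6 := by have := h.1; omega
      refine this.trans (le_of_eq ?_)
      simp [h1, h2, h3, h1.symm, h2.symm, h3.symm]
  rw [← hs]
  rw [Finset.sum_insert, Finset.sum_insert, Finset.sum_insert, Finset.sum_insert,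
    Finset.sum_insert, Finset.sum_singleton]
  · ring
  all_goals simp [h1, h2, h3, h1.symm, h2.symm, h3.symm]

/-- The number of edges of a reduced plane graph. -/
theorem edge_bound (S : FaceSystem G κ) (hG : Reduced G) :
    7 * G.edgeSet.ncard + 36 ≤ 18 * Fintype.card V := by
  classical
  obtain ⟨opp, hopp⟩ : ∃ opp : κ → V → V → κ, ∀ F v w, S.B F v w →
      opp F v w ≠ F ∧ S.B (opp F v w) v w := by
    choose! opp h using fun F v w (h : S.B F v w) => S.exists_opp h
    exact ⟨opp, h⟩
  have h0 := sum_sum_darts (S := S) (fun F p => 11 + S.net F (opp F p.1 p.2) p.1 p.2)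
    (fun _ => 22) (by
      intro F F' v w hne h h'
      have e1 : opp F v w = F' := eq_of_ne h (hopp F v w h).2 h' (hopp F v w h).1 hne.symm
      have e2 : opp F' v w = F := eq_of_ne h' (hopp F' v w h').2 h (hopp F' v w h').1 hne
      simp only [e1, e2, net]
      ring)
  have h1 : ∀ F, 72 ≤ ∑ p ∈ S.darts F, (11 + S.net F (opp F p.1 p.2) p.1 p.2) := by
    intro F
    rcases le_or_gt (S.len F) 3 with hF | hF
    · obtain ⟨x, y, hxy⟩ := S.nonempty F
      obtain ⟨z, hz⟩ := exists_tri hF hxy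
      have oc : ∀ v w, S.B F v w → opp F w v = opp F v w := fun v w h =>
        eq_of_ne h (S.symm (hopp F w v (S.symm h)).2) (hopp F v w h).2
          (hopp F w v (S.symm h)).1 (hopp F v w h).1
      have o1 := hopp _ _ _ hz.2.1
      have o2 := hopp _ _ _ hz.2.2.1
      have o3 := hopp _ _ _ hz.2.2.2
      have := three_le_net_sum hG hz o1.1 o2.1 o3.1 o1.2 o2.2 o3.2
      rw [hz.sum_darts]
      simp only
      rw [oc _ _ hz.2.1, oc _ _ hz.2.2.1, oc _ _ hz.2.2.2, net_comm _ _ y x, net_comm _ _ z y,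
        net_comm _ _ x z]
      linarith
    · have h2 : ∀ p ∈ S.darts F, 11 - quota (S.len F) ≤
          11 + S.net F (opp F p.1 p.2) p.1 p.2 := by
        intro p _
        have := two_le_quota (S.len F)
        have h4 : 4 ≤ S.len F := hF
        simp only [net, give, h4, Nat.not_le.2 hF, if_true, if_false]
        split_ifs <;> linarith
      have h3 := Finset.card_nsmul_le_sum _ _ _ h2
      rw [card_darts, nsmul_eq_mul] at h3
      refine le_trans ?_ h3
      push_cast
      have h4 : (4 : ℤ) ≤ S.len F := by exact_mod_cast hF
      unfold quota
      split_ifs with a b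
      · linarith
      · have : (5 : ℤ) ≤ S.len F := by exact_mod_cast (not_le.1 a)
        linarith
      · have : (6 : ℤ) ≤ S.len F := by exact_mod_cast (not_le.1 b)
        linarith
  have h2 := Finset.card_nsmul_le_sum Finset.univ _ _ fun F _ => h1 F
  rw [h0, Finset.sum_const, card_adj_pairs, Finset.card_univ, nsmul_eq_mul, nsmul_eq_mul] at h2
  have h3 := S.euler
  have h4 : Fintype.card κ * 72 ≤ 2 * G.edgeSet.ncard * 22 := by exact_mod_cast h2
  omega

/-- The number of edges of a plane graph without cut vertices. -/
theorem edge_bound_of_planar (S : FaceSystem G κ) :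
    G.edgeSet.ncard + 6 ≤ 3 * Fintype.card V := by
  classical
  have h0 := sum_sum_darts (S := S) (fun _ _ => 1) (fun _ => 2) (fun _ _ _ _ _ _ _ => rfl)
  have h2 := Finset.card_nsmul_le_sum Finset.univ
    (fun F => ∑ p ∈ S.darts F, (1 : ℤ)) 6 fun F _ => by
      rw [Finset.sum_const, card_darts]
      have : (3 : ℤ) ≤ S.len F := by exact_mod_cast three_le_len F
      simp
      linarith
  rw [h0, Finset.sum_const, card_adj_pairs, Finset.card_univ, nsmul_eq_mul, nsmul_eq_mul] at h2
  have h3 := S.euler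
  have h4 : Fintype.card κ * 6 ≤ 2 * G.edgeSet.ncard * 2 := by exact_mod_cast h2
  omega

end FaceSystem

universe u in
theorem SimpleGraph.HasPlanarEmbedding.exists_faceSystem {V : Type u} [Fintype V]
    {G : SimpleGraph V} (h : G.HasPlanarEmbedding) (hG : NoCutVertex G)
    (hdeg : ∀ v w, G.Adj v w → ∃ w', w' ≠ w ∧ G.Adj v w') {a b : V} (hab : G.Adj a b) :
    ∃ (κ : Type u) (_ : Fintype κ), Nonempty (FaceSystem G κ) := by
  obtain ⟨D⟩ := nonempty_straightDrawing h
  obtain ⟨D⟩ := D.nonempty_faceFunctionals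
  exact D.exists_faceSystem hG hdeg hab

namespace SimpleGraph

variable {V : Type*} (G : SimpleGraph V)

open Classical in
/-- The indicator of adjacency. -/
noncomputable def ind (a b : V) : ℕ := if G.Adj a b then 1 else 0

/-- The number of edges from `v` to `W`. -/
noncomputable def degIn (v : V) (W : Finset V) : ℕ := ∑ b ∈ W, G.ind v b

/-- The number of darts spanned by `W`. -/
noncomputable def dartsIn (W : Finset V) : ℕ := ∑ a ∈ W, G.degIn a W

variable {G}

lemma ind_le (a b : V) : G.ind a b ≤ 1 := by unfold ind; split_ifs <;> omega

lemma ind_comm (a b : V) : G.ind a b = G.ind b a := by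
  unfold ind
  classical
  exact if_congr (G.adj_comm a b) rfl rfl

lemma ind_self (a : V) : G.ind a a = 0 := by simp [ind]

lemma ind_eq_zero {a b : V} (h : ¬ G.Adj a b) : G.ind a b = 0 := if_neg h

lemma ind_pos {a b : V} (h : G.ind a b ≠ 0) : G.Adj a b := by
  by_contra h'
  exact h (ind_eq_zero h')

lemma degIn_eq_card (v : V) (W : Finset V) :
    open Classical in G.degIn v W = (W.filter fun w => G.Adj v w).card := by
  classical
  simp [degIn, ind]

lemma degIn_le {v : V} {W s : Finset V} (h : ∀ w ∈ W, G.Adj v w → w ∈ s) :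
    G.degIn v W ≤ s.card := by
  rw [degIn_eq_card]
  apply Finset.card_le_card
  intro w
  simp only [Finset.mem_filter]
  exact fun hw => h w hw.1 hw.2

variable (G) in
/-- `G` has no cycle of length six. -/
def NoHexagon : Prop := ∀ {a b c d e f}, G.Adj a b → G.Adj b c → G.Adj c d → G.Adj d e →
  G.Adj e f → G.Adj f a → a ≠ c → a ≠ d → a ≠ e → b ≠ d → b ≠ e → b ≠ f → c ≠ e → c ≠ f →
  d ≠ f → False

/-- An edge `uv` cannot close a path with three edges from a neighbour of `u` to a neighbour
of `v`. -/
lemma NoHexagon.ind_add_le (hH : G.NoHexagon) {u v a b : V} (huv : G.Adj u v)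
    (hua : G.Adj u a) (hvb : G.Adj v b) (ub : u ≠ b) (va : v ≠ a) (ab : a ≠ b) {x y : V}
    (ay : a ≠ y) (bx : b ≠ x) (ux : u ≠ x) (uy : u ≠ y) (vx : v ≠ x) (vy : v ≠ y) :
    G.ind a x + G.ind x y + G.ind b y ≤ 2 := by
  have := G.ind_le a x; have := G.ind_le x y; have := G.ind_le b y
  by_contra hlt
  exact hH hua (ind_pos (a := a) (b := x) (by omega)) (ind_pos (a := x) (b := y) (by omega))
    (ind_pos (a := b) (b := y) (by omega)).symm hvb.symm huv.symm ux uy ub ay ab va.symm bx.symm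
    vx.symm vy.symm

variable [DecidableEq V]

lemma degIn_insert {a v : V} {W : Finset V} (h : a ∉ W) :
    G.degIn v (insert a W) = G.ind v a + G.degIn v W := Finset.sum_insert h

lemma dartsIn_insert {v : V} {W : Finset V} (h : v ∉ W) :
    G.dartsIn (insert v W) = G.dartsIn W + 2 * G.degIn v W := by
  have h1 : ∑ a ∈ W, G.ind a v = G.degIn v W := Finset.sum_congr rfl fun _ _ => ind_comm _ _
  rw [dartsIn, Finset.sum_insert h, degIn_insert h, ind_self,
    Finset.sum_congr rfl fun a _ => degIn_insert h, Finset.sum_add_distrib, h1, ← dartsIn]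
  ring

lemma degIn_union {v : V} {A B : Finset V} (h : Disjoint A B) :
    G.degIn v (A ∪ B) = G.degIn v A + G.degIn v B := Finset.sum_union h

lemma dartsIn_union {A B : Finset V} (h : Disjoint A B)
    (hAB : ∀ a ∈ A, ∀ b ∈ B, ¬ G.Adj a b) :
    G.dartsIn (A ∪ B) = G.dartsIn A + G.dartsIn B := by
  have h1 : ∀ a ∈ A, G.degIn a (A ∪ B) = G.degIn a A := fun a ha => by
    rw [degIn_union h, Nat.add_eq_left]
    exact Finset.sum_eq_zero fun b hb => ind_eq_zero (hAB a ha b hb)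
  have h2 : ∀ b ∈ B, G.degIn b (A ∪ B) = G.degIn b B := fun b hb => by
    rw [degIn_union h, Nat.add_eq_right]
    exact Finset.sum_eq_zero fun a ha => ind_eq_zero fun hab => hAB a ha b hb hab.symm
  rw [dartsIn, Finset.sum_union h, Finset.sum_congr rfl h1, Finset.sum_congr rfl h2]
  rfl

/-- Gluing at a cut vertex. -/
lemma dartsIn_insert_union {v : V} {A B : Finset V} (hA : v ∉ A) (hB : v ∉ B)
    (h : Disjoint A B) (hAB : ∀ a ∈ A, ∀ b ∈ B, ¬ G.Adj a b) :
    G.dartsIn (insert v (A ∪ B)) = G.dartsIn (insert v A) + G.dartsIn (insert v B) := by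
  rw [dartsIn_insert (by simp [hA, hB]), dartsIn_insert hA, dartsIn_insert hB,
    dartsIn_union h hAB, degIn_union h]
  ring

lemma dartsIn_two {a b : V} (h : a ≠ b) : G.dartsIn {a, b} = 2 * G.ind a b := by
  rw [dartsIn_insert (by simpa using h)]
  simp [dartsIn, degIn, ind_self]

lemma dartsIn_three {a b c : V} (ab : a ≠ b) (ac : a ≠ c) (bc : b ≠ c) :
    G.dartsIn {a, b, c} = 2 * (G.ind a b + G.ind a c + G.ind b c) := by
  rw [dartsIn_insert (by simp [ab, ac]), dartsIn_two bc, degIn_insert (by simpa using bc)]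
  simp only [degIn, Finset.sum_singleton]
  ring

lemma dartsIn_four {a b c d : V} (ab : a ≠ b) (ac : a ≠ c) (ad : a ≠ d) (bc : b ≠ c)
    (bd : b ≠ d) (cd : c ≠ d) : G.dartsIn {a, b, c, d} =
      2 * (G.ind a b + G.ind a c + G.ind a d + G.ind b c + G.ind b d + G.ind c d) := by
  rw [dartsIn_insert (by simp [ab, ac, ad]), dartsIn_three bc bd cd,
    degIn_insert (by simp [bc, bd]), degIn_insert (by simpa using cd)]
  simp only [degIn, Finset.sum_singleton]
  ring

lemma dartsIn_five {a b c d e : V} (ab : a ≠ b) (ac : a ≠ c) (ad : a ≠ d) (ae : a ≠ e)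
    (bc : b ≠ c) (bd : b ≠ d) (be : b ≠ e) (cd : c ≠ d) (ce : c ≠ e) (de : d ≠ e) :
    G.dartsIn {a, b, c, d, e} = 2 * (G.ind a b + G.ind a c + G.ind a d + G.ind a e +
      G.ind b c + G.ind b d + G.ind b e + G.ind c d + G.ind c e + G.ind d e) := by
  rw [dartsIn_insert (by simp [ab, ac, ad, ae]), dartsIn_four bc bd be cd ce de,
    degIn_insert (by simp [bc, bd, be]), degIn_insert (by simp [cd, ce]),
    degIn_insert (by simpa using de)]
  simp only [degIn, Finset.sum_singleton]
  ring

variable (G) in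
/-- `G` has no complete subgraph on five vertices. -/
def NoFiveClique : Prop := ∀ {a b c d e}, G.Adj a b → G.Adj a c → G.Adj a d → G.Adj a e →
  G.Adj b c → G.Adj b d → G.Adj b e → G.Adj c d → G.Adj c e → G.Adj d e → False

/-- The bound for small vertex sets. -/
lemma dartsIn_le_of_card_le_five (hK : G.NoFiveClique) {W : Finset V} (h2 : 2 ≤ W.card)
    (h5 : W.card ≤ 5) : 7 * G.dartsIn W + 54 ≤ 36 * W.card := by
  have i := G.ind_le
  obtain h | h | h | h : W.card = 2 ∨ W.card = 3 ∨ W.card = 4 ∨ W.card = 5 := by omega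
  · obtain ⟨a, b, ab, rfl⟩ := Finset.card_eq_two.1 h
    rw [h, dartsIn_two ab]
    have := i a b
    omega
  · obtain ⟨a, b, c, ab, ac, bc, rfl⟩ := Finset.card_eq_three.1 h
    rw [h, dartsIn_three ab ac bc]
    have := i a b; have := i a c; have := i b c
    omega
  · obtain ⟨a, s, ha, rfl, hs⟩ := Finset.card_eq_succ.1 h
    obtain ⟨b, c, d, bc, bd, cd, rfl⟩ := Finset.card_eq_three.1 hs
    simp only [Finset.mem_insert, Finset.mem_singleton, not_or] at ha
    rw [h, dartsIn_four ha.1 ha.2.1 ha.2.2 bc bd cd]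
    have := i a b; have := i a c; have := i a d; have := i b c; have := i b d; have := i c d
    omega
  · obtain ⟨a, s, ha, rfl, hs⟩ := Finset.card_eq_succ.1 h
    obtain ⟨b, t, hb, rfl, ht⟩ := Finset.card_eq_succ.1 hs
    obtain ⟨c, d, e, cd, ce, de, rfl⟩ := Finset.card_eq_three.1 ht
    simp only [Finset.mem_insert, Finset.mem_singleton, not_or] at ha hb
    rw [h, dartsIn_five ha.1 ha.2.1 ha.2.2.1 ha.2.2.2 hb.1 hb.2.1 hb.2.2 cd ce de]
    have := i a b; have := i a c; have := i a d; have := i a e; have := i b c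
    have := i b d; have := i b e; have := i c d; have := i c e; have := i d e
    by_contra hlt
    exact hK (ind_pos (a := a) (b := b) (by omega)) (ind_pos (a := a) (b := c) (by omega))
      (ind_pos (a := a) (b := d) (by omega)) (ind_pos (a := a) (b := e) (by omega))
      (ind_pos (a := b) (b := c) (by omega)) (ind_pos (a := b) (b := d) (by omega))
      (ind_pos (a := b) (b := e) (by omega)) (ind_pos (a := c) (b := d) (by omega))
      (ind_pos (a := c) (b := e) (by omega)) (ind_pos (a := d) (b := e) (by omega))

/-- If `v` has neighbours `a` and `b`, then no Hamiltonian path from `a` to `b` exists in a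
set of five vertices avoiding `v`. -/
lemma NoHexagon.dartsIn_five_le (hH : G.NoHexagon) {v a b : V} {W : Finset V}
    (hW : W.card = 5) (hv : v ∉ W) (ha : a ∈ W) (hb : b ∈ W) (ab : a ≠ b) (hva : G.Adj v a)
    (hvb : G.Adj v b) : G.dartsIn W ≤ 16 := by
  have hc : ((W.erase a).erase b).card = 3 := by
    rw [Finset.card_erase_of_mem (Finset.mem_erase.2 ⟨ab.symm, hb⟩), Finset.card_erase_of_mem ha,
      hW]
  obtain ⟨p, q, r, pq, pr, qr, hs⟩ := Finset.card_eq_three.1 hc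
  have hW' : W = {a, b, p, q, r} := by
    rw [← hs, Finset.insert_erase (Finset.mem_erase.2 ⟨ab.symm, hb⟩), Finset.insert_erase ha]
  have hn : a ∉ ({p, q, r} : Finset V) ∧ b ∉ ({p, q, r} : Finset V) := by simp [← hs]
  subst hW'
  simp only [Finset.mem_insert, Finset.mem_singleton, not_or] at hn hv
  obtain ⟨⟨ap, aq, ar⟩, bp, bq, br⟩ := hn
  obtain ⟨-, -, vp, vq, vr⟩ := hv
  rw [dartsIn_five ab ap aq ar bp bq br pq pr qr]
  have i := G.ind_le
  have key : ∀ x y z, x ≠ y → x ≠ z → y ≠ z → a ≠ x → a ≠ y → a ≠ z → b ≠ x → b ≠ y → b ≠ z →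
      v ≠ x → v ≠ y → v ≠ z → G.ind a x + G.ind x y + G.ind y z + G.ind b z ≤ 3 := by
    intro x y z xy xz yz ax ay az bx b_y bz vx vy vz
    have := i a x; have := i x y; have := i y z; have := i b z
    by_contra hlt
    exact hH hva (ind_pos (a := a) (b := x) (by omega)) (ind_pos (a := x) (b := y) (by omega))
      (ind_pos (a := y) (b := z) (by omega)) (ind_pos (a := b) (b := z) (by omega)).symm
      hvb.symm vx vy vz ay az ab xz bx.symm b_y.symm
  have h1 := key p q r pq pr qr ap aq ar bp bq br vp vq vr
  have h2 := key p r q pr pq qr.symm ap ar aq bp br bq vp vr vq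
  have h3 := key q p r pq.symm qr pr aq ap ar bq bp br vq vp vr
  have h4 := key q r p qr pq.symm pr.symm aq ar ap bq br bp vq vr vp
  have h5 := key r p q pr.symm qr.symm pq ar ap aq br bp bq vr vp vq
  have h6 := key r q p qr.symm pr.symm pq.symm ar aq ap br bq bp vr vq vp
  simp only [ind_comm q p, ind_comm r p, ind_comm r q] at *
  have := i a b; have := i a p; have := i a q; have := i a r; have := i b p
  have := i b q; have := i b r; have := i p q; have := i p r; have := i q r
  omega

lemma NoHexagon.dartsIn_four_le (hH : G.NoHexagon) {u v a b : V} {W : Finset V}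
    (hW : W.card = 4) (hu : u ∉ W) (hv : v ∉ W) (ha : a ∈ W) (hb : b ∈ W) (ab : a ≠ b)
    (huv : G.Adj u v) (hua : G.Adj u a) (hvb : G.Adj v b) : G.dartsIn W ≤ 10 := by
  have hc : ((W.erase a).erase b).card = 2 := by
    rw [Finset.card_erase_of_mem (Finset.mem_erase.2 ⟨ab.symm, hb⟩), Finset.card_erase_of_mem ha,
      hW]
  obtain ⟨p, q, pq, hs⟩ := Finset.card_eq_two.1 hc
  have hW' : W = {a, b, p, q} := by
    rw [← hs, Finset.insert_erase (Finset.mem_erase.2 ⟨ab.symm, hb⟩), Finset.insert_erase ha]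
  have hn : a ∉ ({p, q} : Finset V) ∧ b ∉ ({p, q} : Finset V) := by simp [← hs]
  subst hW'
  simp only [Finset.mem_insert, Finset.mem_singleton, not_or] at hn hu hv
  obtain ⟨⟨ap, aq⟩, bp, bq⟩ := hn
  obtain ⟨-, ub, up, uq⟩ := hu
  obtain ⟨va, -, vp, vq⟩ := hv
  rw [dartsIn_four ab ap aq bp bq pq]
  have i := G.ind_le
  have := hH.ind_add_le huv hua hvb ub va ab aq bp up uq vp vq
  have := i a b; have := i a p; have := i a q; have := i b p; have := i b q; have := i p q
  omega

lemma NoHexagon.dartsIn_five_le_of_edge (hH : G.NoHexagon) {u v a b : V} {W : Finset V}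
    (hW : W.card = 5) (hu : u ∉ W) (hv : v ∉ W) (ha : a ∈ W) (hb : b ∈ W) (ab : a ≠ b)
    (huv : G.Adj u v) (hua : G.Adj u a) (hvb : G.Adj v b) : G.dartsIn W ≤ 14 := by
  have hc : ((W.erase a).erase b).card = 3 := by
    rw [Finset.card_erase_of_mem (Finset.mem_erase.2 ⟨ab.symm, hb⟩), Finset.card_erase_of_mem ha,
      hW]
  obtain ⟨p, q, r, pq, pr, qr, hs⟩ := Finset.card_eq_three.1 hc
  have hW' : W = {a, b, p, q, r} := by
    rw [← hs, Finset.insert_erase (Finset.mem_erase.2 ⟨ab.symm, hb⟩), Finset.insert_erase ha]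
  have hn : a ∉ ({p, q, r} : Finset V) ∧ b ∉ ({p, q, r} : Finset V) := by simp [← hs]
  subst hW'
  simp only [Finset.mem_insert, Finset.mem_singleton, not_or] at hn hu hv
  obtain ⟨⟨ap, aq, ar⟩, bp, bq, br⟩ := hn
  obtain ⟨-, ub, up, uq, ur⟩ := hu
  obtain ⟨va, -, vp, vq, vr⟩ := hv
  rw [dartsIn_five ab ap aq ar bp bq br pq pr qr]
  have i := G.ind_le
  have key := fun x y => hH.ind_add_le (x := x) (y := y) huv hua hvb ub va ab
  have h1 := key p q aq bp up uq vp vq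
  have h2 := key p r ar bp up ur vp vr
  have h3 := key q r ar bq uq ur vq vr
  have h4 := key q p ap bq uq up vq vp
  have h5 := key r p ap br ur up vr vp
  have h6 := key r q aq br ur uq vr vq
  simp only [ind_comm q p, ind_comm r p, ind_comm r q] at *
  have := i a b; have := i a p; have := i a q; have := i a r; have := i b p
  have := i b q; have := i b r; have := i p q; have := i p r; have := i q r
  omega

end SimpleGraph

namespace SimpleGraph

variable {V : Type*} {G : SimpleGraph V}

lemma two_mul_ncard_edgeSet_comap (W : Finset V) :
    2 * (G.comap ((↑) : W → V)).edgeSet.ncard = G.dartsIn W := by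
  classical
  rw [← card_adj_pairs, Finset.card_filter, Fintype.sum_prod_type, dartsIn,
    ← Finset.sum_coe_sort W]
  refine Finset.sum_congr rfl fun a _ => ?_
  rw [degIn, ← Finset.sum_coe_sort W]
  refine Finset.sum_congr rfl fun b _ => ?_
  simp [ind]

lemma NoHexagon.comap (hH : G.NoHexagon) {W : Type*} {f : W → V} (hf : Function.Injective f) :
    (G.comap f).NoHexagon :=
  fun ab bc cd de ef fa ac ad ae bd be b_f ce cf df => hH ab bc cd de ef fa (hf.ne ac) (hf.ne ad)
    (hf.ne ae) (hf.ne bd) (hf.ne be) (hf.ne b_f) (hf.ne ce) (hf.ne cf) (hf.ne df)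

/-- A planar graph has no complete subgraph on five vertices. -/
lemma HasPlanarEmbedding.noFiveClique (h : G.HasPlanarEmbedding) : G.NoFiveClique := by
  classical
  intro a b c d e ab ac ad ae bc bd be cd ce de
  have hadj : ∀ i j : Fin 5, i ≠ j → G.Adj (![a, b, c, d, e] i) (![a, b, c, d, e] j) := by
    intro i j hij
    fin_cases i <;> fin_cases j <;> first | exact absurd rfl hij | skip
    exacts [ab, ac, ad, ae, ab.symm, bc, bd, be, ac.symm, bc.symm, cd, ce, ad.symm, bd.symm,
      cd.symm, de, ae.symm, be.symm, ce.symm, de.symm]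
  have hinj : Function.Injective ![a, b, c, d, e] := fun i j hij => by
    by_contra hne
    exact (hadj i j hne).ne hij
  have hp := hasPlanarEmbedding_comap h hinj
  have htop : G.comap ![a, b, c, d, e] = ⊤ := by
    ext i j
    exact ⟨fun h => h.ne, hadj i j⟩
  rw [htop] at hp
  obtain ⟨κ, _, ⟨S⟩⟩ := hp.exists_faceSystem
    (fun v S _ hS hcl x => by
      obtain ⟨s, hs⟩ := hS
      by_cases hx : x = s
      · exact Or.inl (hx ▸ hs)
      · exact hcl s hs x (Ne.symm hx))
    (fun v w _ => by
      obtain ⟨w', h1, h2⟩ : ∃ w', w' ≠ w ∧ v ≠ w' := by revert v w; decide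
      exact ⟨w', h1, h2⟩)
    (a := 0) (b := 1) (by simp)
  have := S.edge_bound_of_planar
  have h1 : (⊤ : SimpleGraph (Fin 5)).edgeSet.ncard = 10 := by
    rw [Set.ncard_eq_toFinset_card', ← edgeFinset, card_edgeFinset_top_eq_card_choose_two]
    rfl
  rw [h1, Fintype.card_fin] at this
  omega

lemma dartsIn_le_of_noCutVertex [DecidableEq V] (hP : G.HasPlanarEmbedding) (hH : G.NoHexagon)
    {W : Finset V} (h6 : 6 ≤ W.card) (hdeg : ∀ v ∈ W, ∀ a b, ∃ w ∈ W, G.Adj v w ∧ w ≠ a ∧ w ≠ b)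
    (h3 : ∀ u ∈ W, ∀ v ∈ W, G.Adj u v → ∀ s t : Finset V, s.card ≤ 3 → t.card ≤ 3 →
      (∀ w ∈ W, G.Adj u w → w ∈ s) → (∀ w ∈ W, G.Adj v w → w ∈ t) → False)
    (hcut : NoCutVertex (G.comap ((↑) : W → V))) :
    7 * G.dartsIn W + 72 ≤ 36 * W.card := by
  have hP' := hasPlanarEmbedding_comap hP (Subtype.val_injective (p := (· ∈ W)))
  have hdeg' : ∀ v a b : W, ∃ w : W, (G.comap ((↑) : W → V)).Adj v w ∧ w ≠ a ∧ w ≠ b := by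
    intro v a b
    obtain ⟨w, hw, h, ha, hb⟩ := hdeg v v.2 a b
    exact ⟨⟨w, hw⟩, h, fun h => ha (congrArg Subtype.val h),
      fun h => hb (congrArg Subtype.val h)⟩
  have hthree : ∀ v : W, (G.comap ((↑) : W → V)).DegLeThree v →
      ∃ s : Finset V, s.card ≤ 3 ∧ ∀ w ∈ W, G.Adj v w → w ∈ s := by
    rintro v ⟨a, b, c, h⟩
    refine ⟨{a.1, b.1, c.1}, Finset.card_le_three, fun w hw hvw => ?_⟩
    have := h ⟨w, hw⟩ hvw
    rw [Subtype.ext_iff, Subtype.ext_iff, Subtype.ext_iff] at this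
    simpa only [Finset.mem_insert, Finset.mem_singleton] using this
  have hred : Reduced (G.comap ((↑) : W → V)) := by
    refine ⟨hH.comap Subtype.val_injective, ?_, hdeg', hP'.noFiveClique, ?_, ?_⟩
    · intro u v huv hu hv
      obtain ⟨s, hs, hus⟩ := hthree u hu
      obtain ⟨t, ht, hvt⟩ := hthree v hv
      exact h3 u u.2 v v.2 huv s t hs ht hus hvt
    · intro a b c d e
      have : ({a, b, c, d, e} : Finset W).card < (Finset.univ : Finset W).card := by
        rw [Finset.card_univ, Fintype.card_coe]
        exact Finset.card_le_five.trans_lt h6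
      obtain ⟨w, -, hw⟩ := Finset.exists_mem_notMem_of_card_lt_card this
      exact ⟨w, by simpa using hw⟩
    · intro S hS hcl x
      by_contra hx
      obtain ⟨w, hw, hwx, -⟩ := hdeg' x x x
      rcases hcut x S hx hS (fun a ha b hab => Or.inl (hcl a ha b hab)) w with h | h
      · exact hx (hcl w h x hw.symm)
      · exact hwx h
  obtain ⟨v, hv⟩ : W.Nonempty := Finset.card_pos.1 (by omega)
  obtain ⟨w, hw, -⟩ := hdeg' ⟨v, hv⟩ ⟨v, hv⟩ ⟨v, hv⟩
  obtain ⟨κ, _, ⟨S⟩⟩ := hP'.exists_faceSystem hcut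
    (fun v w _ => by
      obtain ⟨w', h1, h2, -⟩ := hdeg' v w w
      exact ⟨w', h2, h1⟩) hw
  have := S.edge_bound hred
  rw [Fintype.card_coe] at this
  have := two_mul_ncard_edgeSet_comap (G := G) W
  omega

/-- The edge bound, for all vertex sets with at least six elements. -/
theorem dartsIn_le (hP : G.HasPlanarEmbedding) (hH : G.NoHexagon) (W : Finset V) :
    6 ≤ W.card → 7 * G.dartsIn W + 72 ≤ 36 * W.card := by
  classical
  have hK : G.NoFiveClique := hP.noFiveClique
  induction W using Finset.strongInduction with | H W ih =>
  intro h6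
  by_cases hdeg : ∀ v ∈ W, ∀ a b, ∃ w ∈ W, G.Adj v w ∧ w ≠ a ∧ w ≠ b
  swap
  · push Not at hdeg
    obtain ⟨v, hv, a, b, hab⟩ := hdeg
    obtain ⟨U, hvU, rfl⟩ : ∃ U, v ∉ U ∧ insert v U = W :=
      ⟨W.erase v, Finset.notMem_erase v W, Finset.insert_erase hv⟩
    rw [Finset.card_insert_of_notMem hvU] at h6 ⊢
    rw [dartsIn_insert hvU]
    have hd := degIn_le (G := G) (v := v) (W := U) (s := {a, b}) fun w hw hvw => by
      by_cases hwa : w = a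
      · simp [hwa]
      · simp [hab w (Finset.mem_insert_of_mem hw) hvw hwa]
    have hd2 := hd.trans Finset.card_le_two
    rcases le_or_gt 6 U.card with h | h
    · have := ih U (Finset.ssubset_insert hvU) h
      omega
    · have h5 := dartsIn_le_of_card_le_five hK (W := U) (by omega) (by omega)
      by_cases h1 : G.degIn v U ≤ 1
      · omega
      · rw [degIn_eq_card, not_le, Finset.one_lt_card] at h1
        obtain ⟨x, hx, y, hy, hxy⟩ := h1
        rw [Finset.mem_filter] at hx hy
        have := hH.dartsIn_five_le (by omega) hvU hx.1 hy.1 hxy hx.2 hy.2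
        omega
  by_cases h3 : ∀ u ∈ W, ∀ v ∈ W, G.Adj u v → ∀ s t : Finset V, s.card ≤ 3 → t.card ≤ 3 →
      (∀ w ∈ W, G.Adj u w → w ∈ s) → (∀ w ∈ W, G.Adj v w → w ∈ t) → False
  swap
  · push Not at h3
    obtain ⟨u, hu, v, hv, huv, s, t, hs, ht, hus, hvt, -⟩ := h3
    obtain ⟨a, ha, hua, hav, -⟩ := hdeg u hu v v
    obtain ⟨b, hb, hvb, hbu, hba⟩ := hdeg v hv u a
    have hvs := hus v hv huv
    have hut := hvt u hu huv.symm
    obtain ⟨U, huU, hvU, rfl⟩ : ∃ U, u ∉ U ∧ v ∉ U ∧ insert u (insert v U) = W :=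
      ⟨(W.erase u).erase v, by simp, by simp, by
        rw [Finset.insert_erase (Finset.mem_erase.2 ⟨huv.ne', hv⟩), Finset.insert_erase hu]⟩
    have huv' : u ∉ insert v U := by simp [huv.ne, huU]
    have d1 := degIn_le (G := G) (v := u) (W := insert v U) (s := s) fun w hw =>
      hus w (Finset.mem_insert_of_mem hw)
    have d2 := degIn_le (G := G) (v := v) (W := U) (s := t.erase u) fun w hw hvw =>
      Finset.mem_erase.2 ⟨fun h => huU (h ▸ hw),
        hvt w (Finset.mem_insert_of_mem (Finset.mem_insert_of_mem hw)) hvw⟩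
    rw [Finset.card_erase_of_mem hut] at d2
    have haU : a ∈ U := by simpa [hua.ne', hav] using ha
    have hbU : b ∈ U := by simpa [hvb.ne', hbu] using hb
    rw [Finset.card_insert_of_notMem huv', Finset.card_insert_of_notMem hvU] at h6 ⊢
    rw [dartsIn_insert huv', dartsIn_insert hvU]
    obtain h | h | h : U.card = 4 ∨ U.card = 5 ∨ 6 ≤ U.card := by omega
    · have := hH.dartsIn_four_le h huU hvU haU hbU hba.symm huv hua hvb
      omega
    · have := hH.dartsIn_five_le_of_edge h huU hvU haU hbU hba.symm huv hua hvb
      omega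
    · have := ih U ((Finset.ssubset_insert hvU).trans (Finset.ssubset_insert huv')) h
      omega
  by_cases hcut : NoCutVertex (G.comap ((↑) : W → V))
  · exact dartsIn_le_of_noCutVertex hP hH h6 hdeg h3 hcut
  · unfold NoCutVertex at hcut
    push Not at hcut
    obtain ⟨v, S, hvS, ⟨s, hs⟩, hcl, x, hxS, hxv⟩ := hcut
    have small : ∀ U ⊂ W, 2 ≤ U.card → 7 * G.dartsIn U + 54 ≤ 36 * U.card := by
      intro U hU h2
      rcases le_or_gt 6 U.card with h | h
      · have := ih U hU h
        omega
      · exact dartsIn_le_of_card_le_five hK h2 (by omega)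
    obtain ⟨A, hA⟩ : ∃ A : Finset V, ∀ y, y ∈ A ↔ ∃ h : y ∈ W, (⟨y, h⟩ : W) ∈ S :=
      ⟨W.filter fun y => ∃ h : y ∈ W, (⟨y, h⟩ : W) ∈ S, by
        intro y
        rw [Finset.mem_filter]
        exact ⟨fun h => h.2, fun h => ⟨h.1, h⟩⟩⟩
    obtain ⟨B, hB⟩ : ∃ B : Finset V, ∀ y, y ∈ B ↔ y ∈ W ∧ y ∉ A ∧ y ≠ v :=
      ⟨W.filter fun y => y ∉ A ∧ y ≠ v, by simp⟩
    have hvA : v.1 ∉ A := fun h => hvS ((hA _).1 h).2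
    have hvB : v.1 ∉ B := fun h => ((hB _).1 h).2.2 rfl
    have hsA : s.1 ∈ A := (hA _).2 ⟨s.2, hs⟩
    have hxB : x.1 ∈ B := (hB _).2 ⟨x.2, fun h => hxS ((hA _).1 h).2, fun h => hxv (Subtype.ext h)⟩
    have hd : Disjoint A B := Finset.disjoint_left.2 fun y h1 h2 => ((hB y).1 h2).2.1 h1
    have hAB : ∀ a ∈ A, ∀ b ∈ B, ¬ G.Adj a b := by
      intro a ha b hb hab
      obtain ⟨haW, haS⟩ := (hA a).1 ha
      obtain ⟨hbW, hbA, hbv⟩ := (hB b).1 hb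
      rcases hcl ⟨a, haW⟩ haS ⟨b, hbW⟩ hab with h | h
      · exact hbA ((hA b).2 ⟨hbW, h⟩)
      · exact hbv (congrArg Subtype.val h)
    have hW : insert v.1 (A ∪ B) = W := by
      ext y
      rw [Finset.mem_insert, Finset.mem_union, hB]
      constructor
      · rintro (rfl | h | h)
        exacts [v.2, ((hA y).1 h).1, h.1]
      · intro h
        by_cases h1 : y = v <;> by_cases h2 : y ∈ A <;> simp [h, h1, h2]
    have hc : W.card = A.card + B.card + 1 := by
      rw [← hW, Finset.card_insert_of_notMem (by simp [hvA, hvB]), Finset.card_union_of_disjoint hd]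
    have hA1 : 0 < A.card := Finset.card_pos.2 ⟨_, hsA⟩
    have hB1 : 0 < B.card := Finset.card_pos.2 ⟨_, hxB⟩
    have cA := Finset.card_insert_of_notMem hvA
    have cB := Finset.card_insert_of_notMem hvB
    have hAW : insert v.1 A ⊆ W :=
      (Finset.insert_subset_insert _ Finset.subset_union_left).trans hW.le
    have hBW : insert v.1 B ⊆ W :=
      (Finset.insert_subset_insert _ Finset.subset_union_right).trans hW.le
    have h1 := small (insert v.1 A)
      ⟨hAW, fun h => by have := Finset.card_le_card h; omega⟩ (by omega)
    have h2 := small (insert v.1 B)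
      ⟨hBW, fun h => by have := Finset.card_le_card h; omega⟩ (by omega)
    have := dartsIn_insert_union hvA hvB hd hAB
    rw [hW] at this
    omega

lemma noHexagon_of_not_containsCopy (h : ¬ ContainsCopy cycle6 G) : G.NoHexagon := by
  intro a b c d e f ab bc cd de ef fa ac ad ae bd be b_f ce cf df
  refine h ⟨⟨![a, b, c, d, e, f], ?_⟩, ?_⟩
  · intro i j hij
    fin_cases i <;> fin_cases j <;>
      first
        | exact ab | exact bc | exact cd | exact de | exact ef | exact fa
        | exact ab.symm | exact bc.symm | exact cd.symm | exact de.symm | exact ef.symm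
        | exact fa.symm
        | simp [cycle6] at hij
  · have : ∀ i j : Fin 6, i < j → ![a, b, c, d, e, f] i ≠ ![a, b, c, d, e, f] j := by
      intro i j hij
      fin_cases i <;> fin_cases j <;> first | exact absurd hij (by decide) | skip
      exacts [ab.ne, ac, ad, ae, fa.ne', bc.ne, bd, be, b_f, cd.ne, ce, cf, de.ne, df, ef.ne]
    intro i j hij
    rcases lt_trichotomy i j with h | h | h
    exacts [absurd hij (this i j h), h, absurd hij.symm (this j i h)]

end SimpleGraph

/-- For every `n ≥ 6`, every planar simple graph on `n` vertices containing no 6-cycle as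
a subgraph has at most `18(n-2)/7` edges. -/
theorem planar_turan_c6 (n : ℕ) (hn : 6 ≤ n)
    (V : Type*) [Fintype V] (G : SimpleGraph V) (hcard : Fintype.card V = n)
    (hplanar : G.HasPlanarEmbedding) (hfree : ¬ ContainsCopy cycle6 G) :
    (G.edgeSet.ncard : ℝ) ≤ 18 * ((n : ℝ) - 2) / 7 := by
  classical
  have h := dartsIn_le hplanar (noHexagon_of_not_containsCopy hfree) Finset.univ
    (by rw [Finset.card_univ, hcard]; exact hn)
  have h2 : 2 * G.edgeSet.ncard = G.dartsIn Finset.univ := by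
    rw [← card_adj_pairs, Finset.card_filter, Fintype.sum_prod_type]
    rfl
  rw [← h2, Finset.card_univ, hcard] at h
  have h' : (7 * (2 * G.edgeSet.ncard) + 72 : ℝ) ≤ 36 * n := by exact_mod_cast h
  linarith
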